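/- Parabolic Harnack inequality: for all p, q ∈ (1,∞) with 1/p + 1/q < 2/d there exist positive constants c₁, c₂ and κ, depending only on d, p, q, C_reg and C_riso, such that the following holds for every choice of edge weights ω, every x₀ ∈ V, t₀ ≥ 0, n ≥ 1 and every function u : [t₀,t₀+n²] × V → (0,∞) that is caloric on [t₀,t₀+n²] × B(x₀,n). Set M := max{1, ‖μ^ω‖_{1,B(x₀,n)}/‖μ^ω‖_{1,B(x₀,n/2)}}. Then for all (t,x) ∈ [t₀+n²/4, t₀+n²/2] × B(x₀,n/2) and all (t′,x′) ∈ [t₀+3n²/4, t₀+n²] × B(x₀,n/2): u(t,x) ≤ c₁·exp(c₂·(M·max{1,‖μ^ω‖_{p,B(x₀,n)}}·max{1,‖ν^ω‖_{q,B(x₀,n)}})^κ)·u(t′,x′). -/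

import Mathlib

open Finset MeasureTheory
open scoped ENNReal

noncomputable section

namespace RCM

variable {V : Type*}

/-- `μ^ω(x)`, the sum of the weights of edges incident to `x`. -/
def mu (nbr : V → Finset V) (ω : V → V → ℝ) (x : V) : ℝ := ∑ y ∈ nbr x, ω x y

/-- `ν^ω(x)`, the sum of the reciprocals of the weights of edges incident to `x`. -/
def nu (nbr : V → Finset V) (ω : V → V → ℝ) (x : V) : ℝ := ∑ y ∈ nbr x, (ω x y)⁻¹

/-- `(L_Y^ω f)(x)`. -/
def lap (nbr : V → Finset V) (ω : V → V → ℝ) (f : V → ℝ) (x : V) : ℝ :=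
  (mu nbr ω x)⁻¹ * ∑ y ∈ nbr x, ω x y * (f y - f x)

/-- space-averaged norm `‖f‖_{p,A}` for a real exponent `p`. -/
def nrm (A : Finset V) (p : ℝ) (f : V → ℝ) : ℝ :=
  ((A.card : ℝ)⁻¹ * ∑ x ∈ A, |f x| ^ p) ^ (1 / p)

/-- weighted space-averaged norm `‖f‖_{p,A,φ}` for a real exponent `p`. -/
def nrmW (A : Finset V) (p : ℝ) (φ : V → ℝ) (f : V → ℝ) : ℝ :=
  ((A.card : ℝ)⁻¹ * ∑ x ∈ A, |f x| ^ p * φ x) ^ (1 / p)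

/-- space-averaged norm `‖f‖_{p,A}` for an extended exponent `p ∈ (0,∞]`;
for `p = ∞` this is the maximum of `|f|` over `A`. -/
def nrmE (A : Finset V) (p : ℝ≥0∞) (f : V → ℝ) : ℝ :=
  if p = ⊤ then sSup ((fun x => |f x|) '' (A : Set V)) else nrm A p.toReal f

/-- weighted average `(u)_{A,π}`. -/
def wavg (A : Finset V) (π : V → ℝ) (u : V → ℝ) : ℝ :=
  (∑ x ∈ A, π x * u x) / ∑ x ∈ A, π x

open Classical in
/-- relative internal boundary `∂_B A`. -/
def relBdry (G : SimpleGraph V) (B A : Finset V) : Finset V :=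
  A.filter fun z => ∃ y ∈ B, y ∉ A ∧ G.Adj z y

open Classical in
/-- internal boundary `∂B`. -/
def intBdry (G : SimpleGraph V) (B : Finset V) : Finset V :=
  B.filter fun z => ∃ y, y ∉ B ∧ G.Adj z y

open Classical in
/-- Dirichlet sum `Σ_{x,y ∈ B, x∼y} ω(x,y) (u(x)-u(y))²`. -/
def dSum (G : SimpleGraph V) (ω : V → V → ℝ) (B : Finset V) (u : V → ℝ) : ℝ :=
  ∑ x ∈ B, ∑ y ∈ B, if G.Adj x y then ω x y * (u x - u y) ^ 2 else 0

/-- `E^ω_{η²}(u) = (1/2) Σ_{x,y} η(x)² ω(x,y) (u(y)-u(x))²`. -/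
def energySq (ω : V → V → ℝ) (η u : V → ℝ) : ℝ :=
  (1 / 2) * ∑' x, ∑' y, η x ^ 2 * ω x y * (u y - u x) ^ 2

/-- `E^{ω,η}(u) = (1/2) Σ_{x,y} min(η(x)²,η(y)²) ω(x,y) (u(y)-u(x))²`. -/
def energyMin (ω : V → V → ℝ) (η u : V → ℝ) : ℝ :=
  (1 / 2) * ∑' x, ∑' y, min (η x ^ 2) (η y ^ 2) * ω x y * (u y - u x) ^ 2

/-- `‖∇η‖_{ℓ∞(E)}`, the supremum of `|η(y)-η(x)|` over edges `{x,y}`. -/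
def gradSup (G : SimpleGraph V) (η : V → ℝ) : ℝ :=
  sSup {r : ℝ | ∃ x y, G.Adj x y ∧ r = |η y - η x|}

/-- `u` is caloric on `I × B`: `∂_t u = L_Y^ω u` on `I × B`. -/
def Caloric (nbr : V → Finset V) (ω : V → V → ℝ) (I : Set ℝ) (B : Set V)
    (u : ℝ → V → ℝ) : Prop :=
  ∀ x ∈ B, ∀ t ∈ I, HasDerivAt (fun s => u s x) (lap nbr ω (u t) x) t

/-- `u` is sub-caloric on `I × B`: `∂_t u ≤ L_Y^ω u` on `I × B`. -/
def SubCaloric (nbr : V → Finset V) (ω : V → V → ℝ) (I : Set ℝ) (B : Set V)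
    (u : ℝ → V → ℝ) : Prop :=
  ∀ x ∈ B, ∀ t ∈ I, ∃ d, HasDerivAt (fun s => u s x) d t ∧ d ≤ lap nbr ω (u t) x

/-- `u` is super-caloric on `I × B`: `∂_t u ≥ L_Y^ω u` on `I × B`. -/
def SuperCaloric (nbr : V → Finset V) (ω : V → V → ℝ) (I : Set ℝ) (B : Set V)
    (u : ℝ → V → ℝ) : Prop :=
  ∀ x ∈ B, ∀ t ∈ I, ∃ d, HasDerivAt (fun s => u s x) d t ∧ lap nbr ω (u t) x ≤ d

/-- space-time norm `‖u‖_{p,[a,b]×B,φ}`. -/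
def nrmST (a b : ℝ) (B : Finset V) (p : ℝ) (φ : V → ℝ) (u : ℝ → V → ℝ) : ℝ :=
  ((b - a)⁻¹ * ∫ t in a..b, nrmW B p φ (u t) ^ p) ^ (1 / p)

end RCM

namespace RCM

/-- A connected weighted graph with volume regularity and the relative isoperimetric inequality. -/
structure Env (d : ℕ) (Creg Criso : ℝ) {V : Type} (G : SimpleGraph V) (nbr : V → Finset V)
    (ball : V → ℝ → Finset V) (ω : V → V → ℝ) : Prop where
  two_le : 2 ≤ d
  Creg_pos : 0 < Creg
  Criso_pos : 0 < Criso
  mem_nbr : ∀ x y, y ∈ nbr x ↔ G.Adj x y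
  infinite : Infinite V
  conn : G.Connected
  mem_ball : ∀ (x : V) (r : ℝ) (y : V), y ∈ ball x r ↔ (G.dist x y : ℝ) ≤ r
  vol : ∀ (x : V) (r : ℝ), 1 ≤ r →
    Creg⁻¹ * r ^ d ≤ ((ball x r).card : ℝ) ∧ ((ball x r).card : ℝ) ≤ Creg * r ^ d
  iso : ∀ (x : V) (r : ℝ) (A : Finset V), 1 ≤ r → A.Nonempty → A ⊆ ball x r →
    (A.card : ℝ) < ((ball x r).card : ℝ) / 2 →
    Criso / r ≤ ((relBdry G (ball x r) A).card : ℝ) / (A.card : ℝ)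
  symm : ∀ x y, ω x y = ω y x
  pos : ∀ x y, G.Adj x y → 0 < ω x y
  zero : ∀ x y, ¬ G.Adj x y → ω x y = 0

section Basic

variable {d : ℕ} {Creg Criso : ℝ} {V : Type} {G : SimpleGraph V} {nbr : V → Finset V}
  {ball : V → ℝ → Finset V} {ω : V → V → ℝ}

lemma Env.omega_nonneg (h : Env d Creg Criso G nbr ball ω) (x y : V) : 0 ≤ ω x y := by
  by_cases hxy : G.Adj x y
  · exact (h.pos x y hxy).le
  · exact (h.zero x y hxy).ge

lemma Env.one_le_Creg (h : Env d Creg Criso G nbr ball ω) : 1 ≤ Creg := by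
  obtain ⟨x⟩ := h.conn.nonempty
  have h1 := h.vol x 1 le_rfl
  have h2 : Creg⁻¹ ≤ Creg := by
    have := h1.1.trans h1.2
    simpa using this
  have h3 := h.Creg_pos
  by_contra hc
  push Not at hc
  have : 1 < Creg⁻¹ := (one_lt_inv₀ h3).2 hc
  linarith

lemma Env.dist_le_succ (h : Env d Creg Criso G nbr ball ω) {x y z : V} (hyz : G.Adj y z) :
    (G.dist x z : ℝ) ≤ G.dist x y + 1 := by
  have h1 := h.conn.dist_triangle (u := x) (v := y) (w := z)
  rw [SimpleGraph.dist_eq_one_iff_adj.2 hyz] at h1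
  exact_mod_cast h1

lemma Env.abs_dist_sub_le (h : Env d Creg Criso G nbr ball ω) {x y z : V} (hyz : G.Adj y z) :
    |(G.dist x y : ℝ) - G.dist x z| ≤ 1 := by
  rw [abs_le]
  have h1 := h.dist_le_succ (x := x) hyz
  have h2 := h.dist_le_succ (x := x) hyz.symm
  constructor <;> linarith

lemma Env.ball_mono (h : Env d Creg Criso G nbr ball ω) (x : V) {r s : ℝ} (hrs : r ≤ s) :
    ball x r ⊆ ball x s := fun y hy =>
  (h.mem_ball x s y).2 (((h.mem_ball x r y).1 hy).trans hrs)

lemma Env.nbr_subset_ball (h : Env d Creg Criso G nbr ball ω) {x y : V} {r s : ℝ}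
    (hrs : r + 1 ≤ s) (hy : y ∈ ball x r) : nbr y ⊆ ball x s := fun z hz => by
  have h1 := h.dist_le_succ (x := x) ((h.mem_nbr y z).1 hz)
  have h2 := (h.mem_ball x r y).1 hy
  exact (h.mem_ball x s z).2 (by linarith)

lemma Env.mem_ball_comm (h : Env d Creg Criso G nbr ball ω) (x y : V) (r : ℝ) :
    y ∈ ball x r ↔ x ∈ ball y r := by
  rw [h.mem_ball, h.mem_ball, SimpleGraph.dist_comm]

lemma Env.exists_adj (h : Env d Creg Criso G nbr ball ω) (x : V) : ∃ y, G.Adj x y := by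
  have := h.infinite
  obtain ⟨z, hz⟩ := exists_ne x
  exact (h.conn.preconnected.exists_adj_of_nontrivial x)

lemma Env.mu_pos (h : Env d Creg Criso G nbr ball ω) (x : V) : 0 < mu nbr ω x := by
  obtain ⟨y, hy⟩ := h.exists_adj x
  exact sum_pos (fun z hz => h.pos x z ((h.mem_nbr x z).1 hz)) ⟨y, (h.mem_nbr x y).2 hy⟩

lemma Env.nu_pos (h : Env d Creg Criso G nbr ball ω) (x : V) : 0 < nu nbr ω x := by
  obtain ⟨y, hy⟩ := h.exists_adj x
  exact sum_pos (fun z hz => inv_pos.2 (h.pos x z ((h.mem_nbr x z).1 hz)))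
    ⟨y, (h.mem_nbr x y).2 hy⟩

lemma Env.omega_le_mu (h : Env d Creg Criso G nbr ball ω) {x y : V} (hxy : G.Adj x y) :
    ω x y ≤ mu nbr ω x :=
  single_le_sum (f := fun y => ω x y) (fun z _ => h.omega_nonneg x z) ((h.mem_nbr x y).2 hxy)

lemma Env.inv_omega_le_nu (h : Env d Creg Criso G nbr ball ω) {x y : V} (hxy : G.Adj x y) :
    (ω x y)⁻¹ ≤ nu nbr ω x :=
  single_le_sum (f := fun y => (ω x y)⁻¹) (fun z _ => inv_nonneg.2 (h.omega_nonneg x z))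
    ((h.mem_nbr x y).2 hxy)

lemma Env.one_le_mu_mul_nu (h : Env d Creg Criso G nbr ball ω) (x : V) :
    1 ≤ mu nbr ω x * nu nbr ω x := by
  obtain ⟨y, hy⟩ := h.exists_adj x
  have h0 := h.pos x y hy
  calc 1 = ω x y * (ω x y)⁻¹ := (mul_inv_cancel₀ h0.ne').symm
    _ ≤ _ := mul_le_mul (h.omega_le_mu hy) (h.inv_omega_le_nu hy) (inv_nonneg.2 h0.le)
      (h.mu_pos x).le

lemma Env.sum_nbr_eq (h : Env d Creg Criso G nbr ball ω) {x : V} {F : Finset V}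
    (hF : nbr x ⊆ F) (g : V → ℝ) :
    ∑ y ∈ nbr x, ω x y * g y = ∑ y ∈ F, ω x y * g y := by
  refine sum_subset hF fun y _ hy => ?_
  rw [h.zero x y (fun hxy => hy ((h.mem_nbr x y).2 hxy)), zero_mul]

lemma Env.mu_mul_lap (h : Env d Creg Criso G nbr ball ω) {x : V} {F : Finset V}
    (hF : nbr x ⊆ F) (f : V → ℝ) :
    mu nbr ω x * lap nbr ω f x = ∑ y ∈ F, ω x y * (f y - f x) := by
  rw [lap, ← mul_assoc, mul_inv_cancel₀ (h.mu_pos x).ne', one_mul, h.sum_nbr_eq hF]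

/-- Sums of `ω x ·` over any finite set are at most `μ x`. -/
lemma Env.sum_omega_le (h : Env d Creg Criso G nbr ball ω) (x : V) (F : Finset V) :
    ∑ y ∈ F, ω x y ≤ mu nbr ω x := by
  classical
  have h1 : ∑ y ∈ nbr x, ω x y = ∑ y ∈ F ∪ nbr x, ω x y := by
    have := h.sum_nbr_eq (x := x) (F := F ∪ nbr x) subset_union_right (fun _ => 1)
    simpa using this
  rw [mu, h1]
  exact sum_le_sum_of_subset_of_nonneg subset_union_left fun y _ _ => h.omega_nonneg x y

end Basic

section Coarea

variable {V : Type}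

open Classical in
/-- Indicator function of a finite set. -/
def ind (A : Finset V) (x : V) : ℝ := if x ∈ A then 1 else 0

open Classical in
/-- Indicator of adjacency. -/
def adj1 (G : SimpleGraph V) (x y : V) : ℝ := if G.Adj x y then 1 else 0

lemma adj1_nonneg (G : SimpleGraph V) (x y : V) : 0 ≤ adj1 G x y := by
  unfold adj1; split_ifs <;> norm_num

/-- An inequality between a sublinear functional and the total variation follows from the
corresponding inequality for indicator functions. -/
lemma coarea_bound (F : Finset V) (a : V → V → ℝ) (N : (V → ℝ) → ℝ)
    (hadd : ∀ f g : V → ℝ, (∀ x, 0 ≤ f x) → (∀ x, 0 ≤ g x) → N (fun x => f x + g x) ≤ N f + N g)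
    (hsmul : ∀ (c : ℝ) (f : V → ℝ), 0 ≤ c → N (fun x => c * f x) = c * N f)
    (C : ℝ) (A₀ : Finset V)
    (hset : ∀ A ⊆ A₀, A.Nonempty →
      N (ind A) ≤ C * ∑ x ∈ F, ∑ y ∈ F, a x y * |ind A x - ind A y|)
    (g : V → ℝ) (hg : ∀ x, 0 ≤ g x) (hg0 : ∀ x, x ∉ A₀ → g x = 0) :
    N g ≤ C * ∑ x ∈ F, ∑ y ∈ F, a x y * |g x - g y| := by
  classical
  induction hk : (A₀.filter fun x => g x ≠ 0).card using Nat.strong_induction_on generalizing g with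
  | _ k ih =>
  set S := A₀.filter fun x => g x ≠ 0 with hS
  have hSmem : ∀ x, x ∈ S ↔ g x ≠ 0 := fun x => by
    rw [hS, mem_filter]
    exact ⟨fun h => h.2, fun h => ⟨by by_contra h'; exact h (hg0 x h'), h⟩⟩
  rcases S.eq_empty_or_nonempty with hE | hne
  · have hz : g = fun x => (0 : ℝ) * g x := by
      funext x
      have : g x = 0 := by
        by_contra hx
        have := (hSmem x).2 hx
        rw [hE] at this
        exact notMem_empty _ this
      rw [this, mul_zero]
    rw [hz, hsmul 0 g le_rfl]
    simp
  · obtain ⟨z, hzS, hz⟩ := exists_min_image S g hne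
    set c := g z with hc
    have hcpos : 0 < c := lt_of_le_of_ne (hg z) ((hSmem z).1 hzS).symm
    set g' : V → ℝ := fun x => g x - c * ind S x with hg'
    have hdec : g = fun x => c * ind S x + g' x := by funext x; simp [hg']
    have hg'0 : ∀ x, 0 ≤ g' x := fun x => by
      by_cases hx : x ∈ S
      · simp only [hg', ind, hx, if_true, mul_one]; linarith [hz x hx]
      · simp only [hg', ind, hx, if_false, mul_zero, sub_zero]; exact hg x
    have hg'z : ∀ x, x ∉ S → g' x = 0 ∧ g x = 0 := fun x hx => by
      have : g x = 0 := by by_contra h'; exact hx ((hSmem x).2 h')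
      simp [hg', ind, hx, this]
    have hlt : (A₀.filter fun x => g' x ≠ 0).card < k := by
      rw [← hk]
      refine card_lt_card ⟨fun x hx => ?_, fun hsub => ?_⟩
      · by_contra hxS
        exact (mem_filter.1 hx).2 (hg'z x hxS).1
      · have := (mem_filter.1 (hsub hzS)).2
        exact this (by simp only [hg', ind, hzS, if_true]; simp [hc])
    have hI := ih _ hlt g' hg'0 (fun x hx => (hg'z x (fun h => hx (mem_filter.1 h).1)).1) rfl
    have hI2 := hset S (filter_subset _ _) hne
    have habs : ∀ x y, |g x - g y| = c * |ind S x - ind S y| + |g' x - g' y| := fun x y => by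
      by_cases hx : x ∈ S <;> by_cases hy : y ∈ S
      · simp [hg', ind, hx, hy]
      · have h1 := hg'z y hy
        have h2 := hg'0 x
        simp only [hg', ind, hx, hy, if_true, if_false] at h2 ⊢
        rw [h1.2]
        have := hg x
        simp only [sub_zero, mul_one, mul_zero, abs_one] at h2 ⊢
        rw [abs_of_nonneg this, abs_of_nonneg h2]; ring
      · have h1 := hg'z x hx
        have h2 := hg'0 y
        simp only [hg', ind, hx, hy, if_true, if_false] at h2 ⊢
        rw [h1.2]
        have := hg y
        simp only [sub_zero, zero_sub, mul_one, mul_zero, abs_neg, abs_one] at h2 ⊢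
        rw [abs_of_nonneg this, abs_of_nonneg h2]; ring
      · simp [hg', ind, hx, hy]
    have hsum : ∑ x ∈ F, ∑ y ∈ F, a x y * |g x - g y| =
        c * (∑ x ∈ F, ∑ y ∈ F, a x y * |ind S x - ind S y|) +
          ∑ x ∈ F, ∑ y ∈ F, a x y * |g' x - g' y| := by
      rw [mul_sum, ← sum_add_distrib]
      refine sum_congr rfl fun x _ => ?_
      rw [mul_sum, ← sum_add_distrib]
      refine sum_congr rfl fun y _ => ?_
      rw [habs]; ring
    have hN : N g ≤ c * N (ind S) + N g' := by
      have h1 := hadd (fun x => c * ind S x) g' (fun x => by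
        unfold ind; split_ifs <;> simp [hcpos.le]) hg'0
      rw [← hdec, hsmul c _ hcpos.le] at h1
      exact h1
    rw [hsum]
    have := mul_le_mul_of_nonneg_left hI2 hcpos.le
    linarith

end Coarea

section Isoperimetry

variable {d : ℕ} {Creg Criso : ℝ} {V : Type} {G : SimpleGraph V} {nbr : V → Finset V}
  {ball : V → ℝ → Finset V} {ω : V → V → ℝ}

open Classical in
/-- The number of vertices with a neighbour outside is at most the total variation of the
indicator function. -/
lemma card_le_tv_ind (F A D : Finset V) (hDA : D ⊆ A) (hAF : A ⊆ F)
    (hD : ∀ z ∈ D, ∃ y ∈ F, y ∉ A ∧ G.Adj z y) :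
    (D.card : ℝ) ≤ ∑ x ∈ F, ∑ y ∈ F, adj1 G x y * |ind A x - ind A y| := by
  have h0 : ∀ x y, 0 ≤ adj1 G x y * |ind A x - ind A y| := fun x y =>
    mul_nonneg (adj1_nonneg G x y) (abs_nonneg _)
  calc (D.card : ℝ) = ∑ x ∈ D, (1 : ℝ) := by simp
    _ ≤ ∑ x ∈ D, ∑ y ∈ F, adj1 G x y * |ind A x - ind A y| := by
        refine sum_le_sum fun x hx => ?_
        obtain ⟨y, hyF, hyA, hxy⟩ := hD x hx
        refine le_trans (le_of_eq ?_) (single_le_sum (fun y _ => h0 x y) hyF)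
        simp [adj1, ind, hxy, hyA, hDA hx]
    _ ≤ _ := sum_le_sum_of_subset_of_nonneg (hDA.trans hAF)
        fun x _ _ => sum_nonneg fun y _ => h0 x y

open Classical in
lemma Env.card_rpow_le (h : Env d Creg Criso G nbr ball ω) {A : Finset V} (hA : A.Nonempty) :
    (A.card : ℝ) ^ (1 - 1 / (d : ℝ)) ≤
      Creg ^ 2 * (4 * Creg) ^ (1 / (d : ℝ)) / Criso * ((intBdry G A).card : ℝ) := by
  have hC := h.one_le_Creg
  have hC0 := h.Creg_pos
  have hI0 := h.Criso_pos
  have hd0 : (0 : ℝ) < d := by exact_mod_cast (by linarith [h.two_le] : 0 < d)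
  have hA1 : (1 : ℝ) ≤ A.card := by exact_mod_cast hA.card_pos
  set r : ℝ := (4 * Creg * A.card) ^ (1 / (d : ℝ)) with hr
  have hrd : r ^ d = 4 * Creg * A.card := by
    rw [hr, ← Real.rpow_natCast, ← Real.rpow_mul (by positivity), one_div,
      inv_mul_cancel₀ hd0.ne', Real.rpow_one]
  have hr1 : 1 ≤ r := Real.one_le_rpow (by nlinarith) (by positivity)
  set U := A.biUnion fun z => ball z r with hU
  have key : ∀ x ∈ U, Criso / r * ((A ∩ ball x r).card : ℝ) ≤
      ((intBdry G A ∩ ball x r).card : ℝ) := by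
    intro x hx
    obtain ⟨z, hzA, hxz⟩ := mem_biUnion.1 hx
    have hzx := (h.mem_ball_comm z x r).1 hxz
    have hne : (A ∩ ball x r).Nonempty := ⟨z, mem_inter.2 ⟨hzA, hzx⟩⟩
    have hcard : ((A ∩ ball x r).card : ℝ) < ((ball x r).card : ℝ) / 2 := by
      have h1 := (h.vol x r hr1).1
      rw [hrd] at h1
      have h2 : ((A ∩ ball x r).card : ℝ) ≤ A.card := by
        exact_mod_cast card_le_card inter_subset_left
      have h3 : Creg⁻¹ * (4 * Creg * A.card) = 4 * A.card := by field_simp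
      rw [h3] at h1
      linarith
    have h1 := h.iso x r _ hr1 hne inter_subset_right hcard
    have hpos : (0 : ℝ) < (A ∩ ball x r).card := by exact_mod_cast hne.card_pos
    rw [le_div_iff₀ hpos] at h1
    refine h1.trans ?_
    have : relBdry G (ball x r) (A ∩ ball x r) ⊆ intBdry G A ∩ ball x r := by
      intro w hw
      obtain ⟨hw1, y, hyB, hyA, hwy⟩ := mem_filter.1 hw
      obtain ⟨hwA, hwB⟩ := mem_inter.1 hw1
      refine mem_inter.2 ⟨mem_filter.2 ⟨hwA, y, fun h' => hyA (mem_inter.2 ⟨h', hyB⟩), hwy⟩, hwB⟩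
    exact_mod_cast card_le_card this
  have count : ∀ D : Finset V, D ⊆ A →
      ∑ x ∈ U, ((D ∩ ball x r).card : ℝ) = ∑ z ∈ D, ((ball z r).card : ℝ) := by
    intro D hD
    have e1 : ∀ x, ((D ∩ ball x r).card : ℝ) = ∑ z ∈ D, if x ∈ ball z r then (1 : ℝ) else 0 := by
      intro x
      rw [← filter_mem_eq_inter, sum_boole]
      congr 2
      exact filter_congr fun z _ => h.mem_ball_comm x z r
    simp_rw [e1]
    rw [sum_comm]
    refine sum_congr rfl fun z hz => ?_
    rw [sum_boole, filter_mem_eq_inter]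
    congr 2
    exact inter_eq_right.2 (subset_biUnion_of_mem (fun z => ball z r) (hD hz))
  have hsum := sum_le_sum key
  rw [← mul_sum, count A subset_rfl, count (intBdry G A) (filter_subset _ _)] at hsum
  have hlow : (A.card : ℝ) * (Creg⁻¹ * r ^ d) ≤ ∑ z ∈ A, ((ball z r).card : ℝ) := by
    rw [← nsmul_eq_mul]
    exact card_nsmul_le_sum _ _ _ fun z _ => (h.vol z r hr1).1
  have hup : ∑ z ∈ intBdry G A, ((ball z r).card : ℝ) ≤
      ((intBdry G A).card : ℝ) * (Creg * r ^ d) := by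
    rw [← nsmul_eq_mul]
    exact sum_le_card_nsmul _ _ _ fun z _ => (h.vol z r hr1).2
  have hr0 : 0 < r := by linarith
  have h1 : Criso / r * ((A.card : ℝ) * (Creg⁻¹ * r ^ d)) ≤
      ((intBdry G A).card : ℝ) * (Creg * r ^ d) :=
    (mul_le_mul_of_nonneg_left hlow (by positivity)).trans (hsum.trans hup)
  have hrd0 : 0 < r ^ d := by positivity
  have h2 : (A.card : ℝ) ≤ Creg ^ 2 * r / Criso * ((intBdry G A).card : ℝ) := by
    have e : Criso / r * ((A.card : ℝ) * (Creg⁻¹ * r ^ d)) =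
      ((A.card : ℝ) * (Criso / (r * Creg))) * r ^ d := by field_simp
    rw [e, ← mul_assoc] at h1
    have h3 := le_of_mul_le_mul_right h1 hrd0
    rw [mul_div_assoc', div_le_iff₀ (by positivity)] at h3
    rw [div_mul_eq_mul_div, le_div_iff₀ hI0]
    nlinarith
  have hrs : r = (4 * Creg) ^ (1 / (d : ℝ)) * (A.card : ℝ) ^ (1 / (d : ℝ)) := by
    rw [hr, Real.mul_rpow (by positivity) (by positivity)]
  have hA0 : (0 : ℝ) < A.card := by linarith
  rw [Real.rpow_sub hA0, Real.rpow_one, div_le_iff₀ (by positivity)]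
  refine h2.trans (le_of_eq ?_)
  rw [hrs]; ring

/-- The `ℓ^{d/(d-1)}` Sobolev inequality. -/
lemma Env.sobolev_one (h : Env d Creg Criso G nbr ball ω) {A₀ F : Finset V} (hAF : A₀ ⊆ F)
    (hF : ∀ x ∈ A₀, nbr x ⊆ F) (g : V → ℝ) (hg : ∀ x, 0 ≤ g x) (hg0 : ∀ x, x ∉ A₀ → g x = 0) :
    (∑ x ∈ F, g x ^ ((d : ℝ) / (d - 1))) ^ (1 - 1 / (d : ℝ)) ≤
      Creg ^ 2 * (4 * Creg) ^ (1 / (d : ℝ)) / Criso *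
        ∑ x ∈ F, ∑ y ∈ F, adj1 G x y * |g x - g y| := by
  classical
  have hd2 : (2 : ℝ) ≤ d := by exact_mod_cast h.two_le
  set r : ℝ := (d : ℝ) / (d - 1) with hr
  have hr1 : 1 ≤ r := by rw [hr, le_div_iff₀ (by linarith)]; linarith
  have hr0 : 0 < r := by linarith
  have hri : 1 - 1 / (d : ℝ) = 1 / r := by
    rw [hr]; field_simp
  have hC0 := h.Creg_pos
  have hI0 := h.Criso_pos
  have hmain := coarea_bound F (adj1 G) (fun g => (∑ x ∈ F, |g x| ^ r) ^ (1 / r))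
    (fun f g _ _ => Real.Lp_add_le F f g hr1)
    (fun c f hc => by
      have : ∀ x, |c * f x| ^ r = c ^ r * |f x| ^ r := fun x => by
        rw [abs_mul, abs_of_nonneg hc, Real.mul_rpow hc (abs_nonneg _)]
      simp_rw [this]
      rw [← mul_sum, Real.mul_rpow (by positivity) (by positivity), ← Real.rpow_mul hc,
        mul_one_div_cancel hr0.ne', Real.rpow_one])
    (Creg ^ 2 * (4 * Creg) ^ (1 / (d : ℝ)) / Criso) A₀ (fun A hA hne => by
      have e : ∑ x ∈ F, |ind A x| ^ r = A.card := by
        have : ∀ x, |ind A x| ^ r = if x ∈ A then (1 : ℝ) else 0 := fun x => by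
          unfold ind; split_ifs
          · simp
          · simp [hr0.ne']
        simp_rw [this]
        rw [sum_boole, filter_mem_eq_inter, inter_eq_right.2 (hA.trans hAF)]
      simp only [e, ← hri]
      refine (h.card_rpow_le hne).trans ?_
      refine mul_le_mul_of_nonneg_left ?_ (by positivity)
      refine card_le_tv_ind F A _ (filter_subset _ _) (hA.trans hAF) fun z hz => ?_
      obtain ⟨hzA, y, hyA, hzy⟩ := mem_filter.1 hz
      exact ⟨y, hF z (hA hzA) ((h.mem_nbr z y).2 hzy), hyA, hzy⟩)
    g hg hg0
  rw [hri]
  have : ∀ x, |g x| = g x := fun x => abs_of_nonneg (hg x)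
  simp only [this] at hmain
  exact hmain

end Isoperimetry

section Poincare

variable {d : ℕ} {Creg Criso : ℝ} {V : Type} {G : SimpleGraph V} {nbr : V → Finset V}
  {ball : V → ℝ → Finset V} {ω : V → V → ℝ}

open Classical in
lemma Env.card_nbr_le (h : Env d Creg Criso G nbr ball ω) (z : V) :
    ((nbr z).card : ℝ) ≤ Creg := by
  have h1 := (h.vol z 1 le_rfl).2
  have h2 : nbr z ⊆ ball z 1 := by
    refine h.nbr_subset_ball (r := 0) (by norm_num) ((h.mem_ball z 0 z).2 ?_)
    simp
  have h3 : ((nbr z).card : ℝ) ≤ (ball z 1).card := by exact_mod_cast card_le_card h2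
  simp only [one_pow, mul_one] at h1
  linarith

open Classical in
lemma Env.card_le_of_lt_half (h : Env d Creg Criso G nbr ball ω) {x : V} {r : ℝ} (hr : 1 ≤ r)
    {A : Finset V} (hA : A ⊆ ball x r) (hlt : (A.card : ℝ) < ((ball x r).card : ℝ) / 2) :
    Criso * A.card ≤ r * (relBdry G (ball x r) A).card := by
  rcases A.eq_empty_or_nonempty with rfl | hne
  · simp only [card_empty, Nat.cast_zero, mul_zero]; positivity
  · have h1 := h.iso x r A hr hne hA hlt
    have hpos : (0 : ℝ) < A.card := by exact_mod_cast hne.card_pos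
    rwa [div_le_div_iff₀ (by linarith) hpos, mul_comm _ r] at h1

open Classical in
lemma card_relBdry_le_tv (F A : Finset V) (hAF : A ⊆ F) :
    ((relBdry G F A).card : ℝ) ≤ ∑ x ∈ F, ∑ y ∈ F, adj1 G x y * |ind A x - ind A y| :=
  card_le_tv_ind F A _ (filter_subset _ _) hAF fun _ hz => (mem_filter.1 hz).2

open Classical in
/-- Relative isoperimetric inequality for sets whose complement occupies a fixed fraction. -/
lemma Env.card_le_tv (h : Env d Creg Criso G nbr ball ω) {x : V} {r : ℝ}
    (hr : 8 * Creg ^ 2 / Criso ≤ r) (hr1 : 2 * Creg ≤ r) {θ : ℝ} (hθ : 0 < θ) (hθ1 : θ ≤ 1)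
    {A : Finset V} (hA : A ⊆ ball x r)
    (hc : θ * (ball x r).card ≤ ((ball x r \ A).card : ℝ)) :
    (A.card : ℝ) ≤ 4 * r / (Criso * θ) *
      ∑ x' ∈ ball x r, ∑ y ∈ ball x r, adj1 G x' y * |ind A x' - ind A y| := by
  set F := ball x r with hF
  set T := ∑ x' ∈ F, ∑ y ∈ F, adj1 G x' y * |ind A x' - ind A y| with hT
  have hC := h.one_le_Creg
  have hI := h.Criso_pos
  have hr0 : 1 ≤ r := by linarith
  have hT0 : 0 ≤ T := sum_nonneg fun _ _ => sum_nonneg fun _ _ =>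
    mul_nonneg (adj1_nonneg _ _ _) (abs_nonneg _)
  have hcompl : ((F \ A).card : ℝ) = F.card - A.card := by
    rw [card_sdiff_of_subset hA, Nat.cast_sub (card_le_card hA)]
  have hAFc : (A.card : ℝ) ≤ F.card := by exact_mod_cast card_le_card hA
  suffices hs : Criso * θ * A.card ≤ 4 * r * T by
    rw [div_mul_eq_mul_div, le_div_iff₀ (by positivity)]; linarith
  rcases lt_trichotomy (A.card : ℝ) ((F.card : ℝ) / 2) with hlt | heq | hgt
  · have h1 := h.card_le_of_lt_half hr0 hA hlt
    have h2 := card_relBdry_le_tv (G := G) F A hA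
    have h3 : r * ((relBdry G F A).card : ℝ) ≤ r * T := by gcongr
    have h4 : Criso * θ * A.card ≤ Criso * 1 * A.card := by gcongr
    nlinarith
  · have hvol := (h.vol x r hr0).1
    have hA2 : r ^ 2 ≤ 2 * Creg * A.card := by
      have : r ^ 2 ≤ r ^ d := pow_le_pow_right₀ hr0 h.two_le
      have h2 : Creg⁻¹ * r ^ d = r ^ d / Creg := by ring
      rw [h2, div_le_iff₀ (by linarith)] at hvol
      have : (F.card : ℝ) = 2 * A.card := by linarith
      rw [← hF, this] at hvol
      linarith
    have hA2' : (2 : ℝ) ≤ A.card := by nlinarith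
    have hne : A.Nonempty := card_pos.1 (by
      have : (0 : ℝ) < A.card := by linarith
      exact_mod_cast this)
    obtain ⟨z, hz⟩ := hne
    have hcard : ((A.erase z).card : ℝ) = A.card - 1 := by
      rw [card_erase_of_mem hz, Nat.cast_sub (card_pos.2 ⟨z, hz⟩)]; simp
    have h1 := h.card_le_of_lt_half hr0 ((erase_subset z A).trans hA)
      (by rw [hcard, ← hF]; linarith)
    have h2 : ((relBdry G F (A.erase z)).card : ℝ) ≤ (relBdry G F A).card + Creg := by
      have hsub : relBdry G F (A.erase z) ⊆ relBdry G F A ∪ nbr z := by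
        intro w hw
        obtain ⟨hwA, y, hyF, hyA, hwy⟩ := mem_filter.1 hw
        rw [mem_union]
        by_cases hyz : y = z
        · right
          rw [h.mem_nbr]
          exact hyz ▸ hwy.symm
        · left
          refine mem_filter.2 ⟨mem_of_mem_erase hwA, y, hyF, fun h' => hyA ?_, hwy⟩
          exact mem_erase.2 ⟨hyz, h'⟩
      have h3 : ((relBdry G F (A.erase z)).card : ℝ) ≤ (relBdry G F A).card + (nbr z).card := by
        exact_mod_cast (card_le_card hsub).trans (card_union_le _ _)
      linarith [h.card_nbr_le z]
    have h3 := card_relBdry_le_tv (G := G) F A hA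
    rw [hcard, ← hF] at h1
    have hbig : 2 * Creg * r ≤ Criso * (A.card - 1) := by
      rw [div_le_iff₀ hI] at hr
      have e1 : (A.card : ℝ) ≤ 2 * (A.card - 1) := by linarith
      have e2 : r ^ 2 ≤ 4 * Creg * (A.card - 1) := by nlinarith
      have e3 : 8 * Creg ^ 2 * r ≤ Criso * r ^ 2 := by nlinarith
      have e4 : Criso * r ^ 2 ≤ Criso * (4 * Creg * (A.card - 1)) := by gcongr
      have e5 : (4 * Creg) * (2 * Creg * r) ≤ (4 * Creg) * (Criso * (A.card - 1)) := by nlinarith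
      exact le_of_mul_le_mul_left e5 (by linarith)
    have hh : Criso * A.card ≤ 4 * r * T := by
      have e1 : r * ((relBdry G F (A.erase z)).card : ℝ) ≤ r * (T + Creg) := by
        gcongr; linarith
      have e2 : Criso * A.card ≤ 2 * (Criso * (A.card - 1)) := by nlinarith
      nlinarith
    have h4 : Criso * θ * A.card ≤ Criso * 1 * A.card := by gcongr
    linarith
  · have h1 := h.card_le_of_lt_half (x := x) (r := r) (A := F \ A) hr0 sdiff_subset
      (by rw [← hF, hcompl]; linarith)
    have h2 := card_relBdry_le_tv (G := G) F (F \ A) sdiff_subset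
    have hTe : ∑ x' ∈ F, ∑ y ∈ F, adj1 G x' y * |ind (F \ A) x' - ind (F \ A) y| = T := by
      refine sum_congr rfl fun x' hx' => sum_congr rfl fun y hy => ?_
      congr 1
      have e : ∀ z ∈ F, ind (F \ A) z = 1 - ind A z := fun z hz => by
        by_cases hzA : z ∈ A <;> simp [ind, hz, hzA]
      rw [e x' hx', e y hy, abs_sub_comm]
      congr 1; ring
    rw [hTe] at h2
    have h3 : r * ((relBdry G F (F \ A)).card : ℝ) ≤ r * T := by gcongr
    have h4 : Criso * (θ * A.card) ≤ Criso * (F \ A).card := by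
      have : θ * A.card ≤ θ * F.card := by gcongr
      have : θ * (A.card : ℝ) ≤ (F \ A).card := this.trans hc
      gcongr
    nlinarith

open Classical in
/-- `ℓ¹` Poincaré inequality for functions vanishing on a fixed fraction of a ball. -/
lemma Env.poincare_one (h : Env d Creg Criso G nbr ball ω) {x : V} {r : ℝ}
    (hr : 8 * Creg ^ 2 / Criso ≤ r) (hr1 : 2 * Creg ≤ r) {θ : ℝ} (hθ : 0 < θ) (hθ1 : θ ≤ 1)
    {N : Finset V} (hN : N ⊆ ball x r) (hc : θ * (ball x r).card ≤ (N.card : ℝ))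
    (g : V → ℝ) (hg : ∀ x, 0 ≤ g x) (hgN : ∀ y ∈ N, g y = 0) :
    ∑ y ∈ ball x r, g y ≤ 4 * r / (Criso * θ) *
      ∑ x' ∈ ball x r, ∑ y ∈ ball x r, adj1 G x' y * |g x' - g y| := by
  set F := ball x r with hF
  set g' : V → ℝ := fun y => ind F y * g y with hg'
  have e : ∀ y ∈ F, g' y = g y := fun y hy => by simp [hg', ind, hy]
  have hmain := coarea_bound F (adj1 G) (fun g => ∑ y ∈ F, g y)
    (fun f g _ _ => (sum_add_distrib).le) (fun c f _ => (mul_sum ..).symm)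
    (4 * r / (Criso * θ)) (F \ N) (fun A hA _ => by
      have hAF := hA.trans sdiff_subset
      have e1 : ∑ y ∈ F, ind A y = A.card := by
        unfold ind
        rw [sum_boole, filter_mem_eq_inter, inter_eq_right.2 hAF]
      have hcc : N ⊆ F \ A := fun y hy => mem_sdiff.2
        ⟨hN hy, fun hyA => (mem_sdiff.1 (hA hyA)).2 hy⟩
      have hcc' : (N.card : ℝ) ≤ (F \ A).card := by exact_mod_cast card_le_card hcc
      simp only [e1]
      exact h.card_le_tv hr hr1 hθ hθ1 hAF (hc.trans hcc'))
    g' (fun y => mul_nonneg (by unfold ind; split_ifs <;> norm_num) (hg y)) (fun y hy => by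
      by_cases hyF : y ∈ F
      · have : y ∈ N := by
          by_contra hyN
          exact hy (mem_sdiff.2 ⟨hyF, hyN⟩)
        simp [hg', hgN y this]
      · simp [hg', ind, hyF])
  rw [sum_congr rfl e] at hmain
  refine hmain.trans (le_of_eq ?_)
  congr 1
  refine sum_congr rfl fun x' hx' => sum_congr rfl fun y hy => ?_
  rw [e x' hx', e y hy]

/-- Cauchy–Schwarz between the weighted total variation and the Dirichlet form. -/
lemma Env.tv_sq_le (h : Env d Creg Criso G nbr ball ω) (F : Finset V) (k g : V → ℝ) :
    (∑ x ∈ F, ∑ y ∈ F, adj1 G x y * (k x * |g x - g y|)) ^ 2 ≤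
      (∑ x ∈ F, ∑ y ∈ F, ω x y * (g x - g y) ^ 2) * ∑ x ∈ F, nu nbr ω x * k x ^ 2 := by
  classical
  have h1 : ∀ x, ∑ y ∈ F, adj1 G x y * (ω x y)⁻¹ * k x ^ 2 ≤ nu nbr ω x * k x ^ 2 := by
    intro x
    rw [← sum_mul]
    refine mul_le_mul_of_nonneg_right ?_ (sq_nonneg _)
    have e : ∑ y ∈ F, adj1 G x y * (ω x y)⁻¹ = ∑ y ∈ F.filter (G.Adj x), (ω x y)⁻¹ := by
      rw [sum_filter]
      exact sum_congr rfl fun y _ => by unfold adj1; split_ifs <;> simp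
    rw [e, nu]
    refine sum_le_sum_of_subset_of_nonneg (fun y hy => ?_) fun y _ _ =>
      inv_nonneg.2 (h.omega_nonneg x y)
    exact (h.mem_nbr x y).2 (mem_filter.1 hy).2
  have h2 := sum_sq_le_sum_mul_sum_of_sq_le_mul (F ×ˢ F)
    (r := fun z => adj1 G z.1 z.2 * (k z.1 * |g z.1 - g z.2|))
    (f := fun z => ω z.1 z.2 * (g z.1 - g z.2) ^ 2)
    (g := fun z => adj1 G z.1 z.2 * (ω z.1 z.2)⁻¹ * k z.1 ^ 2)
    (fun z _ => mul_nonneg (h.omega_nonneg _ _) (sq_nonneg _))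
    (fun z _ => mul_nonneg (mul_nonneg (adj1_nonneg _ _ _)
      (inv_nonneg.2 (h.omega_nonneg _ _))) (sq_nonneg _))
    (fun z _ => le_of_eq <| by
      unfold adj1
      split_ifs with hz
      · have := (h.pos _ _ hz).ne'
        simp only [one_mul]
        rw [mul_pow, sq_abs]; field_simp
      · simp)
  rw [sum_product, sum_product, sum_product] at h2
  refine h2.trans (mul_le_mul_of_nonneg_left (sum_le_sum fun x _ => h1 x) ?_)
  exact sum_nonneg fun _ _ => sum_nonneg fun _ _ => mul_nonneg (h.omega_nonneg _ _) (sq_nonneg _)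

end Poincare

section Slice

/-- Weighted moment bounds for `μ` and `ν` on a finite set of linear size `n`. -/
structure Ctrl (d : ℕ) (p q Creg A n : ℝ) {V : Type} (F : Finset V) (nbr : V → Finset V)
    (ω : V → V → ℝ) : Prop where
  one_le_A : 1 ≤ A
  one_le_n : 1 ≤ n
  mu_le : (∑ x ∈ F, mu nbr ω x ^ p) ^ (1 / p) ≤ Creg * (n ^ d) ^ (1 / p) * A
  nu_le : (∑ x ∈ F, nu nbr ω x ^ q) ^ (1 / q) ≤ Creg * (n ^ d) ^ (1 / q) * A
  card_le : (F.card : ℝ) ≤ Creg * n ^ d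

lemma holder_sum {ι : Type*} (F : Finset ι) {f g : ι → ℝ} (hf : ∀ i ∈ F, 0 ≤ f i)
    (hg : ∀ i ∈ F, 0 ≤ g i) {a : ℝ} (ha : 0 < a) (ha1 : a < 1) :
    ∑ i ∈ F, f i ^ a * g i ^ (1 - a) ≤ (∑ i ∈ F, f i) ^ a * (∑ i ∈ F, g i) ^ (1 - a) := by
  have hb : 0 < 1 - a := by linarith
  have hc : Real.HolderConjugate (1 / a) (1 / (1 - a)) := by
    rw [Real.holderConjugate_iff]
    refine ⟨by rw [lt_div_iff₀ ha]; linarith, by field_simp; ring⟩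
  have := Real.inner_le_Lp_mul_Lq_of_nonneg F (f := fun i => f i ^ a) (g := fun i => g i ^ (1 - a))
    hc (fun i hi => Real.rpow_nonneg (hf i hi) _) (fun i hi => Real.rpow_nonneg (hg i hi) _)
  rw [one_div_one_div, one_div_one_div] at this
  refine this.trans_eq ?_
  congr 2 <;> refine sum_congr rfl fun i hi => ?_
  · rw [← Real.rpow_mul (hf i hi), mul_one_div_cancel ha.ne', Real.rpow_one]
  · rw [← Real.rpow_mul (hg i hi), mul_one_div_cancel hb.ne', Real.rpow_one]

lemma holder_weight {ι : Type*} (F : Finset ι) {m g : ι → ℝ} (hm : ∀ i ∈ F, 0 ≤ m i)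
    (hg : ∀ i ∈ F, 0 ≤ g i) {p : ℝ} (hp : 1 < p) :
    ∑ i ∈ F, m i * g i ^ (1 - 1 / p) ≤
      (∑ i ∈ F, m i ^ p) ^ (1 / p) * (∑ i ∈ F, g i) ^ (1 - 1 / p) := by
  have hp0 : 0 < p := by linarith
  refine le_trans (le_of_eq (sum_congr rfl fun i hi => ?_))
    (holder_sum F (f := fun i => m i ^ p) (fun i hi => Real.rpow_nonneg (hm i hi) _) hg
      (a := 1 / p) (by positivity) (by rw [div_lt_iff₀ hp0]; linarith))
  rw [← Real.rpow_mul (hm i hi), mul_one_div_cancel hp0.ne', Real.rpow_one]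

lemma abs_rpow_sub_le {γ : ℝ} (hγ : 1 ≤ γ) {a b : ℝ} (ha : 0 ≤ a) (hb : 0 ≤ b) :
    |a ^ γ - b ^ γ| ≤ γ * (a ^ (γ - 1) + b ^ (γ - 1)) * |a - b| := by
  wlog hab : a ≤ b generalizing a b with H
  · have := H hb ha (le_of_not_ge hab)
    rw [abs_sub_comm, abs_sub_comm a b, add_comm (a ^ _)]; exact this
  have h0 : 0 ≤ a ^ (γ - 1) := Real.rpow_nonneg ha _
  rw [abs_sub_comm, abs_sub_comm a b, abs_of_nonneg (sub_nonneg.2 hab),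
    abs_of_nonneg (sub_nonneg.2 (Real.rpow_le_rpow ha hab (by linarith)))]
  rcases hb.eq_or_lt with rfl | hb0
  · have : a = 0 := le_antisymm hab ha
    subst this; simp
  have h1 := one_add_mul_self_le_rpow_one_add (s := a / b - 1)
    (by have := div_nonneg ha hb; linarith)
    hγ
  have h2 : (1 + (a / b - 1)) ^ γ = a ^ γ / b ^ γ := by
    rw [add_sub_cancel, Real.div_rpow ha hb]
  have h3 : b ^ γ = b ^ (γ - 1) * b := by
    rw [← Real.rpow_add_one hb0.ne']; ring_nf
  have hbg : 0 < b ^ γ := Real.rpow_pos_of_pos hb0 _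
  rw [h2, le_div_iff₀ hbg, add_mul, mul_assoc, mul_comm (a / b - 1)] at h1
  have h4 : b ^ γ * (a / b - 1) = b ^ (γ - 1) * (a - b) := by
    rw [h3]; field_simp
  rw [h4] at h1
  have h5 : 0 ≤ γ * a ^ (γ - 1) * (b - a) :=
    mul_nonneg (mul_nonneg (by linarith) h0) (sub_nonneg.2 hab)
  nlinarith

variable {d : ℕ} {Creg Criso : ℝ} {V : Type} {G : SimpleGraph V} {nbr : V → Finset V}
  {ball : V → ℝ → Finset V} {ω : V → V → ℝ}

/-- Unnormalised Dirichlet energy on a finite set. -/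
def en (ω : V → V → ℝ) (F : Finset V) (h : V → ℝ) : ℝ :=
  ∑ x ∈ F, ∑ y ∈ F, ω x y * (h x - h y) ^ 2

lemma Env.en_nonneg (h : Env d Creg Criso G nbr ball ω) (F : Finset V) (f : V → ℝ) :
    0 ≤ en ω F f :=
  sum_nonneg fun _ _ => sum_nonneg fun _ _ => mul_nonneg (h.omega_nonneg _ _) (sq_nonneg _)

/-- Weighted Sobolev inequality for compactly supported functions. -/
lemma Env.sobolev_two (h : Env d Creg Criso G nbr ball ω) {q ρ : ℝ} (hq : 1 < q)
    (hρ : 1 / ρ = 1 - 2 / (d : ℝ) + 1 / q) (hρ1 : 1 < ρ)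
    {A₀ F : Finset V} (hAF : A₀ ⊆ F) (hF : ∀ x ∈ A₀, nbr x ⊆ F)
    (f : V → ℝ) (hf : ∀ x, 0 ≤ f x) (hf0 : ∀ x, x ∉ A₀ → f x = 0) :
    (∑ x ∈ F, f x ^ (2 * ρ)) ^ (1 / ρ) ≤
      (Creg ^ 2 * (4 * Creg) ^ (1 / (d : ℝ)) / Criso * (4 * ρ)) ^ 2 * en ω F f *
        (∑ x ∈ F, nu nbr ω x ^ q) ^ (1 / q) := by
  have hd2 : (2 : ℝ) ≤ d := by exact_mod_cast h.two_le
  have hd0 : (0 : ℝ) < d := by linarith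
  have hd1 : (0 : ℝ) < d - 1 := by linarith
  have hq0 : 0 < q := by linarith
  have hρ0 : 0 < ρ := by linarith
  have hqi : 1 / q < 1 := by rw [div_lt_iff₀ hq0]; linarith
  set γ : ℝ := 2 * ρ * (1 - 1 / d) with hγ
  have hγ1 : γ - 1 = ρ * (1 - 1 / q) := by
    have : ρ * (1 / ρ) = 1 := by field_simp
    rw [hρ] at this
    rw [hγ]; linear_combination this
  have hγge : 1 ≤ γ := by nlinarith
  have hγle : γ ≤ 2 * ρ := by
    rw [hγ]
    have : 0 < 1 / (d : ℝ) := by positivity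
    nlinarith
  have hγr : γ * ((d : ℝ) / (d - 1)) = 2 * ρ := by rw [hγ]; field_simp
  set C := Creg ^ 2 * (4 * Creg) ^ (1 / (d : ℝ)) / Criso with hC
  have hC0 : 0 ≤ C := by
    have := h.Creg_pos; have := h.Criso_pos; positivity
  set S := ∑ x ∈ F, f x ^ (2 * ρ) with hS
  have hS0 : 0 ≤ S := sum_nonneg fun x _ => Real.rpow_nonneg (hf x) _
  set T := ∑ x ∈ F, ∑ y ∈ F, adj1 G x y * (f x ^ (γ - 1) * |f x - f y|) with hT
  set Nq := (∑ x ∈ F, nu nbr ω x ^ q) ^ (1 / q) with hNq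
  have hN0 : 0 ≤ Nq := Real.rpow_nonneg (sum_nonneg fun x _ =>
    Real.rpow_nonneg (h.nu_pos x).le _) _
  have hE0 := h.en_nonneg F f
  have hT0 : 0 ≤ T := sum_nonneg fun x _ => sum_nonneg fun y _ =>
    mul_nonneg (adj1_nonneg _ _ _) (mul_nonneg (Real.rpow_nonneg (hf x) _) (abs_nonneg _))
  have hsymm : ∀ x y, adj1 G x y = adj1 G y x := fun x y => by
    by_cases hxy : G.Adj x y <;> simp [adj1, hxy, G.adj_comm y x]
  have h1 : S ^ (1 - 1 / (d : ℝ)) ≤ C * (4 * ρ) * T := by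
    have := h.sobolev_one hAF hF (fun x => f x ^ γ) (fun x => Real.rpow_nonneg (hf x) _)
      (fun x hx => by
        rw [hf0 x hx, Real.zero_rpow (by linarith)])
    have e : ∀ x, (f x ^ γ) ^ ((d : ℝ) / (d - 1)) = f x ^ (2 * ρ) := fun x => by
      rw [← Real.rpow_mul (hf x), hγr]
    simp only [e] at this
    refine this.trans ?_
    rw [mul_assoc C]
    refine mul_le_mul_of_nonneg_left ?_ hC0
    have hTs : T = ∑ x ∈ F, ∑ y ∈ F, adj1 G x y * (f y ^ (γ - 1) * |f x - f y|) := by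
      rw [hT, sum_comm]
      refine sum_congr rfl fun x _ => sum_congr rfl fun y _ => ?_
      rw [hsymm, abs_sub_comm]
    have : ∑ x ∈ F, ∑ y ∈ F, adj1 G x y * |f x ^ γ - f y ^ γ| ≤ γ * (T + T) := by
      conv_rhs => rw [hTs]; enter [2, 1]; rw [← hTs, hT]
      rw [← sum_add_distrib, mul_sum]
      refine sum_le_sum fun x _ => ?_
      rw [← sum_add_distrib, mul_sum]
      refine sum_le_sum fun y _ => ?_
      refine (mul_le_mul_of_nonneg_left (abs_rpow_sub_le hγge (hf x) (hf y))
        (adj1_nonneg G x y)).trans_eq ?_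
      ring
    refine this.trans ?_
    nlinarith
  have h2 : T ^ 2 ≤ en ω F f * (Nq * S ^ (1 - 1 / q)) := by
    refine (h.tv_sq_le F (fun x => f x ^ (γ - 1)) f).trans ?_
    refine mul_le_mul_of_nonneg_left ?_ hE0
    refine le_trans (le_of_eq (sum_congr rfl fun x _ => ?_))
      (holder_weight F (m := nu nbr ω) (g := fun x => f x ^ (2 * ρ)) (fun x _ => (h.nu_pos x).le)
        (fun x _ => Real.rpow_nonneg (hf x) _) hq)
    rw [← Real.rpow_natCast, ← Real.rpow_mul (hf x), ← Real.rpow_mul (hf x), hγ1]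
    congr 2; push_cast; ring
  have h3 : (S ^ (1 - 1 / (d : ℝ))) ^ 2 ≤ (C * (4 * ρ)) ^ 2 * en ω F f * Nq * S ^ (1 - 1 / q) := by
    calc _ ≤ (C * (4 * ρ) * T) ^ 2 := by
          refine pow_le_pow_left₀ (Real.rpow_nonneg hS0 _) h1 2
      _ = (C * (4 * ρ)) ^ 2 * T ^ 2 := by ring
      _ ≤ (C * (4 * ρ)) ^ 2 * (en ω F f * (Nq * S ^ (1 - 1 / q))) :=
          mul_le_mul_of_nonneg_left h2 (sq_nonneg _)
      _ = _ := by ring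
  rcases hS0.eq_or_lt with hS00 | hSpos
  · rw [← hS00, Real.zero_rpow (by positivity)]
    positivity
  · have hpos : 0 < S ^ (1 - 1 / q) := Real.rpow_pos_of_pos hSpos _
    refine le_of_mul_le_mul_right (le_trans (le_of_eq ?_) h3) hpos
    rw [← Real.rpow_natCast, ← Real.rpow_mul hS0, ← Real.rpow_add hSpos, hρ]
    congr 1; push_cast; ring

/-- The basic interpolation inequality for compactly supported functions. -/
lemma exists_slice (d : ℕ) (hd : 2 ≤ d) (Creg Criso : ℝ) (hCreg : 0 < Creg) (hCriso : 0 < Criso)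
    (p q : ℝ) (hp : 1 < p) (hq : 1 < q) (hpq : 1 / p + 1 / q < 2 / (d : ℝ)) :
    ∃ β K : ℝ, 1 < β ∧ β < 2 ∧ 0 < K ∧
      ∀ {V : Type} {G : SimpleGraph V} {nbr : V → Finset V} {ball : V → ℝ → Finset V}
        {ω : V → V → ℝ} (_ : Env d Creg Criso G nbr ball ω) {A n : ℝ} {A₀ F : Finset V}
        (_ : Ctrl d p q Creg A n F nbr ω) (_ : A₀ ⊆ F) (_ : ∀ x ∈ A₀, nbr x ⊆ F)
        (f : V → ℝ) (_ : ∀ x, 0 ≤ f x) (_ : ∀ x, x ∉ A₀ → f x = 0),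
        ∑ x ∈ F, mu nbr ω x * f x ^ (2 * β) ≤
          K * A ^ 2 * ((∑ x ∈ F, mu nbr ω x * f x ^ 2) / n ^ d) ^ (β - 1) * (n ^ 2 * en ω F f) := by
  have hd2 : (2 : ℝ) ≤ d := by exact_mod_cast hd
  have hp0 : 0 < p := by linarith
  have hq0 : 0 < q := by linarith
  have hpi : 0 < 1 / p := by positivity
  have hqi : 0 < 1 / q := by positivity
  have hpi1 : 1 / p < 1 := by rw [div_lt_iff₀ hp0]; linarith
  have h2d : 2 / (d : ℝ) ≤ 1 := by rw [div_le_iff₀ (by linarith)]; linarith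
  set ρ : ℝ := 1 / (1 - 2 / (d : ℝ) + 1 / q) with hρdef
  have hden : 0 < 1 - 2 / (d : ℝ) + 1 / q := by linarith
  have hρ : 1 / ρ = 1 - 2 / (d : ℝ) + 1 / q := by rw [hρdef, one_div_one_div]
  have hρ1 : 1 < ρ := by rw [hρdef, lt_div_iff₀ hden]; linarith
  have hρ0 : 0 < ρ := by linarith
  set r : ℝ := ρ * (1 - 1 / p) with hr
  have hrρ : (1 - 1 / p) * (1 / r) = 1 / ρ := by
    have hP : 1 - 1 / p ≠ 0 := by linarith
    rw [hr]
    generalize 1 - 1 / p = P at hP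
    field_simp
  have hr1 : 1 < r := by
    rw [hr, hρdef, div_mul_eq_mul_div, lt_div_iff₀ hden]; linarith
  have hr0 : 0 < r := by linarith
  have hri : 0 < 1 / r := by positivity
  have hri1 : 1 / r < 1 := by rw [div_lt_iff₀ hr0]; linarith
  set C := (Creg ^ 2 * (4 * Creg) ^ (1 / (d : ℝ)) / Criso * (4 * ρ)) ^ 2 with hC
  have hC0 : 0 < C := by positivity
  refine ⟨2 - 1 / r, Creg ^ (1 / r) * (C * Creg), by linarith, by linarith, by positivity, ?_⟩
  intro V G nbr ball ω h A n A₀ F hc hAF hF f hf hf0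
  have hA := hc.one_le_A
  have hn := hc.one_le_n
  have hn0 : 0 < n := by linarith
  set S := ∑ x ∈ F, f x ^ (2 * ρ) with hS
  have hS0 : 0 ≤ S := sum_nonneg fun x _ => Real.rpow_nonneg (hf x) _
  set Ψ := ∑ x ∈ F, mu nbr ω x * f x ^ 2 with hΨ
  have hΨ0 : 0 ≤ Ψ := sum_nonneg fun x _ => mul_nonneg (h.mu_pos x).le (sq_nonneg _)
  have hE0 := h.en_nonneg F f
  set Q := ∑ x ∈ F, mu nbr ω x * f x ^ (2 * r) with hQ
  have hQ0 : 0 ≤ Q := sum_nonneg fun x _ => mul_nonneg (h.mu_pos x).le (Real.rpow_nonneg (hf x) _)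
  have h1 : ∑ x ∈ F, mu nbr ω x * f x ^ (2 * (2 - 1 / r)) ≤ Ψ ^ (1 - 1 / r) * Q ^ (1 / r) := by
    have := holder_sum F (f := fun x => mu nbr ω x * f x ^ 2)
      (g := fun x => mu nbr ω x * f x ^ (2 * r))
      (fun x _ => mul_nonneg (h.mu_pos x).le (sq_nonneg _))
      (fun x _ => mul_nonneg (h.mu_pos x).le (Real.rpow_nonneg (hf x) _))
      (a := 1 - 1 / r) (by linarith) (by linarith)
    rw [sub_sub_cancel] at this
    refine le_trans (le_of_eq (sum_congr rfl fun x _ => ?_)) this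
    have hm := (h.mu_pos x)
    have e1 : f x ^ (2 : ℕ) = f x ^ (2 : ℝ) := (Real.rpow_natCast _ 2).symm
    rw [Real.mul_rpow hm.le (sq_nonneg _), Real.mul_rpow hm.le (Real.rpow_nonneg (hf x) _), e1,
      ← Real.rpow_mul (hf x), ← Real.rpow_mul (hf x), mul_mul_mul_comm, ← Real.rpow_add hm,
      ← Real.rpow_add_of_nonneg (hf x) (by nlinarith) (by positivity)]
    have e2 : 1 - 1 / r + 1 / r = 1 := by ring
    have e3 : 2 * (1 - 1 / r) + 2 * r * (1 / r) = 2 * (2 - 1 / r) := by field_simp; ring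
    rw [e2, e3, Real.rpow_one]
  have h2 : Q ≤ Creg * (n ^ d) ^ (1 / p) * A * S ^ (1 - 1 / p) := by
    have := holder_weight F (m := mu nbr ω) (g := fun x => f x ^ (2 * ρ))
      (fun x _ => (h.mu_pos x).le) (fun x _ => Real.rpow_nonneg (hf x) _) hp
    refine le_trans (le_of_eq (sum_congr rfl fun x _ => ?_)) (this.trans ?_)
    · rw [← Real.rpow_mul (hf x), hr, mul_assoc]
    · exact mul_le_mul_of_nonneg_right hc.mu_le (Real.rpow_nonneg hS0 _)
  have h3 : S ^ (1 / ρ) ≤ C * en ω F f * (Creg * (n ^ d) ^ (1 / q) * A) :=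
    (h.sobolev_two hq hρ hρ1 hAF hF f hf hf0).trans
      (mul_le_mul_of_nonneg_left hc.nu_le (mul_nonneg hC0.le hE0))
  have h4 : Q ^ (1 / r) ≤ Creg ^ (1 / r) * ((n ^ d) ^ (1 / p)) ^ (1 / r) * A * S ^ (1 / ρ) := by
    have hnd : 0 ≤ (n ^ d) ^ (1 / p) := by positivity
    refine (Real.rpow_le_rpow hQ0 h2 hri.le).trans ?_
    rw [Real.mul_rpow (by positivity) (Real.rpow_nonneg hS0 _), Real.mul_rpow (by positivity)
      (by positivity), Real.mul_rpow (by positivity) hnd, ← Real.rpow_mul hS0]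
    rw [hrρ]
    refine mul_le_mul_of_nonneg_right (mul_le_mul_of_nonneg_left ?_ (by positivity))
      (Real.rpow_nonneg hS0 _)
    exact (Real.rpow_le_rpow_of_exponent_le hA hri1.le).trans_eq (Real.rpow_one A)
  have hscale : ((n ^ d) ^ (1 / p)) ^ (1 / r) * (n ^ d) ^ (1 / q) =
      ((n ^ d) ^ (1 - 1 / r))⁻¹ * n ^ 2 := by
    have e : ∀ s : ℝ, (n ^ d) ^ s = n ^ ((d : ℝ) * s) := fun s => by
      rw [← Real.rpow_natCast n d, ← Real.rpow_mul hn0.le]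
    rw [← Real.rpow_mul (by positivity), e, e, e, ← Real.rpow_neg hn0.le, ← Real.rpow_natCast n 2,
      ← Real.rpow_add hn0, ← Real.rpow_add hn0]
    congr 1
    have e1 : ρ * (1 - 2 / (d : ℝ) + 1 / q) = 1 := by rw [← hρ]; field_simp
    have e2 : 1 / p * (1 / r) = 1 / r - 1 / ρ := by
      linear_combination -hrρ
    rw [e2, hρ]
    have : (d : ℝ) ≠ 0 := by linarith
    push_cast
    field_simp
    ring
  have e5 : (2 : ℝ) - 1 / r - 1 = 1 - 1 / r := by ring
  rw [e5, Real.div_rpow hΨ0 (by positivity)]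
  have hP0 : 0 ≤ Ψ ^ (1 - 1 / r) := Real.rpow_nonneg hΨ0 _
  calc _ ≤ Ψ ^ (1 - 1 / r) * Q ^ (1 / r) := h1
    _ ≤ Ψ ^ (1 - 1 / r) * (Creg ^ (1 / r) * ((n ^ d) ^ (1 / p)) ^ (1 / r) * A *
        (C * en ω F f * (Creg * (n ^ d) ^ (1 / q) * A))) := by
      refine mul_le_mul_of_nonneg_left (h4.trans ?_) hP0
      exact mul_le_mul_of_nonneg_left h3 (by positivity)
    _ = Creg ^ (1 / r) * (C * Creg) * A ^ 2 * Ψ ^ (1 - 1 / r) * en ω F f *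
        (((n ^ d) ^ (1 / p)) ^ (1 / r) * (n ^ d) ^ (1 / q)) := by ring
    _ = _ := by rw [hscale]; field_simp

end Slice

section CtrlBounds

variable {d : ℕ} {Creg Criso : ℝ} {V : Type} {G : SimpleGraph V} {nbr : V → Finset V}
  {ball : V → ℝ → Finset V} {ω : V → V → ℝ} {p q A n : ℝ} {F S : Finset V}

lemma Ctrl.mono (h : Env d Creg Criso G nbr ball ω) (hc : Ctrl d p q Creg A n F nbr ω)
    (hp : 1 < p) (hq : 1 < q) (hSF : S ⊆ F) : Ctrl d p q Creg A n S nbr ω where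
  one_le_A := hc.one_le_A
  one_le_n := hc.one_le_n
  mu_le := (Real.rpow_le_rpow (sum_nonneg fun x _ => Real.rpow_nonneg (h.mu_pos x).le _)
    (sum_le_sum_of_subset_of_nonneg hSF fun x _ _ => Real.rpow_nonneg (h.mu_pos x).le _)
    (by positivity)).trans hc.mu_le
  nu_le := (Real.rpow_le_rpow (sum_nonneg fun x _ => Real.rpow_nonneg (h.nu_pos x).le _)
    (sum_le_sum_of_subset_of_nonneg hSF fun x _ _ => Real.rpow_nonneg (h.nu_pos x).le _)
    (by positivity)).trans hc.nu_le
  card_le := le_trans (by exact_mod_cast card_le_card hSF) hc.card_le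

lemma sum_le_of_rpow_sum_le {m : V → ℝ} (hm : ∀ x, 0 ≤ m x) {B : ℝ} (hp : 1 < p)
    (hB : (∑ x ∈ F, m x ^ p) ^ (1 / p) ≤ B) (hSF : S ⊆ F) :
    ∑ x ∈ S, m x ≤ B * (S.card : ℝ) ^ (1 - 1 / p) := by
  have h1 := holder_weight S (m := m) (g := fun _ => (1 : ℝ)) (fun x _ => hm x)
    (fun _ _ => zero_le_one) hp
  simp only [Real.one_rpow, mul_one, sum_const, nsmul_eq_mul] at h1
  refine h1.trans (mul_le_mul_of_nonneg_right (le_trans ?_ hB) (by positivity))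
  exact Real.rpow_le_rpow (sum_nonneg fun x _ => Real.rpow_nonneg (hm x) _)
    (sum_le_sum_of_subset_of_nonneg hSF fun x _ _ => Real.rpow_nonneg (hm x) _) (by positivity)

lemma le_of_rpow_sum_le {m : V → ℝ} (hm : ∀ x, 0 ≤ m x) {B : ℝ} (hp : 1 < p)
    (hB : (∑ x ∈ F, m x ^ p) ^ (1 / p) ≤ B) {x : V} (hx : x ∈ F) : m x ≤ B := by
  have := sum_le_of_rpow_sum_le hm hp hB (singleton_subset_iff.2 hx)
  simpa using this

lemma Ctrl.rpow_mul_le (hc : Ctrl d p q Creg A n F nbr ω) (hC : 1 ≤ Creg) {s : ℝ} (hs : 1 < s) :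
    Creg * (n ^ d) ^ (1 / s) * A * (F.card : ℝ) ^ (1 - 1 / s) ≤ Creg ^ 2 * n ^ d * A := by
  have hA := hc.one_le_A
  have hn := hc.one_le_n
  have hn0 : 0 < n ^ d := by positivity
  have hs1 : 1 / s < 1 := by rw [div_lt_iff₀ (by linarith)]; linarith
  have hs0 : 0 < 1 / s := by positivity
  have h1 : (F.card : ℝ) ^ (1 - 1 / s) ≤ Creg * (n ^ d) ^ (1 - 1 / s) := by
    refine (Real.rpow_le_rpow (by positivity) hc.card_le (by linarith)).trans ?_
    rw [Real.mul_rpow (by positivity) hn0.le]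
    refine mul_le_mul_of_nonneg_right ?_ (by positivity)
    exact (Real.rpow_le_rpow_of_exponent_le hC (by linarith)).trans_eq (Real.rpow_one _)
  have h2 : (n ^ d) ^ (1 / s) * (n ^ d) ^ (1 - 1 / s) = n ^ d := by
    rw [← Real.rpow_add hn0, add_sub_cancel, Real.rpow_one]
  calc _ ≤ Creg * (n ^ d) ^ (1 / s) * A * (Creg * (n ^ d) ^ (1 - 1 / s)) :=
        mul_le_mul_of_nonneg_left h1 (by positivity)
    _ = Creg ^ 2 * ((n ^ d) ^ (1 / s) * (n ^ d) ^ (1 - 1 / s)) * A := by ring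
    _ = _ := by rw [h2]

lemma Ctrl.sum_mu_le (h : Env d Creg Criso G nbr ball ω) (hc : Ctrl d p q Creg A n F nbr ω)
    (hp : 1 < p) : ∑ x ∈ F, mu nbr ω x ≤ Creg ^ 2 * n ^ d * A :=
  (sum_le_of_rpow_sum_le (fun x => (h.mu_pos x).le) hp hc.mu_le subset_rfl).trans
    (hc.rpow_mul_le h.one_le_Creg hp)

lemma Ctrl.sum_nu_le (h : Env d Creg Criso G nbr ball ω) (hc : Ctrl d p q Creg A n F nbr ω)
    (hq : 1 < q) : ∑ x ∈ F, nu nbr ω x ≤ Creg ^ 2 * n ^ d * A :=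
  (sum_le_of_rpow_sum_le (fun x => (h.nu_pos x).le) hq hc.nu_le subset_rfl).trans
    (hc.rpow_mul_le h.one_le_Creg hq)

lemma Ctrl.rpow_le (hc : Ctrl d p q Creg A n F nbr ω) (hC : 1 ≤ Creg) {s : ℝ} (hs : 1 < s) :
    Creg * (n ^ d) ^ (1 / s) * A ≤ Creg * n ^ d * A := by
  have hA := hc.one_le_A
  have hn := one_le_pow₀ hc.one_le_n (n := d)
  have hs1 : 1 / s < 1 := by rw [div_lt_iff₀ (by linarith)]; linarith
  have : (n ^ d) ^ (1 / s) ≤ n ^ d :=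
    (Real.rpow_le_rpow_of_exponent_le hn hs1.le).trans_eq (Real.rpow_one _)
  gcongr

lemma Ctrl.mu_apply_le (h : Env d Creg Criso G nbr ball ω) (hc : Ctrl d p q Creg A n F nbr ω)
    (hp : 1 < p) {x : V} (hx : x ∈ F) : mu nbr ω x ≤ Creg * n ^ d * A :=
  (le_of_rpow_sum_le (fun x => (h.mu_pos x).le) hp hc.mu_le hx).trans (hc.rpow_le h.one_le_Creg hp)

lemma Ctrl.nu_apply_le (h : Env d Creg Criso G nbr ball ω) (hc : Ctrl d p q Creg A n F nbr ω)
    (hq : 1 < q) {x : V} (hx : x ∈ F) : nu nbr ω x ≤ Creg * n ^ d * A :=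
  (le_of_rpow_sum_le (fun x => (h.nu_pos x).le) hq hc.nu_le hx).trans (hc.rpow_le h.one_le_Creg hq)

lemma Ctrl.inv_mu_le (h : Env d Creg Criso G nbr ball ω) (hc : Ctrl d p q Creg A n F nbr ω)
    (hq : 1 < q) {x : V} (hx : x ∈ F) : (mu nbr ω x)⁻¹ ≤ Creg * n ^ d * A := by
  refine le_trans ?_ (hc.nu_apply_le h hq hx)
  rw [inv_le_iff_one_le_mul₀ (h.mu_pos x), mul_comm]
  exact h.one_le_mu_mul_nu x

end CtrlBounds

section Energy

variable {d : ℕ} {Creg Criso : ℝ} {V : Type} {G : SimpleGraph V} {nbr : V → Finset V}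
  {ball : V → ℝ → Finset V} {ω : V → V → ℝ}

lemma hasDerivAt_max_sq (s : ℝ) : HasDerivAt (fun s : ℝ => max s 0 ^ 2) (2 * max s 0) s := by
  rcases lt_trichotomy s 0 with hs | rfl | hs
  · rw [max_eq_right hs.le, mul_zero]
    refine (hasDerivAt_const s (0 : ℝ)).congr_of_eventuallyEq ?_
    filter_upwards [Iio_mem_nhds hs] with z hz
    rw [max_eq_right (le_of_lt hz)]; simp
  · simp only [max_self, mul_zero]
    rw [hasDerivAt_iff_isLittleO_nhds_zero]
    have h1 : (fun h : ℝ => h ^ 2) =o[nhds 0] fun h => h := by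
      simpa using Asymptotics.isLittleO_pow_id (one_lt_two)
    refine (Asymptotics.IsBigO.of_bound 1 ?_).trans_isLittleO h1
    refine Filter.Eventually.of_forall fun h => ?_
    simp only [zero_add, max_self, smul_eq_mul, mul_zero, sub_zero, one_mul, ne_eq,
      OfNat.ofNat_ne_zero, not_false_eq_true, zero_pow, Real.norm_eq_abs, abs_pow]
    refine pow_le_pow_left₀ (abs_nonneg _) ?_ 2
    rw [abs_of_nonneg (le_max_right _ _)]
    exact max_le (le_abs_self _) (abs_nonneg _)
  · rw [max_eq_left hs.le]
    have := (hasDerivAt_pow 2 s)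
    refine (this.congr_deriv (by simp)).congr_of_eventuallyEq ?_
    filter_upwards [Ioi_mem_nhds hs] with z hz
    rw [max_eq_left (le_of_lt hz)]

/-- Summation by parts against a function supported in `A₀`. -/
lemma Env.sum_mul_lap (h : Env d Creg Criso G nbr ball ω) {A₀ F : Finset V}
    (hF : ∀ x ∈ A₀, nbr x ⊆ F) (ζ f : V → ℝ) (hζ : ∀ x, x ∉ A₀ → ζ x = 0) :
    2 * ∑ x ∈ F, ζ x * (mu nbr ω x * lap nbr ω f x) =
      -∑ x ∈ F, ∑ y ∈ F, ω x y * ((f x - f y) * (ζ x - ζ y)) := by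
  have h1 : ∑ x ∈ F, ζ x * (mu nbr ω x * lap nbr ω f x) =
      ∑ x ∈ F, ∑ y ∈ F, ω x y * ((f y - f x) * ζ x) := by
    refine sum_congr rfl fun x _ => ?_
    by_cases hx : x ∈ A₀
    · rw [h.mu_mul_lap (hF x hx), mul_sum]
      exact sum_congr rfl fun y _ => by ring
    · simp [hζ x hx]
  have h2 : ∑ x ∈ F, ζ x * (mu nbr ω x * lap nbr ω f x) =
      ∑ x ∈ F, ∑ y ∈ F, ω x y * ((f x - f y) * ζ y) := by
    rw [h1, sum_comm]
    exact sum_congr rfl fun x _ => sum_congr rfl fun y _ => by rw [h.symm]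
  rw [two_mul]
  nth_rewrite 1 [h1]
  rw [h2, ← sum_add_distrib, ← sum_neg_distrib]
  refine sum_congr rfl fun x _ => ?_
  rw [← sum_add_distrib, ← sum_neg_distrib]
  exact sum_congr rfl fun y _ => by ring

lemma Env.sum_omega_mul_le (h : Env d Creg Criso G nbr ball ω) (F : Finset V) {g : V → ℝ}
    (hg : ∀ x, 0 ≤ g x) :
    ∑ x ∈ F, ∑ y ∈ F, ω x y * g x ≤ ∑ x ∈ F, mu nbr ω x * g x := by
  refine sum_le_sum fun x _ => ?_
  rw [← sum_mul]
  exact mul_le_mul_of_nonneg_right (h.sum_omega_le x F) (hg x)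

/-- Caccioppoli inequality at a fixed time. -/
lemma Env.caccioppoli (h : Env d Creg Criso G nbr ball ω) {A₀ F : Finset V}
    (hF : ∀ x ∈ A₀, nbr x ⊆ F) (φ f : V → ℝ) (hφ : ∀ x, x ∉ A₀ → φ x = 0) (l Lip : ℝ)
    (hLip : ∀ x y, G.Adj x y → |φ x - φ y| ≤ Lip) :
    ∑ x ∈ F, φ x ^ 2 * mu nbr ω x * (2 * max (f x - l) 0 * lap nbr ω f x) ≤
      -en ω F (fun x => φ x * max (f x - l) 0) +
        Lip ^ 2 * ∑ x ∈ F, mu nbr ω x * max (f x - l) 0 ^ 2 := by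
  set g : V → ℝ := fun x => max (f x - l) 0 with hg
  have hg0 : ∀ x, 0 ≤ g x := fun x => le_max_right _ _
  have h1 : ∑ x ∈ F, φ x ^ 2 * mu nbr ω x * (2 * g x * lap nbr ω f x) ≤
      2 * ∑ x ∈ F, φ x ^ 2 * g x * (mu nbr ω x * lap nbr ω g x) := by
    rw [mul_sum]
    refine sum_le_sum fun x _ => ?_
    have h2 : g x * lap nbr ω f x ≤ g x * lap nbr ω g x := by
      rcases le_or_gt (f x - l) 0 with hx | hx
      · have : g x = 0 := max_eq_right hx
        simp [this]
      · have e : g x = f x - l := max_eq_left hx.le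
        refine mul_le_mul_of_nonneg_left ?_ (hg0 x)
        unfold lap
        refine mul_le_mul_of_nonneg_left (sum_le_sum fun y _ => ?_) (inv_nonneg.2 (h.mu_pos x).le)
        refine mul_le_mul_of_nonneg_left ?_ (h.omega_nonneg x y)
        have : f y - l ≤ g y := le_max_left _ _
        rw [e]; linarith
    have h3 : 0 ≤ 2 * (φ x ^ 2 * mu nbr ω x) :=
      mul_nonneg zero_le_two (mul_nonneg (sq_nonneg _) (h.mu_pos x).le)
    nlinarith [mul_le_mul_of_nonneg_left h2 h3]
  refine h1.trans ?_
  rw [h.sum_mul_lap hF (fun x => φ x ^ 2 * g x) g (fun x hx => by simp [hφ x hx])]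
  have h4 : -∑ x ∈ F, ∑ y ∈ F, ω x y * ((g x - g y) * (φ x ^ 2 * g x - φ y ^ 2 * g y)) =
      -en ω F (fun x => φ x * g x) + ∑ x ∈ F, ∑ y ∈ F, ω x y * (g x * g y * (φ x - φ y) ^ 2) := by
    rw [en, neg_add_eq_sub, ← sum_sub_distrib, ← sum_neg_distrib]
    refine sum_congr rfl fun x _ => ?_
    rw [← sum_sub_distrib, ← sum_neg_distrib]
    exact sum_congr rfl fun y _ => by ring
  rw [h4]
  refine add_le_add le_rfl ?_
  have h5 : ∑ x ∈ F, ∑ y ∈ F, ω x y * (g x * g y * (φ x - φ y) ^ 2) ≤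
      ∑ x ∈ F, ∑ y ∈ F, (Lip ^ 2 / 2) * (ω x y * g x ^ 2 + ω y x * g y ^ 2) := by
    refine sum_le_sum fun x _ => sum_le_sum fun y _ => ?_
    by_cases hxy : G.Adj x y
    · have h6 : (φ x - φ y) ^ 2 ≤ Lip ^ 2 := by
        rw [← sq_abs]; exact pow_le_pow_left₀ (abs_nonneg _) (hLip x y hxy) 2
      have h7 : g x * g y ≤ (g x ^ 2 + g y ^ 2) / 2 := by nlinarith [sq_nonneg (g x - g y)]
      have h8 : g x * g y * (φ x - φ y) ^ 2 ≤ (g x ^ 2 + g y ^ 2) / 2 * Lip ^ 2 :=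
        mul_le_mul h7 h6 (sq_nonneg _) (by positivity)
      rw [h.symm y x]
      nlinarith [mul_le_mul_of_nonneg_left h8 (h.omega_nonneg x y)]
    · rw [h.symm y x, h.zero x y hxy]; simp
  refine h5.trans ?_
  have h9 := h.sum_omega_mul_le F (g := fun x => g x ^ 2) (fun x => sq_nonneg _)
  have h10 : ∑ x ∈ F, ∑ y ∈ F, ω y x * g y ^ 2 = ∑ x ∈ F, ∑ y ∈ F, ω x y * g x ^ 2 := sum_comm
  simp only [← mul_sum, sum_add_distrib]
  rw [h10]
  nlinarith [mul_le_mul_of_nonneg_left h9 (sq_nonneg Lip)]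

lemma SubCaloric.continuousOn {I : Set ℝ} {B : Set V} {f : ℝ → V → ℝ}
    (hf : SubCaloric nbr ω I B f) {x : V} (hx : x ∈ B) : ContinuousOn (fun t => f t x) I :=
  fun t ht => (hf x hx t ht).choose_spec.1.continuousAt.continuousWithinAt

/-- Continuity of the truncated mass. -/
lemma continuousOn_sum_max {I : Set ℝ} {F : Finset V} {f : ℝ → V → ℝ} (c : V → ℝ) (l : ℝ)
    (hf : ∀ x ∈ F, ContinuousOn (fun t => f t x) I) :
    ContinuousOn (fun t => ∑ x ∈ F, c x * max (f t x - l) 0 ^ 2) I := by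
  refine continuousOn_finsetSum _ fun x hx => ?_
  have := hf x hx
  fun_prop

lemma continuousOn_en {I : Set ℝ} {F : Finset V} {f : ℝ → V → ℝ}
    (hf : ∀ x ∈ F, ContinuousOn (fun t => f t x) I) :
    ContinuousOn (fun t => en ω F (f t)) I := by
  unfold en
  refine continuousOn_finsetSum _ fun x hx => continuousOn_finsetSum _ fun y hy => ?_
  have := hf x hx
  have := hf y hy
  fun_prop

/-- Differential form of the energy estimate. -/
lemma Env.exists_hasDerivAt_truncated (h : Env d Creg Criso G nbr ball ω) {A₀ F : Finset V}
    (hF : ∀ x ∈ A₀, nbr x ⊆ F) {φ : V → ℝ} {f : ℝ → V → ℝ}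
    (hφ : ∀ x, x ∉ A₀ → φ x = 0) {l Lip s : ℝ}
    (hLip : ∀ x y, G.Adj x y → |φ x - φ y| ≤ Lip)
    (hf : ∀ x ∈ A₀, ∃ D, HasDerivAt (fun s => f s x) D s ∧ D ≤ lap nbr ω (f s) x) :
    ∃ D, HasDerivAt (fun t => ∑ x ∈ F, φ x ^ 2 * mu nbr ω x * max (f t x - l) 0 ^ 2) D s ∧
      D ≤ -en ω F (fun x => φ x * max (f s x - l) 0) +
        Lip ^ 2 * ∑ x ∈ F, mu nbr ω x * max (f s x - l) 0 ^ 2 := by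
  choose! D hD hD' using hf
  refine ⟨∑ x ∈ F, φ x ^ 2 * mu nbr ω x * (2 * max (f s x - l) 0 * D x), ?_, ?_⟩
  · refine HasDerivAt.fun_sum fun x _ => ?_
    by_cases hx : x ∈ A₀
    · refine HasDerivAt.const_mul _ ?_
      exact (hasDerivAt_max_sq (f s x - l)).comp s ((hD x hx).sub_const l)
    · simp only [hφ x hx]
      simpa using hasDerivAt_const s (0 : ℝ)
  · refine le_trans (sum_le_sum fun x _ => ?_) (h.caccioppoli hF φ (f s) hφ l Lip hLip)
    by_cases hx : x ∈ A₀
    · refine mul_le_mul_of_nonneg_left ?_ (mul_nonneg (sq_nonneg _) (h.mu_pos x).le)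
      exact mul_le_mul_of_nonneg_left (hD' x hx) (mul_nonneg zero_le_two (le_max_right _ _))
    · simp [hφ x hx]

/-- Energy estimate for truncations of subcaloric functions. -/
lemma Env.energy_estimate (h : Env d Creg Criso G nbr ball ω) {A₀ F : Finset V}
    (hAF : A₀ ⊆ F) (hF : ∀ x ∈ A₀, nbr x ⊆ F) {φ : V → ℝ} {f : ℝ → V → ℝ}
    (hφ : ∀ x, x ∉ A₀ → φ x = 0)
    (hφ0 : ∀ x, 0 ≤ φ x) (hφ1 : ∀ x, φ x ≤ 1) {l Lip : ℝ}
    (hLip : ∀ x y, G.Adj x y → |φ x - φ y| ≤ Lip) {a τ b t : ℝ} (hτ : 0 < τ) (ht : a + τ ≤ t)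
    (htb : t ≤ b) (hf : SubCaloric nbr ω (Set.Icc a b) (F : Set V) f) :
    ∑ x ∈ F, φ x ^ 2 * mu nbr ω x * max (f t x - l) 0 ^ 2 +
      ∫ s in (a + τ)..t, en ω F (fun x => φ x * max (f s x - l) 0) ≤
      (1 / τ + Lip ^ 2) * ∫ s in a..b, ∑ x ∈ F, mu nbr ω x * max (f s x - l) 0 ^ 2 := by
  set Ψ : ℝ → ℝ := fun t => ∑ x ∈ F, φ x ^ 2 * mu nbr ω x * max (f t x - l) 0 ^ 2 with hΨ
  set E : ℝ → ℝ := fun s => en ω F (fun x => φ x * max (f s x - l) 0) with hE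
  set Q : ℝ → ℝ := fun s => ∑ x ∈ F, mu nbr ω x * max (f s x - l) 0 ^ 2 with hQ
  have hcont : ∀ x ∈ F, ContinuousOn (fun t => f t x) (Set.Icc a b) := fun x hx =>
    hf.continuousOn (by exact_mod_cast hx)
  have hΨc : ContinuousOn Ψ (Set.Icc a b) := continuousOn_sum_max _ l hcont
  have hQc : ContinuousOn Q (Set.Icc a b) := continuousOn_sum_max _ l hcont
  have hEc : ContinuousOn E (Set.Icc a b) :=
    continuousOn_en (f := fun s x => φ x * max (f s x - l) 0) fun x hx => by
      have := hcont x hx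
      fun_prop
  have hQ0 : ∀ s, 0 ≤ Q s := fun s => sum_nonneg fun x _ =>
    mul_nonneg (h.mu_pos x).le (sq_nonneg _)
  have hE0 : ∀ s, 0 ≤ E s := fun s => h.en_nonneg _ _
  have hΨQ : ∀ s, Ψ s ≤ Q s := fun s => sum_le_sum fun x _ => by
    refine mul_le_mul_of_nonneg_right ?_ (sq_nonneg _)
    have : φ x ^ 2 ≤ 1 := pow_le_one₀ (hφ0 x) (hφ1 x)
    nlinarith [h.mu_pos x]
  have hderiv : ∀ s ∈ Set.Icc a b, ∃ D, HasDerivAt Ψ D s ∧ D ≤ -E s + Lip ^ 2 * Q s :=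
    fun s hs => h.exists_hasDerivAt_truncated hF hφ hLip
      fun x hx => hf x (by exact_mod_cast hAF hx) s hs
  choose! D hD hD' using hderiv
  have ii : ∀ {H : ℝ → ℝ}, ContinuousOn H (Set.Icc a b) → ∀ {s s'}, a ≤ s → s ≤ s' → s' ≤ b →
      IntervalIntegrable H volume s s' := fun hH s s' h1 h2 h3 =>
    (hH.mono (by rw [Set.uIcc_of_le h2]; exact Set.Icc_subset_Icc h1 h3)).intervalIntegrable
  have hab : a ≤ b := by linarith
  have key : ∀ s ∈ Set.Icc a (a + τ), Ψ t + ∫ s in (a + τ)..t, E s ≤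
      Q s + Lip ^ 2 * ∫ s in a..b, Q s := by
    intro s hs
    have hst : s ≤ t := hs.2.trans ht
    have hsub : Set.Icc s t ⊆ Set.Icc a b := Set.Icc_subset_Icc hs.1 htb
    have h1 := intervalIntegral.sub_le_integral_of_hasDeriv_right_of_le (g := Ψ) (g' := D)
      (φ := fun s => -E s + Lip ^ 2 * Q s) hst (hΨc.mono hsub)
      (fun z hz => (hD z (hsub (Set.Ioo_subset_Icc_self hz))).hasDerivWithinAt)
      (((hEc.neg.add (hQc.const_smul (Lip ^ 2))).mono hsub).integrableOn_Icc)
      (fun z hz => hD' z (hsub (Set.Ioo_subset_Icc_self hz)))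
    have iE := ii hEc hs.1 hst htb
    have iQ := ii hQc hs.1 hst htb
    rw [intervalIntegral.integral_add (f := fun s => -E s) iE.neg (iQ.const_mul _),
      intervalIntegral.integral_neg,
      intervalIntegral.integral_const_mul] at h1
    have h2 : ∫ s in (a + τ)..t, E s ≤ ∫ s in s..t, E s :=
      intervalIntegral.integral_mono_interval hs.2 ht le_rfl (Filter.Eventually.of_forall hE0) iE
    have h3 : ∫ s in s..t, Q s ≤ ∫ s in a..b, Q s :=
      intervalIntegral.integral_mono_interval hs.1 hst htb (Filter.Eventually.of_forall hQ0)
        (ii hQc le_rfl hab le_rfl)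
    have h4 := hΨQ s
    nlinarith [mul_le_mul_of_nonneg_left h3 (sq_nonneg Lip)]
  have haτ : a + τ ≤ b := ht.trans htb
  have h5 := intervalIntegral.integral_mono_on (a := a) (b := a + τ) (by linarith)
    (intervalIntegrable_const (μ := volume))
    ((ii hQc le_rfl (by linarith) haτ).add (intervalIntegrable_const)) key
  rw [intervalIntegral.integral_add (ii hQc le_rfl (by linarith) haτ) intervalIntegrable_const,
    intervalIntegral.integral_const, intervalIntegral.integral_const] at h5
  have h6 : ∫ s in a..(a + τ), Q s ≤ ∫ s in a..b, Q s :=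
    intervalIntegral.integral_mono_interval le_rfl (by linarith) haτ
      (Filter.Eventually.of_forall hQ0) (ii hQc le_rfl hab le_rfl)
  simp only [add_sub_cancel_left, smul_eq_mul] at h5
  have h7 : τ * (Ψ t + ∫ s in (a + τ)..t, E s) ≤
      τ * ((1 / τ + Lip ^ 2) * ∫ s in a..b, Q s) := by
    have : τ * ((1 / τ + Lip ^ 2) * ∫ s in a..b, Q s) =
      (∫ s in a..b, Q s) + τ * (Lip ^ 2 * ∫ s in a..b, Q s) := by field_simp
    rw [this]; linarith
  exact le_of_mul_le_mul_left h7 hτ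

end Energy

section Cutoff

variable {d : ℕ} {Creg Criso : ℝ} {V : Type} {G : SimpleGraph V} {nbr : V → Finset V}
  {ball : V → ℝ → Finset V} {ω : V → V → ℝ}

/-- Linear cutoff function: `1` at distance at most `r - w`, `0` at distance at least `r`. -/
def cut (G : SimpleGraph V) (x₀ : V) (r w : ℝ) (x : V) : ℝ :=
  max 0 (min 1 ((r - G.dist x₀ x) / w))

lemma cut_nonneg (x₀ : V) (r w : ℝ) (x : V) : 0 ≤ cut G x₀ r w x := le_max_left _ _

lemma cut_le_one (x₀ : V) (r w : ℝ) (x : V) : cut G x₀ r w x ≤ 1 :=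
  max_le zero_le_one (min_le_left _ _)

lemma Env.cut_eq_zero (h : Env d Creg Criso G nbr ball ω) {x₀ : V} {r w : ℝ} (hw : 0 < w) {x : V}
    (hx : x ∉ ball x₀ r) : cut G x₀ r w x = 0 := by
  rw [h.mem_ball, not_le] at hx
  refine max_eq_left ((min_le_right _ _).trans ?_)
  exact div_nonpos_of_nonpos_of_nonneg (by linarith) hw.le

lemma Env.cut_eq_one (h : Env d Creg Criso G nbr ball ω) {x₀ : V} {r w r₁ : ℝ} (hw : 0 < w)
    (hr : r₁ + w ≤ r) {x : V} (hx : x ∈ ball x₀ r₁) : cut G x₀ r w x = 1 := by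
  rw [h.mem_ball] at hx
  have : 1 ≤ (r - G.dist x₀ x) / w := by rw [le_div_iff₀ hw]; linarith
  rw [cut, min_eq_left this, max_eq_right zero_le_one]

lemma Env.abs_cut_sub_le (h : Env d Creg Criso G nbr ball ω) (x₀ : V) (r : ℝ) {w : ℝ} (hw : 0 < w)
    {x y : V} (hxy : G.Adj x y) : |cut G x₀ r w x - cut G x₀ r w y| ≤ 1 / w := by
  have h1 : |(r - G.dist x₀ x) / w - (r - G.dist x₀ y) / w| ≤ 1 / w := by
    rw [← sub_div, abs_div, abs_of_pos hw]
    gcongr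
    rw [sub_sub_sub_cancel_left, abs_sub_comm]
    exact h.abs_dist_sub_le hxy
  refine le_trans ?_ h1
  refine (abs_max_sub_max_le_max _ _ _ _).trans ?_
  rw [sub_self, abs_zero]
  refine max_le (abs_nonneg _) ((abs_min_sub_min_le_max _ _ _ _).trans ?_)
  rw [sub_self, abs_zero]
  exact max_le (abs_nonneg _) le_rfl

/-- Energy estimate with a linear cutoff between two concentric balls. -/
lemma Env.energy_estimate_ball (h : Env d Creg Criso G nbr ball ω) {x₀ : V} {r₁ r : ℝ}
    (hr : r₁ + 2 ≤ r) {f : ℝ → V → ℝ} (l : ℝ) {a τ b t : ℝ} (hτ : 0 < τ) (ht : a + τ ≤ t)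
    (htb : t ≤ b) (hf : SubCaloric nbr ω (Set.Icc a b) (ball x₀ r : Set V) f) :
    ∑ x ∈ ball x₀ r, cut G x₀ (r - 1) ((r - r₁) / 2) x ^ 2 * mu nbr ω x * max (f t x - l) 0 ^ 2 +
      ∫ s in (a + τ)..t, en ω (ball x₀ r)
        (fun x => cut G x₀ (r - 1) ((r - r₁) / 2) x * max (f s x - l) 0) ≤
      (1 / τ + 4 / (r - r₁) ^ 2) *
        ∫ s in a..b, ∑ x ∈ ball x₀ r, mu nbr ω x * max (f s x - l) 0 ^ 2 := by
  have hw : 0 < (r - r₁) / 2 := by linarith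
  have := h.energy_estimate (A₀ := ball x₀ (r - 1)) (F := ball x₀ r)
    (h.ball_mono x₀ (by linarith)) (fun x hx => h.nbr_subset_ball (by linarith) hx)
    (φ := cut G x₀ (r - 1) ((r - r₁) / 2)) (fun x hx => h.cut_eq_zero hw hx)
    (cut_nonneg _ _ _) (cut_le_one _ _ _) (l := l)
    (fun x y hxy => h.abs_cut_sub_le x₀ (r - 1) hw hxy) hτ ht htb hf
  refine this.trans_eq ?_
  congr 2
  have : r - r₁ ≠ 0 := by linarith
  field_simp; norm_num

end Cutoff

section DeGiorgi

/-- One step of the De Giorgi iteration. -/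
lemma exists_deGiorgi_step (d : ℕ) (hd : 2 ≤ d) (Creg Criso : ℝ) (hCreg : 0 < Creg)
    (hCriso : 0 < Criso) (p q : ℝ) (hp : 1 < p) (hq : 1 < q) (hpq : 1 / p + 1 / q < 2 / (d : ℝ)) :
    ∃ β K : ℝ, 1 < β ∧ β < 2 ∧ 0 < K ∧
      ∀ {V : Type} {G : SimpleGraph V} {nbr : V → Finset V} {ball : V → ℝ → Finset V}
        {ω : V → V → ℝ} (_ : Env d Creg Criso G nbr ball ω) {A n : ℝ} {x₀ : V}
        (_ : Ctrl d p q Creg A n (ball x₀ n) nbr ω) {r₁ r : ℝ} (_ : r₁ + 2 ≤ r) (_ : r ≤ n)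
        {f : ℝ → V → ℝ} {l l' : ℝ} (_ : l < l') {a τ b : ℝ} (_ : 0 < τ) (_ : a + τ ≤ b)
        (_ : SubCaloric nbr ω (Set.Icc a b) (ball x₀ r : Set V) f),
        (∫ s in (a + τ)..b, ∑ x ∈ ball x₀ r₁, mu nbr ω x * max (f s x - l') 0 ^ 2) ≤
          ((l' - l) ^ 2)⁻¹ ^ (β - 1) * (K * A ^ 2) * n ^ 2 * ((n ^ d)⁻¹) ^ (β - 1) *
          ((1 / τ + 4 / (r - r₁) ^ 2) *
            ∫ s in a..b, ∑ x ∈ ball x₀ r, mu nbr ω x * max (f s x - l) 0 ^ 2) ^ β := by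
  obtain ⟨β, K, hβ1, hβ2, hK, hslice⟩ := exists_slice d hd Creg Criso hCreg hCriso p q hp hq hpq
  refine ⟨β, K, hβ1, hβ2, hK, ?_⟩
  intro V G nbr ball ω h A n x₀ hc r₁ r hr hrn f l l' hl a τ b hτ hab hf
  have hn := hc.one_le_n
  have hw : 0 < (r - r₁) / 2 := by linarith
  set φ := cut G x₀ (r - 1) ((r - r₁) / 2) with hφ
  set F := ball x₀ r with hF
  set X := ∫ s in a..b, ∑ x ∈ F, mu nbr ω x * max (f s x - l) 0 ^ 2 with hX
  set Z := (1 / τ + 4 / (r - r₁) ^ 2) * X with hZ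
  set c := ((l' - l) ^ 2)⁻¹ ^ (β - 1) * (K * A ^ 2) * n ^ 2 * ((n ^ d)⁻¹) ^ (β - 1) with hcdef
  have hc0 : 0 ≤ c := by positivity
  set E : ℝ → ℝ := fun s => en ω F (fun x => φ x * max (f s x - l) 0) with hE
  have hE0 : ∀ s, 0 ≤ E s := fun s => h.en_nonneg _ _
  have hcont : ∀ x ∈ F, ContinuousOn (fun t => f t x) (Set.Icc a b) := fun x hx =>
    hf.continuousOn (by exact_mod_cast hx)
  have hEc : ContinuousOn E (Set.Icc a b) :=
    continuousOn_en (f := fun s x => φ x * max (f s x - l) 0) fun x hx => by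
      have := hcont x hx
      fun_prop
  have hsub : Set.Icc (a + τ) b ⊆ Set.Icc a b := Set.Icc_subset_Icc (by linarith) le_rfl
  have hEst : ∀ t ∈ Set.Icc (a + τ) b, _ := fun t ht =>
    h.energy_estimate_ball hr l hτ ht.1 ht.2 hf
  have hΨE : ∀ t, ∑ x ∈ F, φ x ^ 2 * mu nbr ω x * max (f t x - l) 0 ^ 2 =
      ∑ x ∈ F, mu nbr ω x * (φ x * max (f t x - l) 0) ^ 2 := fun t =>
    sum_congr rfl fun x _ => by ring
  have hΨ0 : ∀ t, 0 ≤ ∑ x ∈ F, mu nbr ω x * (φ x * max (f t x - l) 0) ^ 2 := fun t =>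
    sum_nonneg fun x _ => mul_nonneg (h.mu_pos x).le (sq_nonneg _)
  have hΨZ : ∀ t ∈ Set.Icc (a + τ) b,
      ∑ x ∈ F, mu nbr ω x * (φ x * max (f t x - l) 0) ^ 2 ≤ Z := fun t ht => by
    have h1 := hEst t ht
    have h2 : 0 ≤ ∫ s in (a + τ)..t, E s :=
      intervalIntegral.integral_nonneg ht.1 fun s _ => hE0 s
    rw [← hΨE]
    exact (le_add_of_nonneg_right h2).trans h1
  have hEZ : ∫ s in (a + τ)..b, E s ≤ Z := by
    have h1 := hEst b ⟨hab, le_rfl⟩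
    rw [hΨE] at h1
    exact (le_add_of_nonneg_left (hΨ0 b)).trans h1
  have hZ0 : 0 ≤ Z := (hΨ0 b).trans (hΨZ b ⟨hab, le_rfl⟩)
  have hll : 0 < (l' - l) ^ 2 := by have := sub_pos.2 hl; positivity
  have hpt : ∀ t ∈ Set.Icc (a + τ) b,
      ∑ x ∈ ball x₀ r₁, mu nbr ω x * max (f t x - l') 0 ^ 2 ≤ c * Z ^ (β - 1) * E t := by
    intro t ht
    have h1 : ∑ x ∈ ball x₀ r₁, mu nbr ω x * max (f t x - l') 0 ^ 2 ≤
        ((l' - l) ^ 2)⁻¹ ^ (β - 1) *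
          ∑ x ∈ F, mu nbr ω x * (φ x * max (f t x - l) 0) ^ (2 * β) := by
      rw [mul_sum]
      refine le_trans (sum_le_sum fun x hx => ?_) (sum_le_sum_of_subset_of_nonneg
        (h.ball_mono x₀ (by linarith : r₁ ≤ r)) fun x _ _ => ?_)
      · rw [hφ, h.cut_eq_one hw (by linarith) hx, one_mul]
        have hm := h.mu_pos x
        rcases le_or_gt (f t x - l') 0 with hle | hgt
        · rw [max_eq_right hle, zero_pow two_ne_zero, mul_zero]
          have : 0 ≤ max (f t x - l) 0 := le_max_right _ _
          positivity
        · have h2 : max (f t x - l') 0 ≤ max (f t x - l) 0 := max_le_max (by linarith) le_rfl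
          have h3 : l' - l ≤ max (f t x - l) 0 := le_max_of_le_left (by linarith)
          have h4 : 0 < max (f t x - l) 0 := (sub_pos.2 hl).trans_le h3
          set g := max (f t x - l) 0
          have h5 : g ^ (2 * β) = g ^ 2 * (g ^ 2) ^ (β - 1) := by
            rw [← Real.rpow_natCast, ← Real.rpow_mul h4.le, ← Real.rpow_add h4]
            congr 1; push_cast; ring
          have h6 : 1 ≤ ((l' - l) ^ 2)⁻¹ ^ (β - 1) * (g ^ 2) ^ (β - 1) := by
            rw [← Real.mul_rpow (by positivity) (by positivity)]
            refine Real.one_le_rpow ?_ (by linarith)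
            rw [inv_mul_eq_div, one_le_div hll]
            exact pow_le_pow_left₀ (sub_pos.2 hl).le h3 2
          have h7 : max (f t x - l') 0 ^ 2 ≤ g ^ 2 := pow_le_pow_left₀ (le_max_right _ _) h2 2
          calc _ ≤ mu nbr ω x * g ^ 2 * 1 := by
                rw [mul_one]; exact mul_le_mul_of_nonneg_left h7 hm.le
            _ ≤ mu nbr ω x * g ^ 2 * (((l' - l) ^ 2)⁻¹ ^ (β - 1) * (g ^ 2) ^ (β - 1)) :=
                mul_le_mul_of_nonneg_left h6 (by positivity)
            _ = _ := by rw [h5]; ring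
      · have := cut_nonneg (G := G) x₀ (r - 1) ((r - r₁) / 2) x
        have h3 : 0 ≤ φ x * max (f t x - l) 0 := mul_nonneg this (le_max_right _ _)
        have := h.mu_pos x
        positivity
    have h2 := hslice h (hc.mono h hp hq (h.ball_mono x₀ hrn)) (A₀ := ball x₀ (r - 1)) (F := F)
      (h.ball_mono x₀ (by linarith)) (fun x hx => h.nbr_subset_ball (by linarith) hx)
      (fun x => φ x * max (f t x - l) 0)
      (fun x => mul_nonneg (cut_nonneg _ _ _ _) (le_max_right _ _))
      (fun x hx => by rw [hφ, h.cut_eq_zero hw hx, zero_mul])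
    refine h1.trans ((mul_le_mul_of_nonneg_left h2 (by positivity)).trans ?_)
    have h3 : ((∑ x ∈ F, mu nbr ω x * (φ x * max (f t x - l) 0) ^ 2) / n ^ d) ^ (β - 1) ≤
        ((n ^ d)⁻¹) ^ (β - 1) * Z ^ (β - 1) := by
      rw [← Real.mul_rpow (by positivity) hZ0, inv_mul_eq_div]
      refine Real.rpow_le_rpow (div_nonneg (hΨ0 t) (by positivity)) ?_ (by linarith)
      gcongr
      exact hΨZ t ht
    calc _ ≤ ((l' - l) ^ 2)⁻¹ ^ (β - 1) * (K * A ^ 2 * (((n ^ d)⁻¹) ^ (β - 1) * Z ^ (β - 1)) *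
          (n ^ 2 * E t)) := by
            refine mul_le_mul_of_nonneg_left ?_ (by positivity)
            refine mul_le_mul_of_nonneg_right ?_ (mul_nonneg (by positivity) (hE0 t))
            exact mul_le_mul_of_nonneg_left h3 (by positivity)
      _ = _ := by rw [hcdef]; ring
  have iE : IntervalIntegrable E volume (a + τ) b :=
    (hEc.mono (by rw [Set.uIcc_of_le hab]; exact hsub)).intervalIntegrable
  have iQ : IntervalIntegrable
      (fun s => ∑ x ∈ ball x₀ r₁, mu nbr ω x * max (f s x - l') 0 ^ 2) volume (a + τ) b := by
    refine ContinuousOn.intervalIntegrable ?_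
    rw [Set.uIcc_of_le hab]
    exact (continuousOn_sum_max _ l' fun x hx =>
      hcont x (h.ball_mono x₀ (by linarith : r₁ ≤ r) hx)).mono hsub
  calc _ ≤ ∫ s in (a + τ)..b, c * Z ^ (β - 1) * E s :=
        intervalIntegral.integral_mono_on hab iQ (iE.const_mul _) hpt
    _ = c * Z ^ (β - 1) * ∫ s in (a + τ)..b, E s := intervalIntegral.integral_const_mul _ _
    _ ≤ c * Z ^ (β - 1) * Z :=
        mul_le_mul_of_nonneg_left hEZ (mul_nonneg hc0 (Real.rpow_nonneg hZ0 _))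
    _ = c * Z ^ β := by
        rw [mul_assoc, ← Real.rpow_add_one' hZ0 (by linarith)]; ring_nf

end DeGiorgi

section MeanValue

/-- Numerical induction step for the De Giorgi iteration. -/
lemma deGiorgi_recursion {β K A θ D Λ L x y : ℝ} (hβ : 1 < β) (hK : 0 < K) (hA : 0 < A)
    (hθ : 0 < θ) (hL : 0 < L) (hD : 0 < D) (hΛ : 0 < Λ) (k : ℕ)
    (hDβ : (4 : ℝ) ^ (2 * β - 1) ≤ D ^ (β - 1))
    (hΛβ : K * A ^ 2 * (5 * (θ ^ 2)⁻¹) ^ β * 4 ^ (2 * β - 1) * D ≤ Λ ^ (β - 1))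
    (hx0 : 0 ≤ x) (hx : x ≤ L / Λ * (D ^ k)⁻¹)
    (hy : y ≤ ((4 : ℝ) ^ (k + 1) / L) ^ (β - 1) * (K * A ^ 2) *
      (5 * (θ ^ 2)⁻¹ * 4 ^ (k + 1) * x) ^ β) :
    y ≤ L / Λ * (D ^ (k + 1))⁻¹ := by
  have hβ0 : 0 < β - 1 := by linarith
  set Y := L / Λ * (D ^ k)⁻¹ with hY
  have hY0 : 0 < Y := by positivity
  set T : ℝ := 4 ^ (k + 1) with hT
  have hT0 : 0 < T := by positivity
  set P := 5 * (θ ^ 2)⁻¹ with hP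
  have hP0 : 0 < P := by positivity
  have h1 : y ≤ (T / L) ^ (β - 1) * (K * A ^ 2) * (P * T * Y) ^ β := by
    refine hy.trans (mul_le_mul_of_nonneg_left ?_ (by positivity))
    exact Real.rpow_le_rpow (by positivity) (by gcongr) (by linarith)
  have hYL : Y / L = Λ⁻¹ * (D ^ k)⁻¹ := by rw [hY]; field_simp
  have hYβ : Y ^ β = Y ^ (β - 1) * Y := by
    rw [← Real.rpow_add_one hY0.ne']; ring_nf
  have hTT : T ^ (β - 1) * T ^ β = (4 ^ (2 * β - 1)) ^ (k + 1) := by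
    rw [← Real.rpow_add hT0, hT, ← Real.rpow_natCast, ← Real.rpow_natCast (4 ^ (2 * β - 1)),
      ← Real.rpow_mul (by norm_num), ← Real.rpow_mul (by norm_num)]
    congr 1; ring
  have hYL' : (Y / L) ^ (β - 1) = (Λ ^ (β - 1))⁻¹ * ((D ^ (β - 1)) ^ k)⁻¹ := by
    rw [hYL, Real.mul_rpow (by positivity) (by positivity), Real.inv_rpow hΛ.le,
      Real.inv_rpow (by positivity), ← Real.rpow_natCast D k, ← Real.rpow_natCast (D ^ (β - 1)),
      ← Real.rpow_mul hD.le, ← Real.rpow_mul hD.le, mul_comm (k : ℝ)]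
  have h2 : (T / L) ^ (β - 1) * (K * A ^ 2) * (P * T * Y) ^ β =
      K * A ^ 2 * P ^ β * (4 ^ (2 * β - 1)) ^ (k + 1) * (Y / L) ^ (β - 1) * Y := by
    rw [Real.mul_rpow (by positivity) hY0.le, Real.mul_rpow hP0.le hT0.le, hYβ, ← hTT,
      Real.div_rpow hT0.le hL.le, Real.div_rpow hY0.le hL.le]
    ring
  set a : ℝ := 4 ^ (2 * β - 1) with ha
  have ha0 : 0 < a := by positivity
  have hDp : 0 < D ^ (β - 1) := by positivity
  have hΛp : 0 < Λ ^ (β - 1) := by positivity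
  have h3 : a ^ k * ((D ^ (β - 1)) ^ k)⁻¹ ≤ 1 := by
    rw [← div_eq_mul_inv]
    exact div_le_one_of_le₀ (pow_le_pow_left₀ ha0.le hDβ k) (by positivity)
  have h4 : K * A ^ 2 * P ^ β * a * (Λ ^ (β - 1))⁻¹ ≤ D⁻¹ := by
    rw [← div_eq_mul_inv, div_le_iff₀ hΛp, ← div_eq_inv_mul, le_div_iff₀ hD]
    exact hΛβ
  calc y ≤ _ := h1
    _ = (K * A ^ 2 * P ^ β * a * (Λ ^ (β - 1))⁻¹) * (a ^ k * ((D ^ (β - 1)) ^ k)⁻¹) * Y := by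
        rw [h2, hYL', pow_succ]; ring
    _ ≤ D⁻¹ * 1 * Y := by gcongr
    _ = _ := by rw [hY, pow_succ]; field_simp

set_option maxHeartbeats 3200000 in
/-- Local maximum principle for subcaloric functions. -/
lemma exists_meanValue (d : ℕ) (hd : 2 ≤ d) (Creg Criso : ℝ) (hCreg : 0 < Creg)
    (hCriso : 0 < Criso) (p q : ℝ) (hp : 1 < p) (hq : 1 < q) (hpq : 1 / p + 1 / q < 2 / (d : ℝ)) :
    ∃ C κ : ℝ, 1 ≤ C ∧ 1 ≤ κ ∧
      ∀ {V : Type} {G : SimpleGraph V} {nbr : V → Finset V} {ball : V → ℝ → Finset V}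
        {ω : V → V → ℝ} (_ : Env d Creg Criso G nbr ball ω) {A n : ℝ} {x₀ : V}
        (_ : Ctrl d p q Creg A n (ball x₀ n) nbr ω) {θ r : ℝ} (_ : 0 < θ) (_ : θ ≤ 1)
        (_ : 2 ≤ θ * n) (_ : r + θ * n ≤ n) {a b : ℝ} (_ : a + θ * n ^ 2 ≤ b) {f : ℝ → V → ℝ}
        (_ : SubCaloric nbr ω (Set.Icc a b) (ball x₀ (r + θ * n) : Set V) f),
        ∀ t ∈ Set.Icc (a + θ * n ^ 2) b, ∀ x ∈ ball x₀ r,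
          max (f t x) 0 ^ 2 ≤ C * (A / θ) ^ κ * ((n ^ (d + 2))⁻¹ *
            ∫ s in a..b, ∑ x ∈ ball x₀ (r + θ * n), mu nbr ω x * max (f s x) 0 ^ 2) := by
  obtain ⟨β, K, hβ1, hβ2, hK, hstep⟩ :=
    exists_deGiorgi_step d hd Creg Criso hCreg hCriso p q hp hq hpq
  have hβ0 : 0 < β - 1 := by linarith
  set D : ℝ := (4 : ℝ) ^ ((2 * β - 1) / (β - 1)) + 4 * 4 ^ d with hD
  have hD0 : 0 < D := by positivity
  have hDβ : (4 : ℝ) ^ (2 * β - 1) ≤ D ^ (β - 1) := by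
    calc (4 : ℝ) ^ (2 * β - 1) = ((4 : ℝ) ^ ((2 * β - 1) / (β - 1))) ^ (β - 1) := by
          rw [← Real.rpow_mul (by norm_num), div_mul_cancel₀ _ hβ0.ne']
      _ ≤ _ := Real.rpow_le_rpow (by positivity) (le_add_of_nonneg_right (by positivity)) hβ0.le
  set K' := K * 5 ^ β * 4 ^ (2 * β - 1) * D with hK'
  have hK'0 : 0 < K' := by positivity
  set C₀ := max 1 (max (K' ^ (1 / (β - 1))) (5 * Creg * 4 ^ (2 * d))) with hC₀
  have hC₀1 : 1 ≤ C₀ := le_max_left _ _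
  set κ := max (4 / (β - 1)) (2 * d + 3 : ℝ) with hκ
  have hκ1 : 1 ≤ κ := le_max_of_le_right (by linarith [Nat.cast_nonneg (α := ℝ) d])
  refine ⟨4 * C₀, κ, by linarith, hκ1, ?_⟩
  intro V G nbr ball ω h A n x₀ hc θ r hθ hθ1 hθn hrn a b hab f hf t ht x hx
  have hA := hc.one_le_A
  have hn := hc.one_le_n
  have hn0 : 0 < n := by linarith
  have hAθ : 1 ≤ A / θ := by rw [le_div_iff₀ hθ]; linarith
  set Λ := C₀ * (A / θ) ^ κ with hΛ
  have hΛ0 : 0 < Λ := by positivity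
  have hΛ1 : K * A ^ 2 * (5 * (θ ^ 2)⁻¹) ^ β * 4 ^ (2 * β - 1) * D ≤ Λ ^ (β - 1) := by
    have h1 : A ^ 2 * ((θ ^ 2)⁻¹) ^ β ≤ (A / θ) ^ (4 : ℝ) := by
      have h2 : ((θ ^ 2)⁻¹) ^ β ≤ ((θ ^ 2)⁻¹) ^ (2 : ℝ) := by
        refine Real.rpow_le_rpow_of_exponent_le ?_ hβ2.le
        rw [one_le_inv₀ (by positivity)]; exact pow_le_one₀ hθ.le hθ1
      have h3 : ((θ ^ 2)⁻¹) ^ (2 : ℝ) = (θ ^ 4)⁻¹ := by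
        rw [Real.rpow_two]; field_simp
      have h4 : (A / θ) ^ (4 : ℝ) = A ^ 4 * (θ ^ 4)⁻¹ := by
        rw [show (4 : ℝ) = (4 : ℕ) by norm_num, Real.rpow_natCast, div_pow, div_eq_mul_inv]
      rw [h4]
      refine mul_le_mul (pow_le_pow_right₀ hA (by norm_num)) (h2.trans h3.le) (by positivity)
        (by positivity)
    have h5 : (K' ^ (1 / (β - 1))) * (A / θ) ^ (4 / (β - 1)) ≤ Λ := by
      refine mul_le_mul ((le_max_left _ _).trans (le_max_right _ _))
        (Real.rpow_le_rpow_of_exponent_le hAθ (le_max_left _ _)) (by positivity) (by positivity)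
    calc _ = K' * (A ^ 2 * ((θ ^ 2)⁻¹) ^ β) := by
          rw [Real.mul_rpow (by norm_num) (by positivity), hK']; ring
      _ ≤ K' * (A / θ) ^ (4 : ℝ) := mul_le_mul_of_nonneg_left h1 hK'0.le
      _ = ((K' ^ (1 / (β - 1))) * (A / θ) ^ (4 / (β - 1))) ^ (β - 1) := by
          rw [Real.mul_rpow (by positivity) (by positivity), ← Real.rpow_mul hK'0.le,
            ← Real.rpow_mul (by positivity), div_mul_cancel₀ _ hβ0.ne', div_mul_cancel₀ _ hβ0.ne',
            Real.rpow_one]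
      _ ≤ _ := Real.rpow_le_rpow (by positivity) h5 hβ0.le
  have hΛ2 : 5 * Creg * 4 ^ (2 * d) * (A * (θ ^ (2 * d + 2))⁻¹) ≤ Λ := by
    have h1 : A * (θ ^ (2 * d + 2))⁻¹ ≤ (A / θ) ^ (2 * d + 3) := by
      have h2 : A / θ * ((1 : ℝ) / θ) ^ (2 * d + 2) ≤ A / θ * (A / θ) ^ (2 * d + 2) := by
        gcongr
      refine le_trans ?_ (h2.trans_eq (by rw [← pow_succ']))
      rw [one_div, inv_pow]
      refine mul_le_mul_of_nonneg_right ?_ (by positivity)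
      rw [le_div_iff₀ hθ]; nlinarith
    refine mul_le_mul ((le_max_right _ _).trans (le_max_right _ _)) (h1.trans ?_) (by positivity)
      (by positivity)
    rw [← Real.rpow_natCast]
    refine Real.rpow_le_rpow_of_exponent_le hAθ ?_
    push_cast
    exact le_max_right _ _
  obtain ⟨J, hJ1, hJ2⟩ := exists_nat_pow_near (x := θ * n / 2) (y := 2) (by linarith) one_lt_two
  set X₀ := (n ^ (d + 2))⁻¹ *
    ∫ s in a..b, ∑ x ∈ ball x₀ (r + θ * n), mu nbr ω x * max (f s x) 0 ^ 2 with hX₀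
  set ρ : ℕ → ℝ := fun k => r + θ * n * (2 ^ k)⁻¹ with hρ
  set α : ℕ → ℝ := fun k => a + θ * n ^ 2 * (1 - (2 ^ k)⁻¹) with hα
  have hρle : ∀ k, ρ k ≤ r + θ * n := fun k => by
    have : ((2 : ℝ) ^ k)⁻¹ ≤ 1 := inv_le_one_of_one_le₀ (one_le_pow₀ one_le_two)
    have h2 : 0 < θ * n := by positivity
    simp only [hρ]; nlinarith
  have hαge : ∀ k, a ≤ α k := fun k => by
    have : ((2 : ℝ) ^ k)⁻¹ ≤ 1 := inv_le_one_of_one_le₀ (one_le_pow₀ one_le_two)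
    have h2 : 0 < θ * n ^ 2 := by positivity
    simp only [hα]; nlinarith
  have hαlt : ∀ k, α k + θ * n ^ 2 * (2 ^ k)⁻¹ = a + θ * n ^ 2 := fun k => by
    simp only [hα]; ring
  have hsub : ∀ k, SubCaloric nbr ω (Set.Icc (α k) b) (ball x₀ (ρ k) : Set V) f :=
    fun k y hy s hs =>
    hf y (by exact_mod_cast h.ball_mono x₀ (hρle k) (by exact_mod_cast hy)) s
      ⟨(hαge k).trans hs.1, hs.2⟩
  have hpow2 : ∀ k : ℕ, ((2 : ℝ) ^ k) ^ 2 = 4 ^ k := fun k => by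
    rw [← pow_mul, mul_comm, pow_mul]; norm_num
  have hcoef : ∀ k : ℕ, 1 / (θ * n ^ 2 * ((2 : ℝ) ^ k)⁻¹) + 4 / (θ * n * (2 ^ k)⁻¹) ^ 2 ≤
      5 * (θ ^ 2)⁻¹ * 4 ^ k * (n ^ 2)⁻¹ := fun k => by
    have h1 : (1 : ℝ) ≤ 2 ^ k := one_le_pow₀ one_le_two
    have h2 : 1 / (θ * n ^ 2 * ((2 : ℝ) ^ k)⁻¹) ≤ (θ ^ 2)⁻¹ * 4 ^ k * (n ^ 2)⁻¹ := by
      rw [← hpow2]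
      have : 1 / (θ * n ^ 2 * ((2 : ℝ) ^ k)⁻¹) = θ⁻¹ * 2 ^ k * (n ^ 2)⁻¹ := by field_simp
      rw [this]
      refine mul_le_mul_of_nonneg_right (mul_le_mul ?_ ?_ (by positivity) (by positivity))
        (by positivity)
      · rw [← inv_pow]; exact le_self_pow₀ ((one_le_inv₀ hθ).2 hθ1) two_ne_zero
      · exact le_self_pow₀ h1 two_ne_zero
    have h3 : 4 / (θ * n * ((2 : ℝ) ^ k)⁻¹) ^ 2 = 4 * ((θ ^ 2)⁻¹ * 4 ^ k * (n ^ 2)⁻¹) := by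
      rw [← hpow2]; field_simp
    rw [h3]; linarith
  have main : ∀ l : ℝ, 0 < l → Λ * X₀ ≤ l ^ 2 → f t x ≤ 2 * l := by
    intro l hl hlX
    set lev : ℕ → ℝ := fun k => l * (1 - (2 ^ k)⁻¹) with hlev
    set X : ℕ → ℝ := fun k => (n ^ (d + 2))⁻¹ *
      ∫ s in (α k)..b, ∑ x ∈ ball x₀ (ρ k), mu nbr ω x * max (f s x - lev k) 0 ^ 2 with hX
    have hαb : ∀ k, α k ≤ b := fun k => by
      have : 0 < θ * n ^ 2 * ((2 : ℝ) ^ k)⁻¹ := by positivity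
      linarith [hαlt k]
    have hX0 : ∀ k, 0 ≤ X k := fun k => by
      refine mul_nonneg (by positivity) (intervalIntegral.integral_nonneg (hαb k) fun s _ => ?_)
      exact sum_nonneg fun x _ => mul_nonneg (h.mu_pos x).le (sq_nonneg _)
    have hXk : ∀ k, k ≤ J → X k ≤ l ^ 2 / Λ * (D ^ k)⁻¹ := by
      intro k
      induction k with
      | zero =>
        intro _
        have e1 : X 0 = X₀ := by simp [hX, hX₀, hα, hρ, hlev]
        rw [e1, pow_zero, inv_one, mul_one, le_div_iff₀ hΛ0, mul_comm]
        exact hlX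
      | succ k ih =>
        intro hk
        have ihk := ih (by omega)
        refine deGiorgi_recursion hβ1 hK (by linarith) hθ (by positivity) hD0 hΛ0 k hDβ hΛ1 (hX0 k)
          ihk ?_
        have hstep2 : ρ k - ρ (k + 1) = θ * n * (2 ^ (k + 1))⁻¹ := by
          simp only [hρ, pow_succ]; field_simp; ring
        have hge2 : 2 ≤ θ * n * ((2 : ℝ) ^ (k + 1))⁻¹ := by
          have : (2 : ℝ) ^ (k + 1) ≤ 2 ^ J := pow_le_pow_right₀ one_le_two hk
          rw [← div_eq_mul_inv, le_div_iff₀ (by positivity)]; linarith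
        have hτ : 0 < θ * n ^ 2 * ((2 : ℝ) ^ (k + 1))⁻¹ := by positivity
        have hαs : α k + θ * n ^ 2 * (2 ^ (k + 1))⁻¹ = α (k + 1) := by
          simp only [hα, pow_succ]; field_simp; ring
        have hlevs : lev (k + 1) - lev k = l * (2 ^ (k + 1))⁻¹ := by
          simp only [hlev, pow_succ]; field_simp; ring
        have hs := hstep h hc (r₁ := ρ (k + 1)) (r := ρ k) (by linarith) ((hρle k).trans hrn)
          (l := lev k) (l' := lev (k + 1)) (by
            have : 0 < l * ((2 : ℝ) ^ (k + 1))⁻¹ := by positivity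
            linarith) hτ (by rw [hαs]; exact hαb _) (hsub k)
        rw [hαs, hlevs, hstep2] at hs
        set I := ∫ s in (α k)..b, ∑ x ∈ ball x₀ (ρ k), mu nbr ω x * max (f s x - lev k) 0 ^ 2
          with hI
        have hI0 : 0 ≤ I := intervalIntegral.integral_nonneg (hαb k) fun s _ =>
          sum_nonneg fun x _ => mul_nonneg (h.mu_pos x).le (sq_nonneg _)
        have hXI : X k = (n ^ (d + 2))⁻¹ * I := rfl
        have h1 : ((1 / (θ * n ^ 2 * ((2 : ℝ) ^ (k + 1))⁻¹) +
            4 / (θ * n * (2 ^ (k + 1))⁻¹) ^ 2) * I) ^ β ≤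
            (n ^ d * (5 * (θ ^ 2)⁻¹ * 4 ^ (k + 1) * X k)) ^ β := by
          refine Real.rpow_le_rpow (by positivity) ?_ (by linarith)
          refine (mul_le_mul_of_nonneg_right (hcoef (k + 1)) hI0).trans_eq ?_
          rw [hXI]; field_simp; ring
        have h2 : (((l * ((2 : ℝ) ^ (k + 1))⁻¹) ^ 2)⁻¹) ^ (β - 1) =
            (4 ^ (k + 1) / l ^ 2) ^ (β - 1) := by
          congr 1
          rw [← hpow2]; field_simp
        have h3 : ((n ^ d)⁻¹) ^ (β - 1) * (n ^ d * (5 * (θ ^ 2)⁻¹ * 4 ^ (k + 1) * X k)) ^ β =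
            n ^ d * (5 * (θ ^ 2)⁻¹ * 4 ^ (k + 1) * X k) ^ β := by
          have hXk0 := hX0 k
          rw [Real.mul_rpow (by positivity) (by positivity), ← mul_assoc, Real.inv_rpow
            (by positivity), ← Real.rpow_neg (by positivity), ← Real.rpow_add (by positivity)]
          congr 1
          have : -(β - 1) + β = 1 := by ring
          rw [this, Real.rpow_one]
        change (n ^ (d + 2))⁻¹ * _ ≤ _
        rw [inv_mul_le_iff₀ (by positivity)]
        refine hs.trans ?_
        rw [h2]
        refine (mul_le_mul_of_nonneg_left h1 (by positivity)).trans_eq ?_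
        rw [mul_assoc, h3, pow_add]; ring
    have hXJ := hXk J le_rfl
    have hge2 : 2 ≤ θ * n * ((2 : ℝ) ^ J)⁻¹ := by
      rw [← div_eq_mul_inv, le_div_iff₀ (by positivity)]; linarith
    have hest := h.energy_estimate_ball (x₀ := x₀) (r₁ := r) (r := ρ J)
      (by simp only [hρ]; linarith) (lev J) (a := α J) (τ := θ * n ^ 2 * (2 ^ J)⁻¹)
      (b := b) (t := t)
      (by positivity) (by rw [hαlt]; exact ht.1) ht.2 (hsub J)
    have hw : 0 < (ρ J - r) / 2 := by simp only [hρ]; linarith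
    have hxJ : x ∈ ball x₀ (ρ J) := h.ball_mono x₀ (by simp only [hρ]; linarith) hx
    have h1 : mu nbr ω x * max (f t x - lev J) 0 ^ 2 ≤
        5 * (θ ^ 2)⁻¹ * 4 ^ J * (n ^ d * X J) := by
      have h2 := single_le_sum (f := fun x => cut G x₀ (ρ J - 1) ((ρ J - r) / 2) x ^ 2 *
        mu nbr ω x * max (f t x - lev J) 0 ^ 2) (fun y _ => mul_nonneg (mul_nonneg (sq_nonneg _)
          (h.mu_pos y).le) (sq_nonneg _)) hxJ
      have h3 : 0 ≤ ∫ s in (α J + θ * n ^ 2 * (2 ^ J)⁻¹)..t, en ω (ball x₀ (ρ J))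
        (fun x => cut G x₀ (ρ J - 1) ((ρ J - r) / 2) x * max (f s x - lev J) 0) :=
        intervalIntegral.integral_nonneg (by rw [hαlt]; exact ht.1) fun s _ => h.en_nonneg _ _
      rw [h.cut_eq_one hw (by simp only [hρ]; linarith) hx, one_pow, one_mul] at h2
      refine h2.trans ((le_add_of_nonneg_right h3).trans (hest.trans ?_))
      have e : ρ J - r = θ * n * (2 ^ J)⁻¹ := by simp only [hρ]; ring
      rw [e]
      refine (mul_le_mul_of_nonneg_right (hcoef J) ?_).trans_eq ?_
      · exact intervalIntegral.integral_nonneg (hαb J) fun s _ =>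
          sum_nonneg fun x _ => mul_nonneg (h.mu_pos x).le (sq_nonneg _)
      · simp only [hX, pow_add]; field_simp
    have hxn : x ∈ ball x₀ n := h.ball_mono x₀ ((hρle J).trans hrn) hxJ
    have hinv := hc.inv_mu_le h hq hxn
    have hDJ : (4 : ℝ) ^ J * (D ^ J)⁻¹ ≤ 4 ^ (2 * d) * (θ ^ (2 * d))⁻¹ * (n ^ (2 * d))⁻¹ := by
      have h2 : (4 : ℝ) * 4 ^ d ≤ D := by
        rw [hD]; exact le_add_of_nonneg_left (by positivity)
      have h3 : (4 : ℝ) ^ J * (D ^ J)⁻¹ ≤ ((4 ^ d) ^ J)⁻¹ := by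
        rw [← div_eq_mul_inv, div_le_iff₀ (by positivity), ← div_eq_inv_mul,
          le_div_iff₀ (by positivity), ← mul_pow]
        exact pow_le_pow_left₀ (by positivity) h2 J
      refine h3.trans ?_
      have h4 : θ * n ≤ 4 * 2 ^ J := by rw [pow_succ] at hJ2; linarith
      have h5 : (θ * n) ^ (2 * d) ≤ 4 ^ (2 * d) * (4 ^ d) ^ J := by
        refine (pow_le_pow_left₀ (by positivity) h4 _).trans_eq ?_
        rw [mul_pow, ← pow_mul, ← pow_mul, show (4 : ℝ) ^ (d * J) = (2 ^ 2) ^ (d * J) by norm_num,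
          ← pow_mul]
        congr 2; ring
      rw [inv_le_iff_one_le_mul₀ (by positivity)]
      have h6 : 4 ^ (2 * d) * (θ ^ (2 * d))⁻¹ * (n ^ (2 * d))⁻¹ * ((4 : ℝ) ^ d) ^ J =
          (4 ^ (2 * d) * (4 ^ d) ^ J) / (θ * n) ^ (2 * d) := by
        rw [mul_pow]; field_simp
      rw [h6, one_le_div (by positivity)]
      exact h5
    have hfin : max (f t x - lev J) 0 ^ 2 ≤ l ^ 2 := by
      have hm := h.mu_pos x
      calc max (f t x - lev J) 0 ^ 2
          = (mu nbr ω x)⁻¹ * (mu nbr ω x * max (f t x - lev J) 0 ^ 2) := by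
            field_simp
        _ ≤ (Creg * n ^ d * A) * (5 * (θ ^ 2)⁻¹ * 4 ^ J * (n ^ d * (l ^ 2 / Λ * (D ^ J)⁻¹))) := by
            refine mul_le_mul hinv (h1.trans ?_) (by positivity) (by positivity)
            gcongr
        _ = (Creg * n ^ d * A) * (5 * (θ ^ 2)⁻¹ * (n ^ d * (l ^ 2 / Λ))) *
            ((4 : ℝ) ^ J * (D ^ J)⁻¹) := by ring
        _ ≤ (Creg * n ^ d * A) * (5 * (θ ^ 2)⁻¹ * (n ^ d * (l ^ 2 / Λ))) *
            (4 ^ (2 * d) * (θ ^ (2 * d))⁻¹ * (n ^ (2 * d))⁻¹) := by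
            gcongr
        _ = (5 * Creg * 4 ^ (2 * d) * (A * (θ ^ (2 * d + 2))⁻¹)) / Λ * l ^ 2 := by
            rw [pow_add θ, two_mul d, pow_add n]; field_simp
        _ ≤ 1 * l ^ 2 := by
            refine mul_le_mul_of_nonneg_right ?_ (sq_nonneg _)
            exact div_le_one_of_le₀ hΛ2 hΛ0.le
        _ = l ^ 2 := one_mul _
    have h7 : max (f t x - lev J) 0 ≤ l := le_of_sq_le_sq hfin hl.le
    have h8 : lev J ≤ l := by
      have : 0 < ((2 : ℝ) ^ J)⁻¹ := by positivity
      simp only [hlev]; nlinarith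
    linarith [(le_max_left (f t x - lev J) 0).trans h7]
  have hX₀0 : 0 ≤ X₀ := by
    refine mul_nonneg (by positivity) (intervalIntegral.integral_nonneg ?_ fun s _ => ?_)
    · have : 0 < θ * n ^ 2 := by positivity
      linarith
    · exact sum_nonneg fun x _ => mul_nonneg (h.mu_pos x).le (sq_nonneg _)
  refine le_of_forall_pos_le_add fun ε hε => ?_
  have h1 := main (Real.sqrt (Λ * X₀ + ε / 4)) (Real.sqrt_pos.2 (by positivity))
    (by rw [Real.sq_sqrt (by positivity)]; linarith)
  have h2 : max (f t x) 0 ≤ 2 * Real.sqrt (Λ * X₀ + ε / 4) := max_le h1 (by positivity)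
  refine (pow_le_pow_left₀ (le_max_right _ _) h2 2).trans_eq ?_
  rw [mul_pow, Real.sq_sqrt (by positivity), hΛ]; ring

end MeanValue

section MeanValueOne

variable {d : ℕ} {Creg Criso : ℝ} {V : Type} {G : SimpleGraph V} {nbr : V → Finset V}
  {ball : V → ℝ → Finset V} {ω : V → V → ℝ}

lemma Caloric.subCaloric {I : Set ℝ} {B : Set V} {u : ℝ → V → ℝ} (hu : Caloric nbr ω I B u) :
    SubCaloric nbr ω I B u := fun x hx t ht => ⟨_, hu x hx t ht, le_rfl⟩

lemma Caloric.mono {I J : Set ℝ} {B B' : Set V} {u : ℝ → V → ℝ} (hu : Caloric nbr ω I B u)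
    (hJ : J ⊆ I) (hB : B' ⊆ B) : Caloric nbr ω J B' u := fun x hx t ht =>
  hu x (hB hx) t (hJ ht)

lemma Caloric.continuousOn {I : Set ℝ} {B : Set V} {u : ℝ → V → ℝ} (hu : Caloric nbr ω I B u)
    {x : V} (hx : x ∈ B) : ContinuousOn (fun t => u t x) I := hu.subCaloric.continuousOn hx

lemma Caloric.continuousOn_sum {I : Set ℝ} {F : Finset V} {u : ℝ → V → ℝ}
    (hu : Caloric nbr ω I (F : Set V) u) (c : V → ℝ) :
    ContinuousOn (fun t => ∑ x ∈ F, c x * u t x) I := by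
  refine continuousOn_finsetSum _ fun x hx => ?_
  have := hu.continuousOn (x := x) (by exact_mod_cast hx)
  fun_prop

lemma Env.lap_add_self (h : Env d Creg Criso G nbr ball ω) (f : V → ℝ) (x : V) :
    lap nbr ω f x + f x = (mu nbr ω x)⁻¹ * ∑ y ∈ nbr x, ω x y * f y := by
  have hm := (h.mu_pos x).ne'
  have : ∑ y ∈ nbr x, ω x y * (f y - f x) = ∑ y ∈ nbr x, ω x y * f y - mu nbr ω x * f x := by
    rw [mu, sum_mul, ← sum_sub_distrib]
    exact sum_congr rfl fun y _ => by ring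
  rw [lap, this]
  field_simp
  ring

/-- The derivative of `exp t * u t x` for a caloric function. -/
lemma Env.hasDerivAt_exp_mul (h : Env d Creg Criso G nbr ball ω) {I : Set ℝ} {B : Set V}
    {u : ℝ → V → ℝ} (hu : Caloric nbr ω I B u) {x : V} (hx : x ∈ B) {t : ℝ} (ht : t ∈ I) :
    HasDerivAt (fun s => Real.exp s * u s x)
      (Real.exp t * ((mu nbr ω x)⁻¹ * ∑ y ∈ nbr x, ω x y * u t y)) t := by
  rw [← h.lap_add_self]
  exact ((Real.hasDerivAt_exp t).mul (hu x hx t ht)).congr_deriv (by ring)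

lemma Env.monotoneOn_exp_mul (h : Env d Creg Criso G nbr ball ω) {a b : ℝ} {B : Set V}
    {u : ℝ → V → ℝ} (hu : Caloric nbr ω (Set.Icc a b) B u)
    (hu0 : ∀ t ∈ Set.Icc a b, ∀ x, 0 ≤ u t x) {x : V} (hx : x ∈ B) :
    MonotoneOn (fun s => Real.exp s * u s x) (Set.Icc a b) := by
  refine monotoneOn_of_hasDerivWithinAt_nonneg (convex_Icc a b)
    (fun t ht => (h.hasDerivAt_exp_mul hu hx ht).continuousAt.continuousWithinAt)
    (fun t ht => (h.hasDerivAt_exp_mul hu hx (interior_subset ht)).hasDerivWithinAt)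
    fun t ht => ?_
  have hm := h.mu_pos x
  exact mul_nonneg (Real.exp_nonneg _) (mul_nonneg (inv_nonneg.2 hm.le) (sum_nonneg fun y _ =>
    mul_nonneg (h.omega_nonneg x y) (hu0 t (interior_subset ht) y)))

/-- A point value is bounded by the mass over a unit time interval. -/
lemma Env.mul_le_integral (h : Env d Creg Criso G nbr ball ω) {a b : ℝ} {F : Finset V}
    {u : ℝ → V → ℝ} (hu : Caloric nbr ω (Set.Icc a (b + 1)) (F : Set V) u)
    (hu0 : ∀ t ∈ Set.Icc a (b + 1), ∀ x, 0 ≤ u t x) {x : V} (hx : x ∈ F) {t : ℝ}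
    (ht : t ∈ Set.Icc a b) :
    mu nbr ω x * u t x ≤ 3 * ∫ s in a..(b + 1), ∑ x ∈ F, mu nbr ω x * u s x := by
  have hm := h.mu_pos x
  have hab : a ≤ b + 1 := by linarith [ht.1, ht.2]
  have hsub : Set.Icc t (t + 1) ⊆ Set.Icc a (b + 1) := Set.Icc_subset_Icc ht.1 (by linarith [ht.2])
  have hcont := hu.continuousOn_sum (mu nbr ω)
  have hnn : ∀ s ∈ Set.Icc a (b + 1), 0 ≤ ∑ x ∈ F, mu nbr ω x * u s x := fun s hs =>
    sum_nonneg fun y _ => mul_nonneg (h.mu_pos y).le (hu0 s hs y)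
  have htI : t ∈ Set.Icc a (b + 1) := ⟨ht.1, by linarith [ht.2]⟩
  have h1 : ∀ s ∈ Set.Icc t (t + 1), Real.exp (-1) * (mu nbr ω x * u t x) ≤
      ∑ x ∈ F, mu nbr ω x * u s x := fun s hs => by
    have h2 := h.monotoneOn_exp_mul hu hu0 (x := x) (by exact_mod_cast hx) htI (hsub hs) hs.1
    simp only at h2
    have h3 : Real.exp (-1) * u t x ≤ u s x := by
      have h4 : Real.exp (t - s) * u t x ≤ u s x := by
        have e : Real.exp s * Real.exp (t - s) = Real.exp t := by
          rw [← Real.exp_add]; ring_nf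
        refine le_of_mul_le_mul_left ?_ (Real.exp_pos s)
        rw [← mul_assoc, e]
        exact h2
      refine le_trans (mul_le_mul_of_nonneg_right (Real.exp_le_exp.2 ?_) (hu0 t htI x)) h4
      linarith [hs.2]
    refine le_trans ?_ (single_le_sum (f := fun x => mu nbr ω x * u s x)
      (fun y _ => mul_nonneg (h.mu_pos y).le (hu0 s (hsub hs) y)) hx)
    calc _ = mu nbr ω x * (Real.exp (-1) * u t x) := by ring
      _ ≤ _ := mul_le_mul_of_nonneg_left h3 hm.le
  have h2 : Real.exp (-1) * (mu nbr ω x * u t x) ≤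
      ∫ s in t..(t + 1), ∑ x ∈ F, mu nbr ω x * u s x := by
    have := intervalIntegral.integral_mono_on (a := t) (b := t + 1) (by linarith)
      (intervalIntegrable_const (μ := volume) (c := Real.exp (-1) * (mu nbr ω x * u t x)))
      ((hcont.mono hsub).intervalIntegrable_of_Icc (by linarith)) h1
    simpa using this
  have h3 : ∫ s in t..(t + 1), ∑ x ∈ F, mu nbr ω x * u s x ≤
      ∫ s in a..(b + 1), ∑ x ∈ F, mu nbr ω x * u s x := by
    refine intervalIntegral.integral_mono_interval ht.1 (by linarith) (by linarith [ht.2]) ?_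
      (hcont.intervalIntegrable_of_Icc hab)
    filter_upwards [ae_restrict_mem measurableSet_Ioc] with s hs using hnn s ⟨hs.1.le, hs.2⟩
  have h4 : 1 ≤ 3 * Real.exp (-1) := by
    rw [Real.exp_neg, ← div_eq_mul_inv, one_le_div (Real.exp_pos _)]
    linarith [Real.exp_one_lt_d9]
  have h5 : 0 ≤ mu nbr ω x * u t x := mul_nonneg hm.le (hu0 t htI x)
  calc mu nbr ω x * u t x ≤ 3 * Real.exp (-1) * (mu nbr ω x * u t x) :=
        le_mul_of_one_le_left h5 h4
    _ = 3 * (Real.exp (-1) * (mu nbr ω x * u t x)) := by ring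
    _ ≤ _ := by linarith

lemma rpow_mul_le_of_sq_le {C A ρ κ₀ κ U N : ℝ} (hC : 0 ≤ C) (hA : 1 ≤ A) (hρ : 0 < ρ)
    (hρ1 : ρ ≤ 1) (hκ : κ₀ ≤ κ) (hU : 0 ≤ U) (hN : 0 ≤ N)
    (h : U ^ 2 ≤ C * (A / (ρ / 2)) ^ κ₀ * (2 ^ κ * U * N)) :
    ρ ^ κ * U ≤ C * 4 ^ κ * A ^ κ * N := by
  rcases hU.eq_or_lt with rfl | hU
  · rw [mul_zero]; positivity
  have h1 : U ≤ C * (A / (ρ / 2)) ^ κ₀ * (2 ^ κ * N) := by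
    refine le_of_mul_le_mul_right ?_ hU
    rw [← sq]; refine h.trans_eq ?_; ring
  have h2 : (A / (ρ / 2)) ^ κ₀ ≤ (A / (ρ / 2)) ^ κ := by
    refine Real.rpow_le_rpow_of_exponent_le ?_ hκ
    rw [le_div_iff₀ (by positivity)]; linarith
  have h3 : ρ ^ κ * (A / (ρ / 2)) ^ κ = 2 ^ κ * A ^ κ := by
    rw [← Real.mul_rpow hρ.le (by positivity), ← Real.mul_rpow (by norm_num) (by positivity)]
    congr 1; field_simp
  have h4 : (4 : ℝ) ^ κ = 2 ^ κ * 2 ^ κ := by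
    rw [← Real.mul_rpow (by norm_num) (by norm_num)]; norm_num
  calc ρ ^ κ * U ≤ ρ ^ κ * (C * (A / (ρ / 2)) ^ κ * (2 ^ κ * N)) := by
        gcongr
        refine h1.trans ?_
        gcongr
    _ = C * 2 ^ κ * N * (ρ ^ κ * (A / (ρ / 2)) ^ κ) := by ring
    _ = _ := by rw [h3, h4]; ring

set_option maxHeartbeats 1600000 in
/-- Mean value inequality with respect to the `L¹` norm for nonnegative caloric functions. -/
lemma exists_meanValue_one (d : ℕ) (hd : 2 ≤ d) (Creg Criso : ℝ) (hCreg : 0 < Creg)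
    (hCriso : 0 < Criso) (p q : ℝ) (hp : 1 < p) (hq : 1 < q) (hpq : 1 / p + 1 / q < 2 / (d : ℝ)) :
    ∃ C κ : ℝ, 1 ≤ C ∧ 1 ≤ κ ∧
      ∀ {V : Type} {G : SimpleGraph V} {nbr : V → Finset V} {ball : V → ℝ → Finset V}
        {ω : V → V → ℝ} (_ : Env d Creg Criso G nbr ball ω) {A n : ℝ} {x₀ : V}
        (_ : Ctrl d p q Creg A n (ball x₀ n) nbr ω) {θ R : ℝ} (_ : 0 < θ) (_ : R ≤ n) {a b : ℝ}
        {u : ℝ → V → ℝ} (_ : Caloric nbr ω (Set.Icc a (b + 1)) (ball x₀ R : Set V) u)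
        (_ : ∀ t ∈ Set.Icc a (b + 1), ∀ x, 0 ≤ u t x),
        ∀ t ∈ Set.Icc (a + θ * n ^ 2) b, ∀ x ∈ ball x₀ (R - θ * n),
          u t x ≤ C * (A / θ) ^ κ * ((n ^ (d + 2))⁻¹ *
            ∫ s in a..(b + 1), ∑ x ∈ ball x₀ R, mu nbr ω x * u s x) := by
  obtain ⟨C₀, κ₀, hC₀, hκ₀, hmv⟩ := exists_meanValue d hd Creg Criso hCreg hCriso p q hp hq hpq
  set κ := max κ₀ (2 * d + 2 : ℝ) with hκ
  have hκ1 : 1 ≤ κ := hκ₀.trans (le_max_left _ _)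
  have h4κ : (1 : ℝ) ≤ 4 ^ κ := Real.one_le_rpow (by norm_num) (by linarith)
  refine ⟨max C₀ (3 * Creg) * 4 ^ κ, κ, ?_, hκ1, ?_⟩
  · exact one_le_mul_of_one_le_of_one_le (hC₀.trans (le_max_left _ _)) h4κ
  intro V G nbr ball ω h A n x₀ hc θ R hθ hRn a b u hu hu0 t ht x hx
  have hA := hc.one_le_A
  have hn := hc.one_le_n
  have hn0 : 0 < n := by linarith
  have hθn : 0 < θ * n ^ 2 := by positivity
  have hab : a ≤ b := by linarith [ht.1, ht.2]
  set I := ∫ s in a..(b + 1), ∑ x ∈ ball x₀ R, mu nbr ω x * u s x with hI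
  have hcont := hu.continuousOn_sum (mu nbr ω)
  have hnn : ∀ s ∈ Set.Icc a (b + 1), 0 ≤ ∑ x ∈ ball x₀ R, mu nbr ω x * u s x := fun s hs =>
    sum_nonneg fun y _ => mul_nonneg (h.mu_pos y).le (hu0 s hs y)
  have hI0 : 0 ≤ I := intervalIntegral.integral_nonneg (by linarith) hnn
  set N := (n ^ (d + 2))⁻¹ * I with hN
  have hN0 : 0 ≤ N := by positivity
  set W : ℝ → V → ℝ := fun s y => min ((R - G.dist x₀ y) / n) ((s - a) / n ^ 2) with hW
  have hxR : x ∈ ball x₀ R := h.ball_mono x₀ (by nlinarith) hx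
  have hW0 : ∀ s ∈ Set.Icc a b, ∀ y ∈ ball x₀ R, 0 ≤ W s y := fun s hs y hy => by
    rw [h.mem_ball] at hy
    exact le_min (div_nonneg (by linarith) hn0.le) (div_nonneg (by linarith [hs.1]) (by positivity))
  have hWθ : θ ≤ W t x := by
    rw [h.mem_ball] at hx
    refine le_min ?_ ?_
    · rw [le_div_iff₀ hn0]; linarith
    · rw [le_div_iff₀ (by positivity)]; linarith [ht.1]
  have htab : t ∈ Set.Icc a b := ⟨by linarith [ht.1], ht.2⟩
  have hsub : Set.Icc a b ⊆ Set.Icc a (b + 1) := Set.Icc_subset_Icc_right (by linarith)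
  obtain ⟨⟨t₁, x₁⟩, ⟨ht₁, hx₁⟩, hmax⟩ : ∃ z : ℝ × V, (z.1 ∈ Set.Icc a b ∧ z.2 ∈ ball x₀ R) ∧
      ∀ s ∈ Set.Icc a b, ∀ y ∈ ball x₀ R, W s y ^ κ * u s y ≤ W z.1 z.2 ^ κ * u z.1 z.2 := by
    have h1 : ∀ y ∈ ball x₀ R, ∃ s ∈ Set.Icc a b, ∀ s' ∈ Set.Icc a b,
        W s' y ^ κ * u s' y ≤ W s y ^ κ * u s y := fun y hy => by
      refine isCompact_Icc.exists_isMaxOn ⟨t, htab⟩ (f := fun s => W s y ^ κ * u s y) ?_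
      refine ContinuousOn.mul ?_ ((hu.continuousOn (x := y) (by exact_mod_cast hy)).mono hsub)
      refine ContinuousOn.rpow_const ?_ fun _ _ => Or.inr (by linarith)
      simp only [hW]
      fun_prop
    choose! τ hτ hτ' using h1
    obtain ⟨y, hy, hy'⟩ := exists_max_image (ball x₀ R) (fun y => W (τ y) y ^ κ * u (τ y) y)
      ⟨x, hxR⟩
    exact ⟨(τ y, y), ⟨hτ y hy, hy⟩, fun s hs z hz => (hτ' z hz s hs).trans (hy' z hz)⟩
  simp only at ht₁ hx₁ hmax
  set ρ := W t₁ x₁ with hρ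
  have hρ0 : 0 ≤ ρ := hW0 _ ht₁ _ hx₁
  have hρ1 : ρ ≤ (R - G.dist x₀ x₁) / n := min_le_left _ _
  have hρ2 : ρ ≤ (t₁ - a) / n ^ 2 := min_le_right _ _
  rw [le_div_iff₀ hn0] at hρ1
  rw [le_div_iff₀ (by positivity)] at hρ2
  have hρle : ρ ≤ 1 := by
    have : (0 : ℝ) ≤ G.dist x₀ x₁ := Nat.cast_nonneg _
    nlinarith
  have hU0 := hu0 t₁ (hsub ht₁) x₁
  have key : ρ ^ κ * u t₁ x₁ ≤ max C₀ (3 * Creg) * 4 ^ κ * A ^ κ * N := by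
    by_cases hbig : 4 ≤ ρ * n
    · have hρpos : 0 < ρ := by
        by_contra hc'
        nlinarith
      have hball : ∀ y ∈ ball x₀ (G.dist x₀ x₁ + ρ / 2 * n), y ∈ ball x₀ R := fun y hy =>
        h.ball_mono x₀ (by nlinarith) hy
      have hIcc : Set.Icc (t₁ - ρ / 2 * n ^ 2) t₁ ⊆ Set.Icc a b :=
        Set.Icc_subset_Icc (by nlinarith) ht₁.2
      have hmv' := hmv h hc (θ := ρ / 2) (r := G.dist x₀ x₁) (by positivity) (by linarith)
        (by linarith) (by nlinarith) (a := t₁ - ρ / 2 * n ^ 2) (b := t₁) (by linarith) (f := u)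
        (hu.mono (hIcc.trans hsub) (fun y hy => by exact_mod_cast hball y (by exact_mod_cast hy))
          ).subCaloric t₁ ⟨by linarith, le_rfl⟩ x₁ ((h.mem_ball _ _ _).2 le_rfl)
      rw [max_eq_left hU0] at hmv'
      have hle : ∀ s ∈ Set.Icc (t₁ - ρ / 2 * n ^ 2) t₁, ∀ y ∈ ball x₀ (G.dist x₀ x₁ + ρ / 2 * n),
          u s y ≤ 2 ^ κ * u t₁ x₁ := fun s hs y hy => by
        have h1 := hmax s (hIcc hs) y (hball y hy)
        have h2 : ρ / 2 ≤ W s y := by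
          rw [h.mem_ball] at hy
          refine le_min ?_ ?_
          · rw [le_div_iff₀ hn0]; linarith
          · rw [le_div_iff₀ (by positivity)]; linarith [hs.1]
        have h3 : (ρ / 2) ^ κ * u s y ≤ ρ ^ κ * u t₁ x₁ :=
          (mul_le_mul_of_nonneg_right (Real.rpow_le_rpow (by positivity) h2 (by linarith))
            (hu0 s (hsub (hIcc hs)) y)).trans h1
        rw [Real.div_rpow hρ0 (by norm_num), div_mul_eq_mul_div, div_le_iff₀ (by positivity)] at h3
        refine le_of_mul_le_mul_left (h3.trans_eq ?_) (Real.rpow_pos_of_pos hρpos κ)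
        ring
      have hint : ∫ s in (t₁ - ρ / 2 * n ^ 2)..t₁, ∑ x ∈ ball x₀ (G.dist x₀ x₁ + ρ / 2 * n),
          mu nbr ω x * max (u s x) 0 ^ 2 ≤ 2 ^ κ * u t₁ x₁ * I := by
        have hle' : t₁ - ρ / 2 * n ^ 2 ≤ t₁ := by nlinarith
        have hcs := hcont.mono hsub |>.mono hIcc
        calc _ ≤ ∫ s in (t₁ - ρ / 2 * n ^ 2)..t₁,
              2 ^ κ * u t₁ x₁ * ∑ x ∈ ball x₀ R, mu nbr ω x * u s x := by
              refine intervalIntegral.integral_mono_on hle' ?_ ?_ fun s hs => ?_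
              · refine ContinuousOn.intervalIntegrable_of_Icc hle' ?_
                have := continuousOn_sum_max (F := ball x₀ (G.dist x₀ x₁ + ρ / 2 * n))
                  (I := Set.Icc (t₁ - ρ / 2 * n ^ 2) t₁) (f := u) (mu nbr ω) 0 fun y hy =>
                    (hu.continuousOn (by exact_mod_cast hball y hy)).mono (hIcc.trans hsub)
                simpa only [sub_zero] using this
              · exact ContinuousOn.intervalIntegrable_of_Icc hle' (continuousOn_const.mul hcs)
              · rw [mul_sum]
                refine (sum_le_sum (g := fun y => 2 ^ κ * u t₁ x₁ * (mu nbr ω y * u s y))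
                  fun y hy => ?_).trans (sum_le_sum_of_subset_of_nonneg hball fun y _ _ => ?_)
                · have h0 := hu0 s (hsub (hIcc hs)) y
                  rw [max_eq_left h0, sq]
                  calc _ = mu nbr ω y * u s y * u s y := by ring
                    _ ≤ mu nbr ω y * u s y * (2 ^ κ * u t₁ x₁) := mul_le_mul_of_nonneg_left
                        (hle s hs y hy) (mul_nonneg (h.mu_pos y).le h0)
                    _ = _ := by ring
                · have h0 := hu0 s (hsub (hIcc hs)) y
                  have := h.mu_pos y
                  positivity
          _ = 2 ^ κ * u t₁ x₁ * ∫ s in (t₁ - ρ / 2 * n ^ 2)..t₁,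
                ∑ x ∈ ball x₀ R, mu nbr ω x * u s x := intervalIntegral.integral_const_mul _ _
          _ ≤ _ := by
              refine mul_le_mul_of_nonneg_left ?_ (by positivity)
              refine intervalIntegral.integral_mono_interval (by nlinarith) hle'
                (by linarith [ht₁.2]) ?_ (hcont.intervalIntegrable_of_Icc (by linarith))
              filter_upwards [ae_restrict_mem measurableSet_Ioc] with s hs
                using hnn s ⟨hs.1.le, hs.2⟩
      have hfin := rpow_mul_le_of_sq_le (C := C₀) (by linarith) hA hρpos hρle (le_max_left _ _) hU0
        hN0 (κ := κ) (κ₀ := κ₀) (U := u t₁ x₁) (hmv'.trans (by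
          refine mul_le_mul_of_nonneg_left ?_ (by positivity)
          rw [hN]
          calc _ ≤ (n ^ (d + 2))⁻¹ * (2 ^ κ * u t₁ x₁ * I) :=
                mul_le_mul_of_nonneg_left hint (by positivity)
            _ = _ := by ring))
      refine hfin.trans ?_
      gcongr
      exact le_max_left _ _
    · push Not at hbig
      have h1 := h.mul_le_integral hu hu0 hx₁ ht₁
      have hm := h.mu_pos x₁
      have h2 := hc.inv_mu_le h hq (h.ball_mono x₀ hRn hx₁)
      have h3 : u t₁ x₁ ≤ 3 * Creg * A * n ^ (2 * d + 2) * N := by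
        calc u t₁ x₁ = (mu nbr ω x₁)⁻¹ * (mu nbr ω x₁ * u t₁ x₁) := by field_simp
          _ ≤ (Creg * n ^ d * A) * (3 * I) := by gcongr
          _ = _ := by
              rw [hN]; field_simp; ring
      have h4 : ρ ^ κ ≤ 4 ^ κ * (n ^ (2 * d + 2))⁻¹ := by
        have h5 : ρ ≤ 4 / n := by rw [le_div_iff₀ hn0]; exact hbig.le
        refine (Real.rpow_le_rpow hρ0 h5 (by linarith)).trans ?_
        rw [Real.div_rpow (by norm_num) hn0.le, div_eq_mul_inv]
        gcongr
        rw [← Real.rpow_natCast]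
        refine Real.rpow_le_rpow_of_exponent_le hn ?_
        push_cast
        exact le_max_right _ _
      have h6 : A ≤ A ^ κ := by
        simpa using Real.rpow_le_rpow_of_exponent_le hA hκ1
      calc ρ ^ κ * u t₁ x₁
          ≤ 4 ^ κ * (n ^ (2 * d + 2))⁻¹ * (3 * Creg * A * n ^ (2 * d + 2) * N) := by
            gcongr
        _ = 3 * Creg * 4 ^ κ * A * N := by field_simp
        _ ≤ _ := by
            gcongr
            exact le_max_right _ _
  have h1 := (hmax t htab x hxR).trans key
  have h2 : θ ^ κ * u t x ≤ W t x ^ κ * u t x := mul_le_mul_of_nonneg_right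
    (Real.rpow_le_rpow hθ.le hWθ (by linarith)) (hu0 t (hsub htab) x)
  rw [Real.div_rpow (by linarith) hθ.le]
  have h3 := h2.trans h1
  have h4 : 0 < θ ^ κ := Real.rpow_pos_of_pos hθ κ
  rw [mul_comm, ← le_div_iff₀ h4] at h3
  refine h3.trans_eq ?_
  field_simp

end MeanValueOne

section Dirichlet

variable {d : ℕ} {Creg Criso : ℝ} {V : Type} {G : SimpleGraph V} {nbr : V → Finset V}
  {ball : V → ℝ → Finset V} {ω : V → V → ℝ}

open Classical in
/-- Extension by zero of a function defined on a finite set. -/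
def extZero (F : Finset V) : (F → ℝ) →ₗ[ℝ] (V → ℝ) where
  toFun g x := if hx : x ∈ F then g ⟨x, hx⟩ else 0
  map_add' g g' := by
    ext x
    by_cases hx : x ∈ F <;> simp [hx]
  map_smul' c g := by
    ext x
    by_cases hx : x ∈ F <;> simp [hx]

/-- The generator with Dirichlet boundary conditions on a finite set. -/
def dirichletLap (nbr : V → Finset V) (ω : V → V → ℝ) (F : Finset V) :
    (F → ℝ) →L[ℝ] (F → ℝ) :=
  LinearMap.toContinuousLinearMap
    { toFun := fun g x => lap nbr ω (extZero F g) x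
      map_add' := fun g g' => by
        ext x
        simp only [lap, map_add, Pi.add_apply, ← mul_add, ← sum_add_distrib]
        congr 1
        exact sum_congr rfl fun y _ => by ring
      map_smul' := fun c g => by
        ext x
        simp only [lap, map_smul, Pi.smul_apply, smul_eq_mul, RingHom.id_apply, mul_sum]
        exact sum_congr rfl fun y _ => by ring }

/-- Existence of solutions of the heat equation with Dirichlet boundary conditions. -/
lemma exists_dirichlet (nbr : V → Finset V) (ω : V → V → ℝ) (F : Finset V) (g₀ : V → ℝ)
    (hg₀ : ∀ x, x ∉ F → g₀ x = 0) :
    ∃ v : ℝ → V → ℝ, v 0 = g₀ ∧ (∀ t x, x ∉ F → v t x = 0) ∧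
      Caloric nbr ω Set.univ (F : Set V) v := by
  refine ⟨fun t => extZero F (NormedSpace.exp (t • dirichletLap nbr ω F) fun x => g₀ x), ?_, ?_, ?_⟩
  · ext x
    by_cases hx : x ∈ F
    · simp [extZero, hx]
    · simp [extZero, hx, hg₀]
  · intro t x hx
    simp [extZero, hx]
  · intro x hx t _
    have hx' : x ∈ F := by exact_mod_cast hx
    have h1 := hasDerivAt_exp_smul_const' (𝕂 := ℝ) (dirichletLap nbr ω F) t
    have h2 := (h1.clm_apply (hasDerivAt_const t (fun x : F => g₀ x)))
    have h3 := (hasDerivAt_pi.1 h2) ⟨x, hx'⟩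
    have e : ∀ g : F → ℝ, extZero F g x = g ⟨x, hx'⟩ := fun g => by simp [extZero, hx']
    simp only [e]
    refine h3.congr_deriv ?_
    simp [dirichletLap]

lemma exists_nbr_superset (nbr : V → Finset V) (F : Finset V) :
    ∃ F' : Finset V, F ⊆ F' ∧ ∀ x ∈ F, nbr x ⊆ F' := by
  classical
  exact ⟨F ∪ F.biUnion nbr, subset_union_left, fun x hx =>
    (subset_biUnion_of_mem nbr hx).trans subset_union_right⟩

/-- Minimum principle. -/
lemma Env.nonneg_of_caloric (h : Env d Creg Criso G nbr ball ω) {F : Finset V} {f : ℝ → V → ℝ}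
    (hf : Caloric nbr ω Set.univ (F : Set V) f) (hout : ∀ t x, x ∉ F → 0 ≤ f t x)
    (h0 : ∀ x, 0 ≤ f 0 x) {t : ℝ} (ht : 0 ≤ t) (x : V) : 0 ≤ f t x := by
  by_cases hx : x ∉ F
  · exact hout t x hx
  push Not at hx
  obtain ⟨F', hFF', hF'⟩ := exists_nbr_superset nbr F
  set Ψ : ℝ → ℝ := fun s => ∑ x ∈ F', mu nbr ω x * max (-f s x) 0 ^ 2 with hΨ
  have hind : ∀ s, ∑ x ∈ F', ind F x ^ 2 * mu nbr ω x * max (-f s x - 0) 0 ^ 2 = Ψ s := fun s => by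
    refine sum_congr rfl fun y _ => ?_
    by_cases hy : y ∈ F
    · simp [ind, hy]
    · simp [ind, hy, hout s y hy]
  have hder : ∀ s, ∃ D, HasDerivAt Ψ D s ∧ D ≤ Ψ s := fun s => by
    obtain ⟨D, hD, hD'⟩ := h.exists_hasDerivAt_truncated hF' (φ := ind F) (f := fun s x => -f s x)
      (fun y hy => by simp [ind, hy]) (l := 0) (Lip := 1) (s := s) (fun y z _ => by
        unfold ind; split_ifs <;> simp)
      (fun y hy => ⟨_, (hf y (by exact_mod_cast hy) s trivial).neg,
        by
          refine le_of_eq ?_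
          simp only [lap, ← mul_neg, ← sum_neg_distrib]
          congr 1
          exact sum_congr rfl fun z _ => by ring⟩)
    refine ⟨D, ?_, ?_⟩
    · simp only [hind] at hD
      exact hD
    · have := h.en_nonneg F' (fun x => ind F x * max (-f s x - 0) 0)
      simp only [sub_zero] at hD' this
      have e : ∑ x ∈ F', mu nbr ω x * max (-f s x) 0 ^ 2 = Ψ s := rfl
      rw [e] at hD'
      linarith
  choose D hD hD' using hder
  have hanti : AntitoneOn (fun s => Real.exp (-s) * Ψ s) (Set.Icc 0 t) := by
    have hder' : ∀ s, HasDerivAt (fun s => Real.exp (-s) * Ψ s)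
        (Real.exp (-s) * (D s - Ψ s)) s := fun s =>
      (((hasDerivAt_id s).neg.exp).mul (hD s)).congr_deriv (by simp; ring)
    refine antitoneOn_of_hasDerivWithinAt_nonpos (convex_Icc 0 t)
      (fun s _ => (hder' s).continuousAt.continuousWithinAt)
      (fun s _ => (hder' s).hasDerivWithinAt) fun s _ => ?_
    exact mul_nonpos_of_nonneg_of_nonpos (Real.exp_nonneg _) (by linarith [hD' s])
  have hΨ0 : Ψ 0 = 0 := by
    refine sum_eq_zero fun y _ => ?_
    rw [max_eq_right (by linarith [h0 y])]; simp
  have h1 := hanti (Set.left_mem_Icc.2 ht) (Set.right_mem_Icc.2 ht) ht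
  simp only [hΨ0, mul_zero] at h1
  have h2 : Ψ t ≤ 0 := by
    by_contra hc
    push Not at hc
    have := mul_pos (Real.exp_pos (-t)) hc
    linarith
  have h3 := single_le_sum (f := fun x => mu nbr ω x * max (-f t x) 0 ^ 2)
    (fun y _ => mul_nonneg (h.mu_pos y).le (sq_nonneg _)) (hFF' hx)
  have h4 : mu nbr ω x * max (-f t x) 0 ^ 2 ≤ 0 := h3.trans h2
  have h5 : max (-f t x) 0 ^ 2 ≤ 0 := by
    by_contra hc
    push Not at hc
    have := mul_pos (h.mu_pos x) hc
    linarith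
  have h6 : max (-f t x) 0 = 0 := by
    have := le_antisymm h5 (sq_nonneg _)
    exact pow_eq_zero_iff two_ne_zero |>.1 this
  have := le_max_left (-f t x) 0
  linarith

/-- Duality between nonnegative caloric functions and Dirichlet solutions. -/
lemma Env.duality (h : Env d Creg Criso G nbr ball ω) {F : Finset V} {a b t : ℝ} (hab : a ≤ b)
    (hbt : b ≤ t) {f g : ℝ → V → ℝ} (hf : Caloric nbr ω (Set.Icc a b) (F : Set V) f)
    (hf0 : ∀ s ∈ Set.Icc a b, ∀ x, 0 ≤ f s x) (hg : Caloric nbr ω Set.univ (F : Set V) g)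
    (hgout : ∀ s x, x ∉ F → g s x = 0) (hg0 : ∀ s, 0 ≤ s → ∀ x, 0 ≤ g s x) :
    ∑ x ∈ F, mu nbr ω x * (f a x * g (t - a) x) ≤ ∑ x ∈ F, mu nbr ω x * (f b x * g (t - b) x) := by
  obtain ⟨F', hFF', hF'⟩ := exists_nbr_superset nbr F
  have hder : ∀ s ∈ Set.Icc a b, HasDerivAt (fun s => ∑ x ∈ F, mu nbr ω x * (f s x * g (t - s) x))
      (∑ x ∈ F, mu nbr ω x * (lap nbr ω (f s) x * g (t - s) x -
        f s x * lap nbr ω (g (t - s)) x)) s := fun s hs => by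
    refine HasDerivAt.fun_sum fun x hx => HasDerivAt.const_mul _ ?_
    have hx' : x ∈ (F : Set V) := by exact_mod_cast hx
    have h1 := hf x hx' s hs
    have h2 : HasDerivAt (fun s => g (t - s) x) (-lap nbr ω (g (t - s)) x) s := by
      have := (hg x hx' (t - s) trivial).comp s ((hasDerivAt_id s).const_sub t)
      exact this.congr_deriv (by ring)
    exact (h1.mul h2).congr_deriv (by ring)
  refine monotoneOn_of_hasDerivWithinAt_nonneg (convex_Icc a b)
    (fun s hs => (hder s hs).continuousAt.continuousWithinAt)
    (fun s hs => (hder s (interior_subset hs)).hasDerivWithinAt) (fun s hs => ?_)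
    (Set.left_mem_Icc.2 hab) (Set.right_mem_Icc.2 hab) hab
  have hs' := interior_subset hs
  have hgs := hg0 (t - s) (by linarith [hs'.2])
  have hfs := hf0 s hs'
  set k := g (t - s) with hk
  have e : ∀ x ∈ F, mu nbr ω x * (lap nbr ω (f s) x * k x - f s x * lap nbr ω k x) =
      ∑ y ∈ F', ω x y * (f s y * k x) - ∑ y ∈ F', ω x y * (f s x * k y) := fun x hx => by
    have h1 := h.mu_mul_lap (hF' x hx) (f s)
    have h2 := h.mu_mul_lap (hF' x hx) k
    calc _ = (mu nbr ω x * lap nbr ω (f s) x) * k x - f s x * (mu nbr ω x * lap nbr ω k x) := by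
          ring
      _ = _ := by
          rw [h1, h2, sum_mul, mul_sum, ← sum_sub_distrib, ← sum_sub_distrib]
          exact sum_congr rfl fun y _ => by ring
  rw [sum_congr rfl e, sum_sub_distrib, sub_nonneg]
  have h1 : ∑ x ∈ F, ∑ y ∈ F', ω x y * (f s x * k y) = ∑ x ∈ F, ∑ y ∈ F, ω x y * (f s x * k y) :=
    sum_congr rfl fun x _ => (sum_subset hFF' fun y _ hy => by
      rw [hk, hgout _ y hy]; simp).symm
  have h2 : ∑ x ∈ F, ∑ y ∈ F, ω x y * (f s x * k y) = ∑ x ∈ F, ∑ y ∈ F, ω x y * (f s y * k x) := by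
    rw [sum_comm]
    exact sum_congr rfl fun x _ => sum_congr rfl fun y _ => by rw [h.symm y x]
  rw [h1, h2]
  exact sum_le_sum fun x _ => sum_le_sum_of_subset_of_nonneg hFF' fun y _ _ =>
    mul_nonneg (h.omega_nonneg x y) (mul_nonneg (hfs y) (hgs x))

end Dirichlet

section Exit

variable {d : ℕ} {Creg Criso : ℝ} {V : Type} {G : SimpleGraph V} {nbr : V → Finset V}
  {ball : V → ℝ → Finset V} {ω : V → V → ℝ}

lemma lap_const_sub (c : ℝ) (f : V → ℝ) (x : V) :
    lap nbr ω (fun y => c - f y) x = -lap nbr ω f x := by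
  simp only [lap, ← mul_neg, ← sum_neg_distrib]
  congr 1
  exact sum_congr rfl fun y _ => by ring

lemma Caloric.const_sub {I : Set ℝ} {B : Set V} {f : ℝ → V → ℝ} (c : ℝ)
    (hf : Caloric nbr ω I B f) : Caloric nbr ω I B (fun t x => c - f t x) := fun x hx t ht => by
  rw [lap_const_sub]
  exact (hf x hx t ht).const_sub c

/-- A caloric function that vanishes initially near the set `B` can be extended by zero to
negative times. -/
lemma Caloric.extend_zero {B B' : Set V} {e : ℝ → V → ℝ} (he : Caloric nbr ω Set.univ B e)
    (hBB' : B ⊆ B') (hnbr : ∀ x ∈ B, (nbr x : Set V) ⊆ B') (h0 : ∀ x ∈ B', e 0 x = 0) :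
    Caloric nbr ω Set.univ B (fun t x => if 0 ≤ t then e t x else 0) := by
  intro x hx t _
  have hpos : ∀ s, 0 ≤ s → (fun y => if 0 ≤ s then e s y else 0) = e s := fun s hs => by simp [hs]
  have hneg : ∀ s, s < 0 → (fun y => if 0 ≤ s then e s y else 0) = fun _ => 0 := fun s hs => by
    simp [not_le.2 hs]
  change HasDerivAt (fun s => if 0 ≤ s then e s x else 0)
    (lap nbr ω (fun y => if 0 ≤ t then e t y else 0) x) t
  rcases lt_trichotomy t 0 with ht | rfl | ht
  · rw [hneg t ht]
    have : lap nbr ω (fun _ => (0 : ℝ)) x = 0 := by simp [lap]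
    rw [this]
    refine (hasDerivAt_const t (0 : ℝ)).congr_of_eventuallyEq ?_
    filter_upwards [Iio_mem_nhds ht] with s hs
    simp [not_le.2 (Set.mem_Iio.1 hs)]
  · rw [hpos 0 le_rfl]
    have hl : lap nbr ω (e 0) x = 0 := by
      rw [lap, sum_eq_zero, mul_zero]
      intro y hy
      rw [h0 y (hnbr x hx (by exact_mod_cast hy)), h0 x (hBB' hx)]; simp
    have h1 := he x hx 0 trivial
    rw [hl] at h1 ⊢
    have hr : HasDerivWithinAt (fun t => if 0 ≤ t then e t x else 0) 0 (Set.Ici 0) 0 :=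
      h1.hasDerivWithinAt.congr (fun s hs => by simp [Set.mem_Ici.1 hs]) (by simp)
    have hl' : HasDerivWithinAt (fun t => if 0 ≤ t then e t x else 0) 0 (Set.Iic 0) 0 := by
      refine (hasDerivWithinAt_const (0 : ℝ) (Set.Iic 0) (0 : ℝ)).congr (fun s hs => ?_) ?_
      · rcases (Set.mem_Iic.1 hs).lt_or_eq with hs | rfl
        · simp [not_le.2 hs]
        · simp [h0 x (hBB' hx)]
      · simp [h0 x (hBB' hx)]
    have := hl'.union hr
    rwa [Set.Iic_union_Ici, hasDerivWithinAt_univ] at this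
  · rw [hpos t ht.le]
    refine (he x hx t trivial).congr_of_eventuallyEq ?_
    filter_upwards [Ioi_mem_nhds ht] with s hs
    simp [(Set.mem_Ioi.1 hs).le]

set_option maxHeartbeats 800000 in
/-- The walk started in the middle of a ball stays in the ball for a short diffusive time. -/
lemma exists_exit_bound (d : ℕ) (hd : 2 ≤ d) (Creg Criso : ℝ) (hCreg : 0 < Creg)
    (hCriso : 0 < Criso) (p q : ℝ) (hp : 1 < p) (hq : 1 < q) (hpq : 1 / p + 1 / q < 2 / (d : ℝ)) :
    ∃ C κ : ℝ, 1 ≤ C ∧ 1 ≤ κ ∧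
      ∀ {V : Type} {G : SimpleGraph V} {nbr : V → Finset V} {ball : V → ℝ → Finset V}
        {ω : V → V → ℝ} (_ : Env d Creg Criso G nbr ball ω) {A n : ℝ} {x₀ : V}
        (_ : Ctrl d p q Creg A n (ball x₀ n) nbr ω) (_ : 32 ≤ n) {θ : ℝ} (_ : 0 < θ)
        (_ : C * A ^ κ * θ ≤ 1) {g : ℝ → V → ℝ}
        (_ : Caloric nbr ω Set.univ (ball x₀ n : Set V) g)
        (_ : ∀ t x, x ∉ ball x₀ n → g t x = 0) (_ : g 0 = ind (ball x₀ (7 * n / 8))),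
        ∀ t ∈ Set.Icc 0 (θ * n ^ 2), ∀ x ∈ ball x₀ (3 * n / 4), 1 / 2 ≤ g t x := by
  obtain ⟨C₀, κ₀, hC₀, hκ₀, hmv⟩ := exists_meanValue d hd Creg Criso hCreg hCriso p q hp hq hpq
  refine ⟨max 1 (4 * C₀ * 16 ^ κ₀ * Creg ^ 2), κ₀ + 1, le_max_left _ _, by linarith, ?_⟩
  intro V G nbr ball ω h A n x₀ hc hn32 θ hθ hCθ g hg hgout hginit t ht x hx
  have hA := hc.one_le_A
  have hn0 : 0 < n := by linarith
  have hind : ∀ x, 0 ≤ g 0 x ∧ g 0 x ≤ 1 := fun x => by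
    rw [hginit]; unfold ind; split_ifs <;> norm_num
  have hg0 : ∀ s, 0 ≤ s → ∀ x, 0 ≤ g s x := fun s hs x =>
    h.nonneg_of_caloric hg (fun t x hx => (hgout t x hx).ge) (fun x => (hind x).1) hs x
  have hg1 : ∀ s, 0 ≤ s → ∀ x, g s x ≤ 1 := fun s hs x => by
    have := h.nonneg_of_caloric (hg.const_sub 1) (fun t x hx => by simp [hgout t x hx])
      (fun x => by linarith [(hind x).2]) hs x
    linarith
  have hsub2 : ball x₀ (3 * n / 4 + 1 / 16 * n) ⊆ ball x₀ n := h.ball_mono x₀ (by linarith)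
  have hext := Caloric.extend_zero (B := (ball x₀ (3 * n / 4 + 1 / 16 * n) : Set V))
    (B' := (ball x₀ (7 * n / 8) : Set V)) ((hg.const_sub 1).mono subset_rfl (by
      exact_mod_cast hsub2)) (by exact_mod_cast h.ball_mono x₀ (by linarith)) (fun x hx => by
      exact_mod_cast h.nbr_subset_ball (x := x₀)
        (r := 3 * n / 4 + 1 / 16 * n) (by linarith) (by exact_mod_cast hx)) (fun x hx => by
      have hx' : x ∈ ball x₀ (7 * n / 8) := by exact_mod_cast hx
      simp [hginit, ind, hx'])
  set e : ℝ → V → ℝ := fun t x => if 0 ≤ t then 1 - g t x else 0 with he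
  have hθn : 0 < θ * n ^ 2 := by positivity
  have hmv' := hmv h hc (θ := 1 / 16) (r := 3 * n / 4) (by norm_num) (by norm_num) (by linarith)
    (by linarith) (a := -n ^ 2) (b := θ * n ^ 2) (by nlinarith) (f := e)
    (hext.mono (Set.subset_univ _) subset_rfl).subCaloric t ⟨by nlinarith [ht.1], ht.2⟩ x hx
  have hcont := continuousOn_sum_max (F := ball x₀ (3 * n / 4 + 1 / 16 * n)) (I := Set.univ)
    (f := e) (mu nbr ω) 0 fun y hy => hext.continuousOn (by exact_mod_cast hy)
  simp only [sub_zero] at hcont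
  have hint : ∫ s in (-n ^ 2)..(θ * n ^ 2), ∑ x ∈ ball x₀ (3 * n / 4 + 1 / 16 * n),
      mu nbr ω x * max (e s x) 0 ^ 2 ≤ θ * n ^ 2 * (Creg ^ 2 * n ^ d * A) := by
    rw [continuousOn_univ] at hcont
    rw [← intervalIntegral.integral_add_adjacent_intervals (hcont.intervalIntegrable _ 0)
      (hcont.intervalIntegrable 0 _)]
    have h1 : ∫ s in (-n ^ 2)..0, ∑ x ∈ ball x₀ (3 * n / 4 + 1 / 16 * n),
        mu nbr ω x * max (e s x) 0 ^ 2 = 0 := by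
      refine intervalIntegral.integral_zero_ae ?_
      filter_upwards [Measure.ae_ne volume 0] with s hs0 hs
      rw [Set.uIoc_of_le (by nlinarith)] at hs
      refine sum_eq_zero fun y _ => ?_
      have : ¬ 0 ≤ s := not_le.2 (lt_of_le_of_ne hs.2 hs0)
      simp [he, this]
    have h2 : ∫ s in (0 : ℝ)..(θ * n ^ 2), ∑ x ∈ ball x₀ (3 * n / 4 + 1 / 16 * n),
        mu nbr ω x * max (e s x) 0 ^ 2 ≤ ∫ _ in (0 : ℝ)..(θ * n ^ 2), Creg ^ 2 * n ^ d * A := by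
      refine intervalIntegral.integral_mono_on hθn.le (hcont.intervalIntegrable _ _)
        intervalIntegrable_const fun s hs => ?_
      refine le_trans (sum_le_sum fun y _ => ?_)
        ((hc.mono h hp hq hsub2).sum_mu_le h hp)
      have h3 : max (e s y) 0 ≤ 1 := by
        simp only [he, hs.1, if_true]
        exact max_le (by linarith [hg0 s hs.1 y]) zero_le_one
      exact mul_le_of_le_one_right (h.mu_pos y).le (pow_le_one₀ (le_max_right _ _) h3)
    rw [h1, zero_add]
    refine h2.trans_eq ?_
    rw [intervalIntegral.integral_const, smul_eq_mul, sub_zero]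
  have hfin : max (e t x) 0 ^ 2 ≤ 1 / 4 := by
    refine hmv'.trans ?_
    have h1 : (A / (1 / 16)) ^ κ₀ = 16 ^ κ₀ * A ^ κ₀ := by
      rw [← Real.mul_rpow (by norm_num) (by linarith)]; congr 1; ring
    have h2 : max 1 (4 * C₀ * 16 ^ κ₀ * Creg ^ 2) * A ^ (κ₀ + 1) * θ ≥
      (4 * C₀ * 16 ^ κ₀ * Creg ^ 2) * A ^ (κ₀ + 1) * θ := by
      gcongr
      exact le_max_right _ _
    rw [Real.rpow_add_one (by linarith)] at h2 hCθ
    calc _ ≤ C₀ * (A / (1 / 16)) ^ κ₀ *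
          ((n ^ (d + 2))⁻¹ * (θ * n ^ 2 * (Creg ^ 2 * n ^ d * A))) := by
          gcongr
      _ = 1 / 4 * ((4 * C₀ * 16 ^ κ₀ * Creg ^ 2) * (A ^ κ₀ * A) * θ) := by
          rw [h1, pow_add]; field_simp
      _ ≤ _ := by linarith
  have h1 : max (e t x) 0 ≤ 1 / 2 := by
    refine le_of_sq_le_sq (hfin.trans_eq ?_) (by norm_num)
    norm_num
  have h2 := (le_max_left (e t x) 0).trans h1
  simp only [he, ht.1, if_true] at h2
  linarith

end Exit

section LogEnergy

variable {d : ℕ} {Creg Criso : ℝ} {V : Type} {G : SimpleGraph V} {nbr : V → Finset V}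
  {ball : V → ℝ → Finset V} {ω : V → V → ℝ}

lemma sq_le_sinh_sq (l : ℝ) : l ^ 2 ≤ Real.sinh l ^ 2 := by
  rw [sq_le_sq, Real.abs_sinh]
  exact Real.self_le_sinh_iff.2 (abs_nonneg l)

lemma sq_log_le {r : ℝ} (hr : 0 < r) : Real.log r ^ 2 ≤ r + r⁻¹ - 2 := by
  have h := sq_le_sinh_sq (Real.log r / 2)
  have h2 : Real.exp (Real.log r / 2) ^ 2 = r := by
    rw [← Real.exp_nat_mul]; push_cast
    rw [mul_div_cancel₀ _ two_ne_zero, Real.exp_log hr]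
  have h3 : Real.exp (-(Real.log r / 2)) ^ 2 = r⁻¹ := by
    rw [Real.exp_neg, inv_pow, h2]
  have h4 : Real.exp (Real.log r / 2) * Real.exp (-(Real.log r / 2)) = 1 := by
    rw [← Real.exp_add]; simp
  rw [Real.sinh_eq] at h
  nlinarith

lemma log_energy_of_le {a b φ ψ : ℝ} (ha : 0 < a) (hb : 0 < b) (hφ : 0 ≤ φ) (hφψ : φ ≤ ψ) :
    (a - b) * (φ ^ 2 / a - ψ ^ 2 / b) ≤
      3 * (φ - ψ) ^ 2 - 1 / 2 * φ ^ 2 * (Real.log a - Real.log b) ^ 2 := by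
  have hr : 0 < a / b := div_pos ha hb
  rw [← Real.log_div ha.ne' hb.ne']
  have h1 := sq_log_le hr
  have h2 : (a - b) * (φ ^ 2 / a - ψ ^ 2 / b) =
      φ ^ 2 * (2 - a / b - (a / b)⁻¹) + (ψ ^ 2 - φ ^ 2) * (1 - a / b) := by
    field_simp; ring
  rw [h2]
  set r := a / b
  have h3 := mul_le_mul_of_nonneg_left h1 (sq_nonneg φ)
  have h4 := mul_nonneg (sq_nonneg φ) (sq_nonneg (Real.log r))
  rcases le_total 1 r with h5 | h5
  · nlinarith [mul_nonneg (mul_nonneg (sub_nonneg.2 hφψ) (by linarith : 0 ≤ ψ + φ))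
      (sub_nonneg.2 h5), sq_nonneg (φ - ψ)]
  · have h6 : (1 - r) ^ 2 ≤ r + r⁻¹ - 2 := by
      have : r + r⁻¹ - 2 = (1 - r) ^ 2 * r⁻¹ := by field_simp; ring
      rw [this]
      exact le_mul_of_one_le_right (sq_nonneg _) ((one_le_inv₀ hr).2 h5)
    have h7 := mul_le_mul_of_nonneg_left h6 (sq_nonneg φ)
    nlinarith [sq_nonneg (2 * (ψ - φ) - φ * (1 - r)), mul_nonneg (sq_nonneg (ψ - φ)) hr.le]

lemma log_energy {a b φ ψ : ℝ} (ha : 0 < a) (hb : 0 < b) (hφ : 0 ≤ φ) (hψ : 0 ≤ ψ) :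
    (a - b) * (φ ^ 2 / a - ψ ^ 2 / b) ≤
      3 * (φ - ψ) ^ 2 - 1 / 2 * min φ ψ ^ 2 * (Real.log a - Real.log b) ^ 2 := by
  rcases le_total φ ψ with h | h
  · rw [min_eq_left h]; exact log_energy_of_le ha hb hφ h
  · rw [min_eq_right h]
    have := log_energy_of_le hb ha hψ h
    nlinarith

/-- Weighted Dirichlet energy of `log v` on `F`. -/
def logEn (ω : V → V → ℝ) (F : Finset V) (φ v : V → ℝ) : ℝ :=
  ∑ x ∈ F, ∑ y ∈ F, ω x y * (min (φ x) (φ y) ^ 2 * (Real.log (v x) - Real.log (v y)) ^ 2)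

lemma Env.exists_hasDerivAt_log (h : Env d Creg Criso G nbr ball ω) {A₀ F : Finset V}
    (hF : ∀ x ∈ A₀, nbr x ⊆ F) {φ : V → ℝ} {v : ℝ → V → ℝ} (hφ : ∀ x, x ∉ A₀ → φ x = 0)
    (hφ0 : ∀ x, 0 ≤ φ x) {c Lip s : ℝ} (hLip : ∀ x y, G.Adj x y → |φ x - φ y| ≤ Lip)
    (hv : ∀ x ∈ A₀, HasDerivAt (fun s => v s x) (lap nbr ω (v s) x) s) (hv0 : ∀ x, 0 < v s x) :
    ∃ D, HasDerivAt (fun t => ∑ x ∈ F, φ x ^ 2 * mu nbr ω x * (c - Real.log (v t x))) D s ∧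
      D ≤ -(1 / 4 * logEn ω F φ (v s)) + 3 / 2 * Lip ^ 2 * ∑ x ∈ F, mu nbr ω x := by
  refine ⟨∑ x ∈ F, φ x ^ 2 * mu nbr ω x * -(lap nbr ω (v s) x / v s x), ?_, ?_⟩
  · refine HasDerivAt.fun_sum fun x _ => ?_
    by_cases hx : x ∈ A₀
    · exact (((hv x hx).log (hv0 x).ne').const_sub c).const_mul _
    · simp only [hφ x hx]
      simpa using hasDerivAt_const s (0 : ℝ)
  · have h1 := h.sum_mul_lap hF (fun x => φ x ^ 2 / v s x) (v s)
      (fun x hx => by simp [hφ x hx])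
    have h2 : ∑ x ∈ F, φ x ^ 2 * mu nbr ω x * -(lap nbr ω (v s) x / v s x) =
        -∑ x ∈ F, φ x ^ 2 / v s x * (mu nbr ω x * lap nbr ω (v s) x) := by
      rw [← sum_neg_distrib]
      exact sum_congr rfl fun x _ => by ring
    have h3 : ∑ x ∈ F, ∑ y ∈ F, ω x y * ((v s x - v s y) * (φ x ^ 2 / v s x - φ y ^ 2 / v s y)) ≤
        ∑ x ∈ F, ∑ y ∈ F, (3 * Lip ^ 2 * (ω x y * 1) - 1 / 2 * (ω x y *
          (min (φ x) (φ y) ^ 2 * (Real.log (v s x) - Real.log (v s y)) ^ 2))) := by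
      refine sum_le_sum fun x _ => sum_le_sum fun y _ => ?_
      by_cases hxy : G.Adj x y
      · have h4 := log_energy (hv0 x) (hv0 y) (hφ0 x) (hφ0 y)
        have h5 : (φ x - φ y) ^ 2 ≤ Lip ^ 2 := by
          rw [← sq_abs]
          exact pow_le_pow_left₀ (abs_nonneg _) (hLip x y hxy) 2
        have h6 := h.omega_nonneg x y
        have h7 := mul_le_mul_of_nonneg_left (h4.trans (sub_le_sub_right
          (mul_le_mul_of_nonneg_left h5 zero_le_three) _)) h6
        linarith
      · simp [h.zero x y hxy]
    simp only [sum_sub_distrib, ← mul_sum] at h3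
    have h8 := h.sum_omega_mul_le F (g := fun _ => 1) (fun _ => zero_le_one)
    simp only [mul_one] at h8 h3
    have h9 := mul_le_mul_of_nonneg_left h8 (by positivity : 0 ≤ 3 / 2 * Lip ^ 2)
    rw [h2]
    simp only [logEn]
    linarith

lemma continuousOn_logEn {F : Finset V} {φ : V → ℝ} {v : ℝ → V → ℝ} {I : Set ℝ}
    (hv : ∀ x ∈ F, ContinuousOn (fun t => v t x) I) (hv0 : ∀ t ∈ I, ∀ x, 0 < v t x) :
    ContinuousOn (fun t => logEn ω F φ (v t)) I := by
  unfold logEn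
  refine continuousOn_finsetSum _ fun x hx => continuousOn_finsetSum _ fun y hy => ?_
  have h1 := (hv x hx).log fun t ht => (hv0 t ht x).ne'
  have h2 := (hv y hy).log fun t ht => (hv0 t ht y).ne'
  fun_prop

/-- Energy estimate for the logarithm of a positive caloric function. -/
lemma Env.log_energy_estimate (h : Env d Creg Criso G nbr ball ω) {A₀ F : Finset V}
    (hAF : A₀ ⊆ F) (hF : ∀ x ∈ A₀, nbr x ⊆ F) {φ : V → ℝ} {v : ℝ → V → ℝ}
    (hφ : ∀ x, x ∉ A₀ → φ x = 0) (hφ0 : ∀ x, 0 ≤ φ x) {c Lip : ℝ}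
    (hLip : ∀ x y, G.Adj x y → |φ x - φ y| ≤ Lip) {a b : ℝ} (hab : a ≤ b)
    (hv : Caloric nbr ω (Set.Icc a b) (F : Set V) v) (hv0 : ∀ t ∈ Set.Icc a b, ∀ x, 0 < v t x) :
    ∑ x ∈ F, φ x ^ 2 * mu nbr ω x * (c - Real.log (v b x)) +
        1 / 4 * ∫ s in a..b, logEn ω F φ (v s) ≤
      ∑ x ∈ F, φ x ^ 2 * mu nbr ω x * (c - Real.log (v a x)) +
        (b - a) * (3 / 2 * Lip ^ 2 * ∑ x ∈ F, mu nbr ω x) := by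
  have hcont : ∀ x ∈ F, ContinuousOn (fun t => v t x) (Set.Icc a b) := fun x hx =>
    hv.continuousOn (by exact_mod_cast hx)
  have hEc : ContinuousOn (fun t => logEn ω F φ (v t)) (Set.Icc a b) :=
    continuousOn_logEn hcont hv0
  have hderiv : ∀ s ∈ Set.Icc a b, ∃ D,
      HasDerivAt (fun t => ∑ x ∈ F, φ x ^ 2 * mu nbr ω x * (c - Real.log (v t x))) D s ∧
      D ≤ -(1 / 4 * logEn ω F φ (v s)) + 3 / 2 * Lip ^ 2 * ∑ x ∈ F, mu nbr ω x :=
    fun s hs => h.exists_hasDerivAt_log hF hφ hφ0 hLip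
      (fun x hx => hv x (by exact_mod_cast hAF hx) s hs) (hv0 s hs)
  choose! D hD hD' using hderiv
  have hW : ContinuousOn (fun t => ∑ x ∈ F, φ x ^ 2 * mu nbr ω x * (c - Real.log (v t x)))
      (Set.Icc a b) := fun s hs => (hD s hs).continuousAt.continuousWithinAt
  have hE' : ContinuousOn (fun s => -(1 / 4 * logEn ω F φ (v s)) +
      3 / 2 * Lip ^ 2 * ∑ x ∈ F, mu nbr ω x) (Set.Icc a b) := by fun_prop
  have h1 := intervalIntegral.sub_le_integral_of_hasDeriv_right_of_le hab hW
    (fun z hz => (hD z (Set.Ioo_subset_Icc_self hz)).hasDerivWithinAt)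
    hE'.integrableOn_Icc (fun z hz => hD' z (Set.Ioo_subset_Icc_self hz))
  have iE : IntervalIntegrable (fun s => logEn ω F φ (v s)) volume a b :=
    (hEc.mono (by rw [Set.uIcc_of_le hab])).intervalIntegrable
  rw [intervalIntegral.integral_add (f := fun s => -(1 / 4 * logEn ω F φ (v s)))
    (iE.const_mul _).neg intervalIntegrable_const,
    intervalIntegral.integral_neg, intervalIntegral.integral_const_mul,
    intervalIntegral.integral_const, smul_eq_mul] at h1
  linarith

/-- The negative logarithm of a positive caloric function is subcaloric. -/
lemma Env.subCaloric_neg_log (h : Env d Creg Criso G nbr ball ω) {I : Set ℝ} {B : Set V}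
    {v : ℝ → V → ℝ} (c : ℝ) (hv : Caloric nbr ω I B v) (hv0 : ∀ t ∈ I, ∀ x, 0 < v t x) :
    SubCaloric nbr ω I B (fun t x => c - Real.log (v t x)) := by
  intro x hx t ht
  refine ⟨_, ((hv x hx t ht).log (hv0 t ht x).ne').const_sub c, ?_⟩
  rw [lap_const_sub, neg_le_neg_iff, lap, lap, mul_div_assoc, sum_div]
  refine mul_le_mul_of_nonneg_left (sum_le_sum fun y _ => ?_) (inv_nonneg.2 (h.mu_pos x).le)
  rw [mul_div_assoc]
  refine mul_le_mul_of_nonneg_left ?_ (h.omega_nonneg x y)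
  have hx0 := hv0 t ht x
  have hy0 := hv0 t ht y
  rw [← Real.log_div hy0.ne' hx0.ne', sub_div, div_self hx0.ne']
  exact Real.log_le_sub_one_of_pos (div_pos hy0 hx0)

end LogEnergy

section Spread

variable {d : ℕ} {Creg Criso : ℝ} {V : Type} {G : SimpleGraph V} {nbr : V → Finset V}
  {ball : V → ℝ → Finset V} {ω : V → V → ℝ} {p q A n : ℝ} {F S : Finset V}

open Classical in
lemma mass_below {m φ w : V → ℝ} (hm : ∀ x, 0 ≤ m x) (hφ0 : ∀ x, 0 ≤ φ x) (hφ1 : ∀ x, φ x ≤ 1)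
    {L b η β M : ℝ} (hb : 0 ≤ b) (hL : 0 < L) (hw0 : ∀ x ∈ F, 0 ≤ w x)
    (hwL : ∀ x ∈ F, w x ≤ L) (hM : ∑ x ∈ F, m x ≤ M)
    (hW : ∑ x ∈ F, φ x ^ 2 * m x * w x ≤ L * ∑ x ∈ F, φ x ^ 2 * m x - L * β) :
    β - (η ^ 2 + b) * M ≤ ∑ x ∈ F.filter (fun x => η ≤ φ x ∧ w x < (1 - b) * L), m x := by
  have h1 : ∀ x ∈ F, φ x ^ 2 * m x * (L - w x) ≤
      L * ((η ^ 2 + b) * m x) + L * (if η ≤ φ x ∧ w x < (1 - b) * L then m x else 0) := by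
    intro x hx
    have hm' := hm x
    have hwx := hw0 x hx
    have hwx' := hwL x hx
    have hφ2 : φ x ^ 2 ≤ 1 := pow_le_one₀ (hφ0 x) (hφ1 x)
    have hφ2' := sq_nonneg (φ x)
    have e1 : φ x ^ 2 * m x ≤ m x := by nlinarith
    have e0 : 0 ≤ φ x ^ 2 * m x := mul_nonneg hφ2' hm'
    have e2 : 0 ≤ L * m x := mul_nonneg hL.le hm'
    have e3 : φ x ^ 2 * m x * (L - w x) ≤ L * (φ x ^ 2 * m x) := by nlinarith
    by_cases hη' : η ≤ φ x
    · by_cases hw' : w x < (1 - b) * L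
      · rw [if_pos ⟨hη', hw'⟩]
        have : 0 ≤ L * ((η ^ 2 + b) * m x) := by positivity
        nlinarith [mul_le_mul_of_nonneg_left e1 hL.le]
      · rw [if_neg (fun h => hw' h.2), mul_zero, add_zero]
        push Not at hw'
        have h2 : L - w x ≤ b * L := by linarith
        have h3 : φ x ^ 2 * m x * (L - w x) ≤ m x * (b * L) :=
          mul_le_mul e1 h2 (by linarith) hm'
        nlinarith [mul_nonneg e2 (sq_nonneg η)]
    · rw [if_neg (fun h => hη' h.1), mul_zero, add_zero]
      push Not at hη'
      have h2 : φ x ^ 2 ≤ η ^ 2 := pow_le_pow_left₀ (hφ0 x) hη'.le 2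
      nlinarith [mul_le_mul_of_nonneg_right h2 e2, mul_nonneg hb e2]
  have h2 := sum_le_sum h1
  rw [sum_add_distrib, ← mul_sum, ← mul_sum, ← mul_sum, ← sum_filter] at h2
  have h3 : ∑ x ∈ F, φ x ^ 2 * m x * (L - w x) =
      L * ∑ x ∈ F, φ x ^ 2 * m x - ∑ x ∈ F, φ x ^ 2 * m x * w x := by
    rw [mul_sum, ← sum_sub_distrib]
    exact sum_congr rfl fun x _ => by ring
  have h4 : L * β ≤ L * ((η ^ 2 + b) * M +
      ∑ x ∈ F.filter (fun x => η ≤ φ x ∧ w x < (1 - b) * L), m x) := by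
    have := mul_le_mul_of_nonneg_left (mul_le_mul_of_nonneg_left hM
      (by positivity : 0 ≤ η ^ 2 + b)) hL.le
    rw [h3] at h2
    linarith
  linarith [le_of_mul_le_mul_left h4 hL]

lemma Ctrl.le_card (h : Env d Creg Criso G nbr ball ω) (hc : Ctrl d p q Creg A n F nbr ω)
    (hp : 1 < p) (hSF : S ⊆ F) {β : ℝ} (hβ : 0 ≤ β) (hS : β * n ^ d ≤ ∑ x ∈ S, mu nbr ω x) :
    (β / (Creg * A)) ^ (1 / (1 - 1 / p)) * n ^ d ≤ S.card := by
  have hA := hc.one_le_A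
  have hC := h.Creg_pos
  have hn : 0 < n ^ d := pow_pos (by linarith [hc.one_le_n]) d
  have he : 0 < 1 - 1 / p := by
    rw [sub_pos, div_lt_one (by linarith)]; exact hp
  have h1 := hS.trans (sum_le_of_rpow_sum_le (fun x => (h.mu_pos x).le) hp hc.mu_le hSF)
  have h2 : n ^ d = (n ^ d) ^ (1 / p) * (n ^ d) ^ (1 - 1 / p) := by
    rw [← Real.rpow_add hn]; simp
  have h3 : β / (Creg * A) * (n ^ d) ^ (1 - 1 / p) ≤ (S.card : ℝ) ^ (1 - 1 / p) := by
    have h5 := (congrArg (β * ·) h2).ge.trans h1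
    have h4 : 0 < (n ^ d) ^ (1 / p) := Real.rpow_pos_of_pos hn _
    rw [div_mul_eq_mul_div, div_le_iff₀ (by positivity)]
    refine le_of_mul_le_mul_left ?_ h4
    convert h5 using 1 <;> ring
  have h5 := Real.rpow_le_rpow (by positivity) h3 (by positivity : 0 ≤ 1 / (1 - 1 / p))
  rwa [Real.mul_rpow (by positivity) (by positivity), ← Real.rpow_mul hn.le,
    ← Real.rpow_mul (Nat.cast_nonneg _), mul_one_div_cancel he.ne', Real.rpow_one,
    Real.rpow_one] at h5

lemma Env.poincare_sq (h : Env d Creg Criso G nbr ball ω) {x : V} {r : ℝ}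
    (hc : Ctrl d p q Creg A n (ball x r) nbr ω) (hq : 1 < q)
    (hr : 8 * Creg ^ 2 / Criso ≤ r) (hr1 : 2 * Creg ≤ r) (hrn : r ≤ n) {θ : ℝ} (hθ : 0 < θ)
    (hθ1 : θ ≤ 1) {N : Finset V} (hN : N ⊆ ball x r) (hNc : θ * (ball x r).card ≤ (N.card : ℝ))
    (g : V → ℝ) (hg : ∀ x, 0 ≤ g x) (hgN : ∀ y ∈ N, g y = 0) :
    (∑ y ∈ ball x r, g y) ^ 2 ≤
      (4 / (Criso * θ)) ^ 2 * (Creg ^ 2 * A) * n ^ (d + 2) * en ω (ball x r) g := by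
  have h1 := h.poincare_one hr hr1 hθ hθ1 hN hNc g hg hgN
  have h2 := h.tv_sq_le (ball x r) (fun _ => 1) g
  simp only [one_mul, one_pow, mul_one] at h2
  set T := ∑ x' ∈ ball x r, ∑ y ∈ ball x r, adj1 G x' y * |g x' - g y|
  have hC := h.Creg_pos
  have hC' := h.Criso_pos
  have hr0 : 0 < r := by linarith
  have h3 := hc.sum_nu_le h hq
  have hE := h.en_nonneg (ball x r) g
  calc (∑ y ∈ ball x r, g y) ^ 2 ≤ (4 * r / (Criso * θ) * T) ^ 2 :=
        pow_le_pow_left₀ (sum_nonneg fun y _ => hg y) h1 2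
    _ = (4 / (Criso * θ)) ^ 2 * r ^ 2 * T ^ 2 := by ring
    _ ≤ (4 / (Criso * θ)) ^ 2 * n ^ 2 * (en ω (ball x r) g * (Creg ^ 2 * n ^ d * A)) := by
        have h4 : T ^ 2 ≤ en ω (ball x r) g * (Creg ^ 2 * n ^ d * A) :=
          h2.trans (mul_le_mul_of_nonneg_left h3 hE)
        gcongr
    _ = _ := by ring

lemma rpow_le_add {e σ y : ℝ} (he : 0 < e) (he1 : e < 1) (hσ : 0 < σ) (hy : 0 ≤ y) :
    y ^ e ≤ σ ^ e + σ ^ (e - 1) * y := by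
  rcases le_total y σ with h | h
  · have := Real.rpow_le_rpow hy h he.le
    have : 0 ≤ σ ^ (e - 1) * y := by positivity
    linarith
  · have hy0 : 0 < y := hσ.trans_le h
    have h1 : y ^ e = y ^ (e - 1) * y := by
      rw [Real.rpow_sub_one hy0.ne']; field_simp
    have h2 : y ^ (e - 1) ≤ σ ^ (e - 1) :=
      Real.rpow_le_rpow_of_nonpos hσ h (by linarith)
    have : 0 ≤ σ ^ e := by positivity
    nlinarith

lemma Ctrl.sum_mu_sq_le (h : Env d Creg Criso G nbr ball ω) (hc : Ctrl d p q Creg A n F nbr ω)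
    (hp : 1 < p) {f : V → ℝ} {L σ : ℝ} (hL : 0 < L) (hσ : 0 < σ) (hf0 : ∀ x ∈ F, 0 ≤ f x)
    (hfL : ∀ x ∈ F, f x ≤ L) :
    ∑ x ∈ F, mu nbr ω x * f x ^ 2 ≤ L ^ 2 * Creg * A * (n ^ d * σ ^ (1 - 1 / p) +
      σ ^ (1 - 1 / p - 1) * L⁻¹ * ∑ x ∈ F, f x) := by
  have hA := hc.one_le_A
  have hC := h.Creg_pos
  have hn : 0 < n ^ d := pow_pos (by linarith [hc.one_le_n]) d
  have hp0 : 0 < p := by linarith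
  have he : 0 < 1 - 1 / p := by
    rw [sub_pos, div_lt_one (by linarith)]; exact hp
  have he1 : 1 - 1 / p < 1 := by
    have : 0 < 1 / p := by positivity
    linarith
  set e := 1 - 1 / p with hedef
  have hg0 : ∀ x ∈ F, 0 ≤ f x / L := fun x hx => div_nonneg (hf0 x hx) hL.le
  have h1 := holder_weight F (m := mu nbr ω) (g := fun x => f x / L)
    (fun x _ => (h.mu_pos x).le) hg0 hp
  have h2 : ∑ x ∈ F, mu nbr ω x * f x ^ 2 ≤ L ^ 2 * ∑ x ∈ F, mu nbr ω x * (f x / L) ^ e := by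
    rw [mul_sum]
    refine sum_le_sum fun x hx => ?_
    have h3 : (f x / L) ^ 2 ≤ (f x / L) ^ e := by
      rw [← Real.rpow_natCast]
      refine Real.rpow_le_rpow_of_exponent_ge' (hg0 x hx) ((div_le_one hL).2 (hfL x hx)) he.le ?_
      push_cast; linarith
    have h4 : f x ^ 2 = L ^ 2 * (f x / L) ^ 2 := by field_simp
    rw [h4]
    have := mul_le_mul_of_nonneg_left h3 (mul_nonneg (sq_nonneg L) (h.mu_pos x).le)
    linarith
  have hy0 : 0 ≤ (n ^ d)⁻¹ * ∑ x ∈ F, f x / L :=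
    mul_nonneg (inv_nonneg.2 hn.le) (sum_nonneg hg0)
  have h5 := rpow_le_add he he1 hσ hy0
  have h6 : (∑ x ∈ F, f x / L) ^ e = (n ^ d) ^ e * ((n ^ d)⁻¹ * ∑ x ∈ F, f x / L) ^ e := by
    rw [← Real.mul_rpow hn.le hy0, mul_inv_cancel_left₀ hn.ne']
  have h7 : n ^ d = (n ^ d) ^ (1 / p) * (n ^ d) ^ e := by
    rw [← Real.rpow_add hn]; simp [hedef]
  calc ∑ x ∈ F, mu nbr ω x * f x ^ 2
      ≤ L ^ 2 * ((Creg * (n ^ d) ^ (1 / p) * A) * ((n ^ d) ^ e *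
          (σ ^ e + σ ^ (e - 1) * ((n ^ d)⁻¹ * ∑ x ∈ F, f x / L)))) := by
        refine h2.trans (mul_le_mul_of_nonneg_left (h1.trans ?_) (sq_nonneg L))
        refine mul_le_mul hc.mu_le ?_ (by have := sum_nonneg hg0; positivity) (by positivity)
        rw [h6]
        exact mul_le_mul_of_nonneg_left h5 (by positivity)
    _ = L ^ 2 * Creg * A * (((n ^ d) ^ (1 / p) * (n ^ d) ^ e) *
          (σ ^ e + σ ^ (e - 1) * ((n ^ d)⁻¹ * ∑ x ∈ F, f x / L))) := by ring
    _ = _ := by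
        rw [← h7, ← sum_div]
        field_simp

end Spread

section LogSpread

variable {d : ℕ} {Creg Criso : ℝ} {V : Type} {G : SimpleGraph V} {nbr : V → Finset V}
  {ball : V → ℝ → Finset V} {ω : V → V → ℝ} {p q A n : ℝ}

lemma Env.le_cut (h : Env d Creg Criso G nbr ball ω) {x₀ : V} {r w η : ℝ} (hw : 0 < w)
    (hη1 : η ≤ 1) {x : V} (hx : x ∈ ball x₀ (r - η * w)) :
    η ≤ cut G x₀ r w x := by
  rw [h.mem_ball] at hx
  exact le_max_of_le_right (le_min hη1 (by rw [le_div_iff₀ hw]; linarith))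

lemma Env.mem_ball_of_le_cut (h : Env d Creg Criso G nbr ball ω) {x₀ : V} {r w η : ℝ} (hw : 0 < w)
    (hη : 0 < η) {x : V} (hx : η ≤ cut G x₀ r w x) : x ∈ ball x₀ (r - η * w) := by
  rw [cut, le_max_iff, or_iff_right (not_le.2 hη), le_min_iff, le_div_iff₀ hw] at hx
  rw [h.mem_ball]
  linarith [hx.2]

set_option maxHeartbeats 400000 in
/-- If a positive caloric function is initially not too small on a set of positive density, then
so it remains, and its logarithm has bounded energy. -/
lemma Env.log_mass (h : Env d Creg Criso G nbr ball ω) {x₀ : V}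
    (hc : Ctrl d p q Creg A n (ball x₀ n) nbr ω) (hp : 1 < p) (hq : 1 < q) (hn : 32 ≤ n)
    {a b c L : ℝ} (hab : a ≤ b) (hba : b - a ≤ n ^ 2) {v : ℝ → V → ℝ}
    (hv : Caloric nbr ω (Set.Icc a b) (ball x₀ (15 * n / 16) : Set V) v)
    (hv0 : ∀ t ∈ Set.Icc a b, ∀ x, 0 < v t x)
    (hw0 : ∀ t ∈ Set.Icc a b, ∀ x ∈ ball x₀ (15 * n / 16), 0 ≤ c - Real.log (v t x))
    (hwL : ∀ t ∈ Set.Icc a b, ∀ x ∈ ball x₀ (15 * n / 16), c - Real.log (v t x) ≤ L)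
    {S : Finset V} (hS : S ⊆ ball x₀ (7 * n / 8)) (hSμ : 1 / A * n ^ d ≤ ∑ x ∈ S, mu nbr ω x)
    (hSL : ∀ x ∈ S, c - Real.log (v a x) ≤ L / 2) (hL1 : 1 ≤ L)
    (hL : 6144 * Creg ^ 2 * A ^ 2 ≤ L) :
    (∀ t ∈ Set.Icc a b, ∑ x ∈ ball x₀ (15 * n / 16),
        cut G x₀ (15 * n / 16 - 1) (n / 32) x ^ 2 * mu nbr ω x * (c - Real.log (v t x)) ≤
      L * ∑ x ∈ ball x₀ (15 * n / 16), cut G x₀ (15 * n / 16 - 1) (n / 32) x ^ 2 * mu nbr ω x -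
        L * (1 / (4 * A) * n ^ d)) ∧
    ∫ s in a..b, logEn ω (ball x₀ (15 * n / 16)) (cut G x₀ (15 * n / 16 - 1) (n / 32)) (v s) ≤
      6148 * Creg ^ 2 * A * L * n ^ d := by
  have hA := hc.one_le_A
  have hA0 : 0 < A := by linarith
  have hn0 : 0 < n := by linarith
  have hnd : 0 < n ^ d := by positivity
  have hC := h.Creg_pos
  have hw : 0 < n / 32 := by positivity
  set F := ball x₀ (15 * n / 16) with hF
  set φ := cut G x₀ (15 * n / 16 - 1) (n / 32) with hφ
  have hFB : F ⊆ ball x₀ n := h.ball_mono x₀ (by linarith)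
  have hM : ∑ x ∈ F, mu nbr ω x ≤ Creg ^ 2 * n ^ d * A := (hc.mono h hp hq hFB).sum_mu_le h hp
  have hSF : S ⊆ F := hS.trans (h.ball_mono x₀ (by linarith))
  have hφ0 : ∀ x, 0 ≤ φ x := cut_nonneg _ _ _
  have hφ1 : ∀ x, φ x ≤ 1 := cut_le_one _ _ _
  have hφμ : ∀ x, 0 ≤ φ x ^ 2 * mu nbr ω x := fun x => mul_nonneg (sq_nonneg _) (h.mu_pos x).le
  have hE : ∀ t ∈ Set.Icc a b, ∑ x ∈ F, φ x ^ 2 * mu nbr ω x * (c - Real.log (v t x)) +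
        1 / 4 * ∫ s in a..t, logEn ω F φ (v s) ≤
      ∑ x ∈ F, φ x ^ 2 * mu nbr ω x * (c - Real.log (v a x)) + 1536 * Creg ^ 2 * A * n ^ d := by
    intro t ht
    have h1 := h.log_energy_estimate (A₀ := ball x₀ (15 * n / 16 - 1)) (F := F) (c := c)
      (h.ball_mono x₀ (by linarith)) (fun x hx => h.nbr_subset_ball (by linarith) hx) (φ := φ)
      (fun x hx => h.cut_eq_zero hw hx) hφ0 (fun x y hxy => h.abs_cut_sub_le x₀ _ hw hxy) ht.1
      (hv.mono (Set.Icc_subset_Icc_right ht.2) subset_rfl)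
      (fun s hs => hv0 s ⟨hs.1, hs.2.trans ht.2⟩)
    refine h1.trans (add_le_add_right ?_ _)
    calc (t - a) * (3 / 2 * (1 / (n / 32)) ^ 2 * ∑ x ∈ F, mu nbr ω x)
        ≤ n ^ 2 * (3 / 2 * (1 / (n / 32)) ^ 2 * (Creg ^ 2 * n ^ d * A)) := by
          have : t - a ≤ n ^ 2 := by linarith [ht.2]
          have : 0 ≤ ∑ x ∈ F, mu nbr ω x := sum_nonneg fun x _ => (h.mu_pos x).le
          gcongr
      _ = _ := by field_simp; ring
  have hEpos : ∀ s, 0 ≤ logEn ω F φ (v s) := fun s => sum_nonneg fun x _ => sum_nonneg fun y _ =>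
    mul_nonneg (h.omega_nonneg x y) (by positivity)
  have ha : a ∈ Set.Icc a b := ⟨le_rfl, hab⟩
  have hWa : ∑ x ∈ F, φ x ^ 2 * mu nbr ω x * (c - Real.log (v a x)) ≤
      L * ∑ x ∈ F, φ x ^ 2 * mu nbr ω x - L / 2 * (1 / A * n ^ d) := by
    have h1 : ∑ x ∈ F, φ x ^ 2 * mu nbr ω x * (c - Real.log (v a x)) ≤
        ∑ x ∈ F, (L * (φ x ^ 2 * mu nbr ω x) - L / 2 * (ind S x * mu nbr ω x)) := by
      refine sum_le_sum fun x hx => ?_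
      by_cases hxS : x ∈ S
      · have h2 : φ x = 1 := h.cut_eq_one hw (by linarith) (hS hxS)
        have h3 := mul_le_mul_of_nonneg_left (hSL x hxS) (h.mu_pos x).le
        simp only [h2, ind, hxS, if_true]
        linarith
      · have h3 := mul_le_mul_of_nonneg_left (hwL a ha x hx) (hφμ x)
        simp only [ind, hxS, if_false]
        linarith
    rw [sum_sub_distrib, ← mul_sum, ← mul_sum] at h1
    have h2 : ∑ x ∈ F, ind S x * mu nbr ω x = ∑ x ∈ S, mu nbr ω x := by
      rw [← sum_subset hSF (fun x _ hx => by simp [ind, hx])]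
      exact sum_congr rfl fun x hx => by simp [ind, hx]
    rw [h2] at h1
    have := mul_le_mul_of_nonneg_left hSμ (by linarith : 0 ≤ L / 2)
    linarith
  refine ⟨fun t ht => ?_, ?_⟩
  · have h1 := hE t ht
    have h2 : 0 ≤ ∫ s in a..t, logEn ω F φ (v s) :=
      intervalIntegral.integral_nonneg ht.1 fun s _ => hEpos s
    have h3 : 1536 * Creg ^ 2 * A * n ^ d ≤ L * (1 / (4 * A) * n ^ d) := by
      have h4 : 1536 * Creg ^ 2 * A ≤ L * (1 / (4 * A)) := by
        rw [mul_one_div, le_div_iff₀ (by positivity)]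
        linarith
      nlinarith
    have h5 : L / 2 * (1 / A * n ^ d) = 2 * (L * (1 / (4 * A) * n ^ d)) := by
      field_simp; ring
    linarith
  · have h1 := hE b ⟨hab, le_rfl⟩
    have h2 : 0 ≤ ∑ x ∈ F, φ x ^ 2 * mu nbr ω x * (c - Real.log (v b x)) :=
      sum_nonneg fun x hx => mul_nonneg (hφμ x) (hw0 b ⟨hab, le_rfl⟩ x hx)
    have h3 : ∑ x ∈ F, φ x ^ 2 * mu nbr ω x ≤ Creg ^ 2 * n ^ d * A := by
      refine le_trans (sum_le_sum fun x _ => ?_) hM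
      exact mul_le_of_le_one_left (h.mu_pos x).le (pow_le_one₀ (hφ0 x) (hφ1 x))
    have h4 : 0 ≤ L / 2 * (1 / A * n ^ d) := by positivity
    have h5 := mul_le_mul_of_nonneg_left h3 (by linarith : 0 ≤ L)
    have h6 := mul_le_mul_of_nonneg_left hL1 (by positivity : 0 ≤ Creg ^ 2 * A * n ^ d)
    linarith

lemma sq_max_sub_le (a b c : ℝ) : (max (a - c) 0 - max (b - c) 0) ^ 2 ≤ (a - b) ^ 2 := by
  rw [sq_le_sq]
  refine (abs_max_sub_max_le_abs _ _ _).trans (le_of_eq ?_)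
  congr 1; ring

set_option maxHeartbeats 400000 in
/-- Poincaré inequality for the logarithm of a positive function that is not too small on a set of
positive density. -/
lemma Env.log_poincare (h : Env d Creg Criso G nbr ball ω) {x₀ : V}
    (hc : Ctrl d p q Creg A n (ball x₀ n) nbr ω) (hp : 1 < p) (hq : 1 < q) (hn : 32 ≤ n)
    (hr : 8 * Creg ^ 2 / Criso ≤ 7 * n / 8) (hr1 : 2 * Creg ≤ 7 * n / 8) {c L : ℝ} (hL : 0 < L)
    {v : V → ℝ} (hw0 : ∀ x ∈ ball x₀ (15 * n / 16), 0 ≤ c - Real.log (v x))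
    (hwL : ∀ x ∈ ball x₀ (15 * n / 16), c - Real.log (v x) ≤ L)
    (hW : ∑ x ∈ ball x₀ (15 * n / 16),
        cut G x₀ (15 * n / 16 - 1) (n / 32) x ^ 2 * mu nbr ω x * (c - Real.log (v x)) ≤
      L * ∑ x ∈ ball x₀ (15 * n / 16), cut G x₀ (15 * n / 16 - 1) (n / 32) x ^ 2 * mu nbr ω x -
        L * (1 / (4 * A) * n ^ d)) :
    (∑ x ∈ ball x₀ (7 * n / 8),
        max (c - Real.log (v x) - (1 - 1 / (16 * Creg ^ 2 * A ^ 2)) * L) 0) ^ 2 ≤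
      (4 * Creg / Criso * (8 * Creg * A ^ 2) ^ (1 / (1 - 1 / p))) ^ 2 * (16 * Creg ^ 4 * A ^ 3) *
        n ^ (d + 2) *
        logEn ω (ball x₀ (15 * n / 16)) (cut G x₀ (15 * n / 16 - 1) (n / 32)) v := by
  classical
  have hA := hc.one_le_A
  have hA0 : 0 < A := by linarith
  have hn0 : 0 < n := by linarith
  have hnd : 0 < n ^ d := by positivity
  have hC := h.Creg_pos
  have hC1 := h.one_le_Creg
  have hC' := h.Criso_pos
  have hw : 0 < n / 32 := by positivity
  have he : 0 < 1 - 1 / p := by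
    rw [sub_pos, div_lt_one (by linarith)]; exact hp
  set F := ball x₀ (15 * n / 16) with hF
  set φ := cut G x₀ (15 * n / 16 - 1) (n / 32) with hφ
  set b := 1 / (16 * Creg ^ 2 * A ^ 2) with hb
  set η := 1 / (4 * Creg * A) with hη
  have hηb : η ^ 2 = b := by rw [hη, hb]; field_simp; norm_num
  have hη0 : 0 < η := by positivity
  have hη1 : η ≤ 1 := by
    rw [hη, div_le_one (by positivity)]
    nlinarith
  have hb0 : 0 < b := by positivity
  have hFB : F ⊆ ball x₀ n := h.ball_mono x₀ (by linarith)
  have hcF := hc.mono h hp hq hFB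
  have h1 := mass_below (F := F) (m := mu nbr ω) (η := η) (fun x => (h.mu_pos x).le)
    (cut_nonneg _ _ _) (cut_le_one _ _ _) hb0.le hL hw0 hwL (hcF.sum_mu_le h hp) hW
  set N := F.filter (fun x => η ≤ φ x ∧ c - Real.log (v x) < (1 - b) * L) with hN
  set r := 15 * n / 16 - 1 - η * (n / 32) with hrdef
  have hr78 : 7 * n / 8 ≤ r := by
    have := mul_le_mul_of_nonneg_right hη1 hw.le
    rw [hrdef]; linarith
  have hrn : r ≤ 15 * n / 16 := by
    have := mul_nonneg hη0.le hw.le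
    rw [hrdef]; linarith
  have hrF : ball x₀ r ⊆ F := h.ball_mono x₀ hrn
  have hNr : N ⊆ ball x₀ r := fun x hx =>
    h.mem_ball_of_le_cut hw hη0 (mem_filter.1 hx).2.1
  have h2 : 1 / (8 * A) * n ^ d ≤ ∑ x ∈ N, mu nbr ω x := by
    refine le_trans (le_of_eq ?_) h1
    rw [hηb, hb]; field_simp; ring
  have h3 := hcF.le_card h hp (filter_subset _ _) (by positivity) h2
  set X := (1 / (8 * A) / (Creg * A)) ^ (1 / (1 - 1 / p)) with hX
  have hX' : X = ((8 * Creg * A ^ 2) ^ (1 / (1 - 1 / p)))⁻¹ := by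
    rw [hX, ← Real.inv_rpow (by positivity)]
    congr 1; field_simp
  have hX0 : 0 < X := by positivity
  have hX1 : X ≤ 1 := by
    refine Real.rpow_le_one (by positivity) ?_ (by positivity)
    rw [div_div, div_le_one (by positivity)]
    nlinarith [mul_pos hC hA0]
  have hcr := hcF.mono h hp hq hrF
  have h4 : X / Creg * (ball x₀ r).card ≤ (N.card : ℝ) := by
    refine le_trans ?_ h3
    rw [div_mul_eq_mul_div, div_le_iff₀ hC, mul_assoc, mul_comm (n ^ d)]
    exact mul_le_mul_of_nonneg_left hcr.card_le hX0.le
  set f : V → ℝ := fun x => max (c - Real.log (v x) - (1 - b) * L) 0 with hf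
  have h5 := h.poincare_sq hcr hq (hr.trans hr78) (hr1.trans hr78) (by linarith)
    (by positivity : 0 < X / Creg) ((div_le_one hC).2 (hX1.trans hC1)) hNr h4 f
    (fun x => le_max_right _ _)
    (fun y hy => max_eq_right (by linarith [(mem_filter.1 hy).2.2]))
  have h6 : η ^ 2 * en ω (ball x₀ r) f ≤ logEn ω F φ v := by
    have hnn : ∀ x y, 0 ≤ ω x y * (min (φ x) (φ y) ^ 2 *
        (Real.log (v x) - Real.log (v y)) ^ 2) := fun x y =>
      mul_nonneg (h.omega_nonneg x y) (by positivity)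
    calc η ^ 2 * en ω (ball x₀ r) f
        ≤ ∑ x ∈ ball x₀ r, ∑ y ∈ ball x₀ r, ω x y * (min (φ x) (φ y) ^ 2 *
          (Real.log (v x) - Real.log (v y)) ^ 2) := by
          rw [en, mul_sum]
          refine sum_le_sum fun x hx => ?_
          rw [mul_sum]
          refine sum_le_sum fun y hy => ?_
          rw [mul_left_comm]
          refine mul_le_mul_of_nonneg_left ?_ (h.omega_nonneg x y)
          have e1 : η ≤ min (φ x) (φ y) := le_min (h.le_cut hw hη1 hx) (h.le_cut hw hη1 hy)
          have e2 : (f x - f y) ^ 2 ≤ (Real.log (v x) - Real.log (v y)) ^ 2 := by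
            refine (sq_max_sub_le _ _ _).trans (le_of_eq ?_)
            ring
          exact mul_le_mul (pow_le_pow_left₀ hη0.le e1 2) e2 (sq_nonneg _) (sq_nonneg _)
      _ ≤ ∑ x ∈ ball x₀ r, ∑ y ∈ F, ω x y * (min (φ x) (φ y) ^ 2 *
          (Real.log (v x) - Real.log (v y)) ^ 2) :=
          sum_le_sum fun x _ => sum_le_sum_of_subset_of_nonneg hrF fun y _ _ => hnn x y
      _ ≤ _ := sum_le_sum_of_subset_of_nonneg hrF fun x _ _ => sum_nonneg fun y _ => hnn x y
  have h7 : ∑ x ∈ ball x₀ (7 * n / 8), f x ≤ ∑ x ∈ ball x₀ r, f x :=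
    sum_le_sum_of_subset_of_nonneg (h.ball_mono x₀ hr78) fun x _ _ => le_max_right _ _
  have h8 : 4 / (Criso * (X / Creg)) =
      4 * Creg / Criso * (8 * Creg * A ^ 2) ^ (1 / (1 - 1 / p)) := by
    rw [hX']; field_simp
  have h9 : en ω (ball x₀ r) f ≤ 16 * Creg ^ 2 * A ^ 2 * logEn ω F φ v := by
    rw [hηb, hb, one_div, inv_mul_le_iff₀ (by positivity)] at h6
    exact h6
  calc _ ≤ (∑ x ∈ ball x₀ r, f x) ^ 2 :=
        pow_le_pow_left₀ (sum_nonneg fun x _ => le_max_right _ _) h7 2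
    _ ≤ _ := h5
    _ ≤ (4 * Creg / Criso * (8 * Creg * A ^ 2) ^ (1 / (1 - 1 / p))) ^ 2 * (Creg ^ 2 * A) *
        n ^ (d + 2) * (16 * Creg ^ 2 * A ^ 2 * logEn ω F φ v) := by
        rw [h8]
        exact mul_le_mul_of_nonneg_left h9 (by positivity)
    _ = _ := by ring

end LogSpread

section PolyBd

/-- `f` is nonnegative and of at most polynomial growth on `[1, ∞)`. -/
def PolyBd (f : ℝ → ℝ) : Prop :=
  ∃ C κ : ℝ, 1 ≤ C ∧ 1 ≤ κ ∧ ∀ A, 1 ≤ A → 0 ≤ f A ∧ f A ≤ C * A ^ κ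

lemma PolyBd.const {c : ℝ} (hc : 0 ≤ c) : PolyBd fun _ => c := by
  refine ⟨max 1 c, 1, le_max_left _ _, le_rfl, fun A hA => ⟨hc, ?_⟩⟩
  rw [Real.rpow_one]
  nlinarith [le_max_left 1 c, le_max_right 1 c]

lemma PolyBd.id : PolyBd fun A => A :=
  ⟨1, 1, le_rfl, le_rfl, fun A hA => ⟨by linarith, by simp⟩⟩

lemma PolyBd.add {f g : ℝ → ℝ} (hf : PolyBd f) (hg : PolyBd g) : PolyBd fun A => f A + g A := by
  obtain ⟨C, κ, hC, hκ, hf⟩ := hf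
  obtain ⟨C', κ', hC', hκ', hg⟩ := hg
  refine ⟨C + C', max κ κ', by linarith, le_max_of_le_left hκ, fun A hA => ?_⟩
  have h1 := Real.rpow_le_rpow_of_exponent_le hA (le_max_left κ κ')
  have h2 := Real.rpow_le_rpow_of_exponent_le hA (le_max_right κ κ')
  refine ⟨add_nonneg (hf A hA).1 (hg A hA).1, ?_⟩
  have := (hf A hA).2
  have := (hg A hA).2
  nlinarith

lemma PolyBd.mul {f g : ℝ → ℝ} (hf : PolyBd f) (hg : PolyBd g) : PolyBd fun A => f A * g A := by
  obtain ⟨C, κ, hC, hκ, hf⟩ := hf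
  obtain ⟨C', κ', hC', hκ', hg⟩ := hg
  refine ⟨C * C', κ + κ', by nlinarith, by linarith, fun A hA => ?_⟩
  have hA0 : 0 < A := by linarith
  refine ⟨mul_nonneg (hf A hA).1 (hg A hA).1, ?_⟩
  calc f A * g A ≤ (C * A ^ κ) * (C' * A ^ κ') :=
        mul_le_mul (hf A hA).2 (hg A hA).2 (hg A hA).1 (by positivity)
    _ = _ := by rw [Real.rpow_add hA0]; ring

lemma PolyBd.rpow {f : ℝ → ℝ} (hf : PolyBd f) {s : ℝ} (hs : 0 ≤ s) :
    PolyBd fun A => f A ^ s := by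
  obtain ⟨C, κ, hC, hκ, hf⟩ := hf
  refine ⟨C ^ s, max 1 (κ * s), Real.one_le_rpow hC hs, le_max_left _ _, fun A hA => ?_⟩
  have hA0 : 0 < A := by linarith
  refine ⟨Real.rpow_nonneg (hf A hA).1 _, ?_⟩
  calc f A ^ s ≤ (C * A ^ κ) ^ s := Real.rpow_le_rpow (hf A hA).1 (hf A hA).2 hs
    _ = C ^ s * A ^ (κ * s) := by
        rw [Real.mul_rpow (by linarith) (by positivity), ← Real.rpow_mul hA0.le]
    _ ≤ _ := mul_le_mul_of_nonneg_left
        (Real.rpow_le_rpow_of_exponent_le hA (le_max_right _ _)) (by positivity)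

lemma PolyBd.pow {f : ℝ → ℝ} (hf : PolyBd f) (k : ℕ) : PolyBd fun A => f A ^ k := by
  simpa only [Real.rpow_natCast] using hf.rpow (Nat.cast_nonneg k)

end PolyBd

section SpreadMain

variable {d : ℕ} {Creg Criso : ℝ} {V : Type} {G : SimpleGraph V} {nbr : V → Finset V}
  {ball : V → ℝ → Finset V} {ω : V → V → ℝ} {p q A n : ℝ}

lemma integral_le_of_sq_le {a b T k e α : ℝ} (hab : a ≤ b) (hT : b - a ≤ T) {Q E : ℝ → ℝ}
    (hQ : ContinuousOn Q (Set.Icc a b)) (hE : ContinuousOn E (Set.Icc a b)) (hk : 0 ≤ k)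
    (hQE : ∀ s ∈ Set.Icc a b, Q s ^ 2 ≤ k * E s) (he : ∫ s in a..b, E s ≤ e) (hα : 0 < α) :
    ∫ s in a..b, Q s ≤ 1 / 2 * (α * T + k * e / α) := by
  have iQ : IntervalIntegrable Q volume a b :=
    (hQ.mono (by rw [Set.uIcc_of_le hab])).intervalIntegrable
  have iE : IntervalIntegrable E volume a b :=
    (hE.mono (by rw [Set.uIcc_of_le hab])).intervalIntegrable
  have h1 := intervalIntegral.integral_mono_on (g := fun s => α / 2 + k / (2 * α) * E s) hab iQ
    (intervalIntegrable_const.add (iE.const_mul _)) (fun s hs => by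
      have h2 := hQE s hs
      have h3 : Q s ≤ α / 2 + Q s ^ 2 / (2 * α) := by
        have : α / 2 + Q s ^ 2 / (2 * α) - Q s = (Q s - α) ^ 2 / (2 * α) := by field_simp; ring
        have : 0 ≤ (Q s - α) ^ 2 / (2 * α) := by positivity
        linarith
      have h4 : Q s ^ 2 / (2 * α) ≤ k * E s / (2 * α) := by gcongr
      calc Q s ≤ α / 2 + k * E s / (2 * α) := by linarith
        _ = _ := by ring)
  rw [intervalIntegral.integral_add intervalIntegrable_const (iE.const_mul _),
    intervalIntegral.integral_const, intervalIntegral.integral_const_mul, smul_eq_mul] at h1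
  have h5 : (b - a) * (α / 2) ≤ T * (α / 2) := by gcongr
  have h6 : k / (2 * α) * ∫ s in a..b, E s ≤ k / (2 * α) * e := by gcongr
  calc _ ≤ T * (α / 2) + k / (2 * α) * e := by linarith
    _ = _ := by field_simp

set_option maxHeartbeats 800000 in
/-- A positive caloric function that is initially not too small on a set of positive density is
eventually not too small everywhere. -/
lemma exists_spread (d : ℕ) (hd : 2 ≤ d) (Creg Criso : ℝ) (hCreg : 0 < Creg)
    (hCriso : 0 < Criso) (p q : ℝ) (hp : 1 < p) (hq : 1 < q) (hpq : 1 / p + 1 / q < 2 / (d : ℝ)) :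
    ∃ Λ : ℝ → ℝ, PolyBd Λ ∧
      ∀ {V : Type} {G : SimpleGraph V} {nbr : V → Finset V} {ball : V → ℝ → Finset V}
        {ω : V → V → ℝ} (_ : Env d Creg Criso G nbr ball ω) {A n : ℝ} {x₀ : V}
        (_ : Ctrl d p q Creg A n (ball x₀ n) nbr ω) (_ : 32 ≤ n)
        (_ : 8 * Creg ^ 2 / Criso ≤ 7 * n / 8) (_ : 2 * Creg ≤ 7 * n / 8)
        {a b c L : ℝ} (_ : a + n ^ 2 / 16 ≤ b) (_ : b - a ≤ n ^ 2) {v : ℝ → V → ℝ}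
        (_ : Caloric nbr ω (Set.Icc a b) (ball x₀ (15 * n / 16) : Set V) v)
        (_ : ∀ t ∈ Set.Icc a b, ∀ x, 0 < v t x)
        (_ : ∀ t ∈ Set.Icc a b, ∀ x ∈ ball x₀ (15 * n / 16), 0 ≤ c - Real.log (v t x))
        (_ : ∀ t ∈ Set.Icc a b, ∀ x ∈ ball x₀ (15 * n / 16), c - Real.log (v t x) ≤ L)
        {S : Finset V} (_ : S ⊆ ball x₀ (7 * n / 8))
        (_ : 1 / A * n ^ d ≤ ∑ x ∈ S, mu nbr ω x)
        (_ : ∀ x ∈ S, c - Real.log (v a x) ≤ L / 2) (_ : Λ A ≤ L),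
        ∀ t ∈ Set.Icc (a + n ^ 2 / 16) b, ∀ x ∈ ball x₀ (3 * n / 4),
          c - Real.log (v t x) ≤ L - 1 := by
  obtain ⟨C₀, κ₀, hC₀, hκ₀, hmv⟩ := exists_meanValue d hd Creg Criso hCreg hCriso p q hp hq hpq
  have he : 0 < 1 - 1 / p := by
    rw [sub_pos, div_lt_one (by linarith)]; exact hp
  set e := 1 - 1 / p with hedef
  set K₂ : ℝ → ℝ := fun A =>
    (4 * Creg / Criso * (8 * Creg * A ^ 2) ^ (1 / e)) ^ 2 * (16 * Creg ^ 4 * A ^ 3) with hK₂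
  set K₃ : ℝ → ℝ := fun A => 1 / 2 * (1 + K₂ A * (6148 * Creg ^ 2 * A)) with hK₃
  set K₄ : ℝ → ℝ := fun A => C₀ * (16 * A) ^ κ₀ * (Creg * A * (1 + K₃ A)) with hK₄
  set Λ : ℝ → ℝ := fun A => 1 + 6144 * Creg ^ 2 * A ^ 2 +
    (4 * K₄ A * (16 * Creg ^ 2 * A ^ 2) ^ 2) ^ (2 / e) with hΛ
  have bK₂ : PolyBd K₂ :=
    (((PolyBd.const (by positivity)).mul (((PolyBd.const (by positivity)).mul
      (PolyBd.id.pow 2)).rpow (by positivity))).pow 2).mul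
      ((PolyBd.const (by positivity)).mul (PolyBd.id.pow 3))
  have bK₃ : PolyBd K₃ := (PolyBd.const (by positivity)).mul ((PolyBd.const zero_le_one).add
    (bK₂.mul ((PolyBd.const (by positivity)).mul PolyBd.id)))
  have bK₄ : PolyBd K₄ := ((PolyBd.const (by positivity)).mul
    (((PolyBd.const (by positivity)).mul PolyBd.id).rpow (by positivity))).mul
    (((PolyBd.const hCreg.le).mul PolyBd.id).mul ((PolyBd.const zero_le_one).add bK₃))
  have bΛ : PolyBd Λ := ((PolyBd.const zero_le_one).add ((PolyBd.const (by positivity)).mul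
    (PolyBd.id.pow 2))).add ((((PolyBd.const (by positivity)).mul bK₄).mul
      (((PolyBd.const (by positivity)).mul (PolyBd.id.pow 2)).pow 2)).rpow (by positivity))
  refine ⟨Λ, bΛ, ?_⟩
  intro V G nbr ball ω h A n x₀ hc hn hr hr1 a b c L hab hba v hv hv0 hw0 hwL S hS hSμ hSL hΛL
  have hA := hc.one_le_A
  have hA0 : 0 < A := by linarith
  have hn0 : 0 < n := by linarith
  have hC1 := h.one_le_Creg
  have hab' : a ≤ b := by nlinarith
  have hK₂0 : 0 ≤ K₂ A := by positivity
  have hK₃0 : 0 ≤ K₃ A := by positivity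
  have hK₄0 : 0 ≤ K₄ A := by positivity
  have hΛ1 : 0 ≤ (4 * K₄ A * (16 * Creg ^ 2 * A ^ 2) ^ 2) ^ (2 / e) := by positivity
  have hΛ2 : 0 ≤ 6144 * Creg ^ 2 * A ^ 2 := by positivity
  have hΛL' : 1 + 6144 * Creg ^ 2 * A ^ 2 +
    (4 * K₄ A * (16 * Creg ^ 2 * A ^ 2) ^ 2) ^ (2 / e) ≤ L := hΛL
  have hL1 : 1 ≤ L := by linarith
  have hL0 : 0 < L := by linarith
  obtain ⟨hmass, hener⟩ := h.log_mass hc hp hq hn hab' hba hv hv0 hw0 hwL hS hSμ hSL hL1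
    (by linarith)
  set F := ball x₀ (15 * n / 16) with hF
  set B := ball x₀ (7 * n / 8) with hB
  have hBF : B ⊆ F := h.ball_mono x₀ (by linarith)
  have hFn : F ⊆ ball x₀ n := h.ball_mono x₀ (by linarith)
  set β := 1 / (16 * Creg ^ 2 * A ^ 2) with hβ
  have hβ0 : 0 < β := by positivity
  have hβ1 : β ≤ 1 := by
    rw [hβ, div_le_one (by positivity)]
    nlinarith [mul_le_mul (one_le_pow₀ hC1 (n := 2)) (one_le_pow₀ hA (n := 2)) zero_le_one
      (by positivity)]
  set f : ℝ → V → ℝ := fun s x => c - Real.log (v s x) - (1 - β) * L with hf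
  have hcontv : ∀ x ∈ F, ContinuousOn (fun t => v t x) (Set.Icc a b) := fun x hx =>
    hv.continuousOn (by exact_mod_cast hx)
  have hcont : ∀ x ∈ F, ContinuousOn (fun t => f t x) (Set.Icc a b) := fun x hx =>
    ((continuousOn_const.sub ((hcontv x hx).log fun t ht => (hv0 t ht x).ne')).sub
      continuousOn_const)
  have hQc : ContinuousOn (fun s => ∑ x ∈ B, max (f s x) 0) (Set.Icc a b) :=
    continuousOn_finsetSum _ fun x hx => (hcont x (hBF hx)).sup continuousOn_const
  have hint := integral_le_of_sq_le (α := n ^ d * √L) (k := K₂ A * n ^ (d + 2)) hab' hba hQc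
    (continuousOn_logEn hcontv hv0) (by positivity)
    (fun s hs => h.log_poincare hc hp hq hn hr hr1 hL0 (hw0 s hs) (hwL s hs) (hmass s hs)) hener
    (by positivity)
  have hsqrt : √L * √L = L := Real.mul_self_sqrt hL0.le
  have hs0 : 0 < √L := Real.sqrt_pos.2 hL0
  have hint2 : ∫ s in a..b, ∑ x ∈ B, max (f s x) 0 ≤ n ^ (d + 2) * √L * K₃ A := by
    refine hint.trans (le_of_eq ?_)
    have e1 : K₂ A * n ^ (d + 2) * (6148 * Creg ^ 2 * A * L * n ^ d) / (n ^ d * √L) =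
        K₂ A * n ^ (d + 2) * (6148 * Creg ^ 2 * A) * √L := by
      rw [div_eq_iff (by positivity)]
      calc _ = K₂ A * n ^ (d + 2) * (6148 * Creg ^ 2 * A * (√L * √L) * n ^ d) := by rw [hsqrt]
        _ = _ := by ring
    rw [e1]
    simp only [hK₃]
    ring
  have hcB := hc.mono h hp hq (hBF.trans hFn)
  set σ := (√L)⁻¹ with hσ
  have hσ0 : 0 < σ := by positivity
  have hpt : ∀ s ∈ Set.Icc a b, ∑ x ∈ ball x₀ (3 * n / 4 + 1 / 16 * n),
      mu nbr ω x * max (f s x) 0 ^ 2 ≤ L ^ 2 * Creg * A * (n ^ d * σ ^ e +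
        σ ^ (e - 1) * L⁻¹ * ∑ x ∈ B, max (f s x) 0) := by
    intro s hs
    refine le_trans (sum_le_sum_of_subset_of_nonneg (h.ball_mono x₀ (by linarith))
      fun x _ _ => mul_nonneg (h.mu_pos x).le (sq_nonneg _)) (hcB.sum_mu_sq_le h hp hL0 hσ0
      (fun x _ => le_max_right _ _) fun x hx => max_le ?_ hL0.le)
    have := hwL s hs x (hBF hx)
    have := mul_nonneg (sub_nonneg.2 hβ1) hL0.le
    simp only [hf]; linarith
  have hsub : ball x₀ (3 * n / 4 + 1 / 16 * n) ⊆ F := h.ball_mono x₀ (by linarith)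
  have hPc : ContinuousOn (fun s => ∑ x ∈ ball x₀ (3 * n / 4 + 1 / 16 * n),
      mu nbr ω x * max (f s x) 0 ^ 2) (Set.Icc a b) := by
    simpa using continuousOn_sum_max (mu nbr ω) 0 fun x hx => hcont x (hsub hx)
  have ii : ∀ {H : ℝ → ℝ}, ContinuousOn H (Set.Icc a b) → IntervalIntegrable H volume a b :=
    fun hH => (hH.mono (by rw [Set.uIcc_of_le hab'])).intervalIntegrable
  have hint3 : ∫ s in a..b, ∑ x ∈ ball x₀ (3 * n / 4 + 1 / 16 * n),
      mu nbr ω x * max (f s x) 0 ^ 2 ≤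
      L ^ 2 * (Creg * A * (1 + K₃ A)) * σ ^ e * n ^ (d + 2) := by
    have h1 := intervalIntegral.integral_mono_on hab' (ii hPc)
      ((intervalIntegrable_const.add ((ii hQc).const_mul _)).const_mul _) hpt
    rw [intervalIntegral.integral_const_mul, intervalIntegral.integral_add
      intervalIntegrable_const ((ii hQc).const_mul _), intervalIntegral.integral_const,
      intervalIntegral.integral_const_mul, smul_eq_mul] at h1
    refine h1.trans ?_
    have h2 : (b - a) * (n ^ d * σ ^ e) ≤ n ^ 2 * (n ^ d * σ ^ e) :=
      mul_le_mul_of_nonneg_right hba (by positivity)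
    have h3 := mul_le_mul_of_nonneg_left hint2 (by positivity : 0 ≤ σ ^ (e - 1) * L⁻¹)
    have h4 : σ ^ (e - 1) * L⁻¹ * (n ^ (d + 2) * √L * K₃ A) = n ^ (d + 2) * σ ^ e * K₃ A := by
      have e1 : L⁻¹ * √L = σ := by
        rw [hσ, inv_mul_eq_iff_eq_mul₀ hL0.ne']
        field_simp
        rw [sq, hsqrt]
      have e2 : σ ^ (e - 1) * σ = σ ^ e := by
        rw [Real.rpow_sub_one hσ0.ne']; field_simp
      calc _ = σ ^ (e - 1) * (L⁻¹ * √L) * (n ^ (d + 2) * K₃ A) := by ring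
        _ = _ := by rw [e1, e2]; ring
    rw [h4] at h3
    calc _ ≤ L ^ 2 * Creg * A * (n ^ 2 * (n ^ d * σ ^ e) + n ^ (d + 2) * σ ^ e * K₃ A) :=
          mul_le_mul_of_nonneg_left (add_le_add h2 h3) (by positivity)
      _ = _ := by ring
  intro t ht x hx
  have hsc : SubCaloric nbr ω (Set.Icc a b) (ball x₀ (3 * n / 4 + 1 / 16 * n) : Set V) f := by
    have h1 := h.subCaloric_neg_log (c - (1 - β) * L) (hv.mono subset_rfl
      (Finset.coe_subset.2 hsub)) hv0
    have h2 : f = fun t x => c - (1 - β) * L - Real.log (v t x) := by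
      funext t x; simp only [hf]; ring
    rw [h2]; exact h1
  have hm := hmv h hc (θ := 1 / 16) (r := 3 * n / 4) (by norm_num) (by norm_num) (by linarith)
    (by linarith) (by linarith) hsc t ⟨by linarith [ht.1], ht.2⟩ x hx
  have hA16 : A / (1 / 16) = 16 * A := by ring
  rw [hA16] at hm
  have hm2 : max (f t x) 0 ^ 2 ≤ K₄ A * σ ^ e * L ^ 2 := by
    have h1 := mul_le_mul_of_nonneg_left (mul_le_mul_of_nonneg_left hint3
      (by positivity : 0 ≤ (n ^ (d + 2))⁻¹)) (by positivity : 0 ≤ C₀ * (16 * A) ^ κ₀)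
    refine hm.trans (h1.trans (le_of_eq ?_))
    simp only [hK₄]
    field_simp
  have hσe : K₄ A * σ ^ e ≤ (β / 2) ^ 2 := by
    have h1 : (4 * K₄ A * (16 * Creg ^ 2 * A ^ 2) ^ 2) ^ (2 / e) ≤ L := by linarith
    have h2 := Real.rpow_le_rpow hΛ1 h1 (by positivity : 0 ≤ e / 2)
    rw [← Real.rpow_mul (by positivity), (by field_simp : 2 / e * (e / 2) = 1),
      Real.rpow_one] at h2
    have h3 : σ ^ e = (L ^ (e / 2))⁻¹ := by
      rw [hσ, Real.inv_rpow (Real.sqrt_nonneg _), Real.sqrt_eq_rpow, ← Real.rpow_mul hL0.le]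
      congr 2; ring
    have h4 : 0 < L ^ (e / 2) := by positivity
    rw [h3, mul_inv_le_iff₀ h4]
    have h5 : (β / 2) ^ 2 * (4 * K₄ A * (16 * Creg ^ 2 * A ^ 2) ^ 2) = K₄ A := by
      rw [hβ]; field_simp; ring
    calc K₄ A = _ := h5.symm
      _ ≤ _ := mul_le_mul_of_nonneg_left h2 (by positivity)
  have hm3 : max (f t x) 0 ≤ β / 2 * L := by
    refine le_of_sq_le_sq ?_ (by positivity)
    calc _ ≤ _ := hm2
      _ ≤ (β / 2) ^ 2 * L ^ 2 := mul_le_mul_of_nonneg_right hσe (sq_nonneg L)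
      _ = _ := by ring
  have hβL : 2 ≤ β * L := by
    rw [hβ, one_div, inv_mul_eq_div, le_div_iff₀ (by positivity)]
    nlinarith [sq_nonneg (Creg * A)]
  have hm4 := (le_max_left (f t x) 0).trans hm3
  simp only [hf] at hm4
  linarith

end SpreadMain

section Kernel

variable {d : ℕ} {Creg Criso : ℝ} {V : Type} {G : SimpleGraph V} {nbr : V → Finset V}
  {ball : V → ℝ → Finset V} {ω : V → V → ℝ} {p q A n : ℝ} {F : Finset V}

lemma PolyBd.comp {f g : ℝ → ℝ} (hf : PolyBd f) (hg : PolyBd g) (hg1 : ∀ A, 1 ≤ A → 1 ≤ g A) :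
    PolyBd fun A => f (g A) := by
  obtain ⟨C, κ, hC, hκ, hf⟩ := hf
  obtain ⟨C', κ', hC', hκ', h⟩ := (PolyBd.const (by linarith : 0 ≤ C)).mul
    (hg.rpow (by linarith : 0 ≤ κ))
  exact ⟨C', κ', hC', hκ', fun A hA => ⟨(hf _ (hg1 A hA)).1,
    (hf _ (hg1 A hA)).2.trans (h A hA).2⟩⟩

lemma Caloric.add_const {I : Set ℝ} {B : Set V} {f : ℝ → V → ℝ} (c : ℝ)
    (hf : Caloric nbr ω I B f) : Caloric nbr ω I B (fun t x => f t x + c) := fun x hx t ht => by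
  have h1 : lap nbr ω (fun y => f t y + c) x = lap nbr ω (f t) x := by
    simp only [lap, add_sub_add_right_eq_sub]
  rw [h1]
  exact (hf x hx t ht).add_const c

lemma Ctrl.mono_const (h : Env d Creg Criso G nbr ball ω) (hc : Ctrl d p q Creg A n F nbr ω)
    {A' : ℝ} (hA : A ≤ A') : Ctrl d p q Creg A' n F nbr ω := by
  have hC := h.Creg_pos
  have hn := hc.one_le_n
  refine ⟨hc.one_le_A.trans hA, hn, hc.mu_le.trans ?_, hc.nu_le.trans ?_, hc.card_le⟩ <;> gcongr

lemma sum_ind_singleton_mul {x' : V} (hx : x' ∈ F) (g : V → ℝ) :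
    ∑ x ∈ F, ind {x'} x * g x = g x' := by
  classical
  rw [sum_eq_single_of_mem x' hx fun x _ hxx => by simp [ind, hxx]]
  simp [ind]

/-- The heat kernel with Dirichlet boundary conditions has mass at most one. -/
lemma Env.sum_mu_mul_le_one (h : Env d Creg Criso G nbr ball ω) {v : ℝ → V → ℝ} {x' : V}
    (hv : Caloric nbr ω Set.univ (F : Set V) v) (hout : ∀ t x, x ∉ F → v t x = 0)
    (hv0 : ∀ t, 0 ≤ t → ∀ x, 0 ≤ v t x) (hx' : x' ∈ F)
    (hinit : v 0 = fun x => ind {x'} x * (mu nbr ω x)⁻¹) {t : ℝ} (ht : 0 ≤ t) :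
    ∑ x ∈ F, mu nbr ω x * v t x ≤ 1 := by
  have h1 : Caloric nbr ω (Set.Icc 0 t) (F : Set V) (fun _ _ => 1) := fun x _ s _ => by
    simpa [lap] using hasDerivAt_const s (1 : ℝ)
  have h2 := h.duality ht le_rfl h1 (fun _ _ _ => zero_le_one) hv hout hv0
  simp only [one_mul, sub_zero, sub_self, hinit] at h2
  refine h2.trans (le_of_eq ?_)
  rw [← sum_ind_singleton_mul hx' (fun _ => (1 : ℝ))]
  refine sum_congr rfl fun x _ => ?_
  have := (h.mu_pos x).ne'
  field_simp

open Classical in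
lemma exists_dense_superlevel {m v : V → ℝ} (hm : ∀ x, 0 ≤ m x) {M k K : ℝ}
    (hvK : ∀ x ∈ F, v x ≤ K) (hk : 0 ≤ k) (hM : ∑ x ∈ F, m x ≤ M) (hv : 1 / 2 ≤ ∑ x ∈ F, m x * v x)
    (hkM : k * M ≤ 1 / 4) :
    1 / 4 ≤ K * ∑ x ∈ F.filter (fun x => k ≤ v x), m x := by
  have h1 : ∑ x ∈ F, m x * v x ≤ k * ∑ x ∈ F, m x +
      K * ∑ x ∈ F.filter (fun x => k ≤ v x), m x := by
    rw [mul_sum, mul_sum, sum_filter, ← sum_add_distrib]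
    refine sum_le_sum fun x hx => ?_
    split_ifs with hkv
    · nlinarith [mul_le_mul_of_nonneg_left (hvK x hx) (hm x), mul_nonneg hk (hm x)]
    · nlinarith [mul_le_mul_of_nonneg_left (not_le.1 hkv).le (hm x)]
  linarith [mul_le_mul_of_nonneg_left hM hk]

set_option maxHeartbeats 800000 in
/-- Lower bound for the heat kernel with Dirichlet boundary conditions. -/
lemma exists_kernel_lower (d : ℕ) (hd : 2 ≤ d) (Creg Criso : ℝ) (hCreg : 0 < Creg)
    (hCriso : 0 < Criso) (p q : ℝ) (hp : 1 < p) (hq : 1 < q) (hpq : 1 / p + 1 / q < 2 / (d : ℝ)) :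
    ∃ Λ : ℝ → ℝ, PolyBd Λ ∧
      ∀ {V : Type} {G : SimpleGraph V} {nbr : V → Finset V} {ball : V → ℝ → Finset V}
        {ω : V → V → ℝ} (_ : Env d Creg Criso G nbr ball ω) {A n : ℝ} {x₀ : V}
        (_ : Ctrl d p q Creg A n (ball x₀ n) nbr ω) (_ : 32 ≤ n)
        (_ : 8 * Creg ^ 2 / Criso ≤ 7 * n / 8) (_ : 2 * Creg ≤ 7 * n / 8)
        {x' : V} (_ : x' ∈ ball x₀ (3 * n / 4)) {v : ℝ → V → ℝ}
        (_ : Caloric nbr ω Set.univ (ball x₀ n : Set V) v)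
        (_ : ∀ t x, x ∉ ball x₀ n → v t x = 0)
        (_ : v 0 = fun x => ind {x'} x * (mu nbr ω x)⁻¹),
        ∀ t ∈ Set.Icc (n ^ 2 / 8) (n ^ 2), ∀ x ∈ ball x₀ (3 * n / 4),
          Real.exp (-Λ A) * (n ^ d)⁻¹ ≤ v t x := by
  classical
  obtain ⟨Ce, κe, hCe, hκe, hexit⟩ := exists_exit_bound d hd Creg Criso hCreg hCriso p q hp hq hpq
  obtain ⟨Cm, κm, hCm, hκm, hmv⟩ :=
    exists_meanValue_one d hd Creg Criso hCreg hCriso p q hp hq hpq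
  obtain ⟨Λ₁, bΛ₁, hspread⟩ := exists_spread d hd Creg Criso hCreg hCriso p q hp hq hpq
  set K : ℝ → ℝ := fun A => 2 * Cm * (A * (16 * Ce * A ^ κe)) ^ κm with hK
  have bK : PolyBd K := (PolyBd.const (by positivity)).mul ((PolyBd.id.mul
    ((PolyBd.const (by positivity)).mul (PolyBd.id.rpow (by linarith)))).rpow (by linarith))
  have hK1 : ∀ A, 1 ≤ A → 1 ≤ K A := fun A hA => by
    have h1 : 1 ≤ A ^ κe := Real.one_le_rpow hA (by linarith)
    have h3 : 1 ≤ 16 * Ce * A ^ κe := by nlinarith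
    have h2 : 1 ≤ (A * (16 * Ce * A ^ κe)) ^ κm :=
      Real.one_le_rpow (by nlinarith) (by linarith)
    simp only [hK]
    nlinarith
  set Λ : ℝ → ℝ := fun A => Λ₁ (4 * K A * A) + (16 * Creg ^ 2 * A * K A + 1) with hΛ
  have bΛ : PolyBd Λ := (bΛ₁.comp (((PolyBd.const (by norm_num)).mul bK).mul PolyBd.id)
    (fun A hA => by nlinarith [hK1 A hA])).add
    ((((PolyBd.const (by positivity)).mul PolyBd.id).mul bK).add (PolyBd.const zero_le_one))
  refine ⟨Λ, bΛ, ?_⟩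
  intro V G nbr ball ω h A n x₀ hc hn hr hr1 x' hx' v hv hvout hinit t ht x hx
  have hA := hc.one_le_A
  have hA0 : 0 < A := by linarith
  have hn0 : 0 < n := by linarith
  have hn2 : 1 ≤ n ^ 2 := by nlinarith
  have hnd : 0 < n ^ d := by positivity
  have hKA := hK1 A hA
  set B := ball x₀ n with hB
  have hx'B : x' ∈ B := h.ball_mono x₀ (by linarith) hx'
  have hv0 : ∀ t, 0 ≤ t → ∀ x, 0 ≤ v t x := fun t ht x =>
    h.nonneg_of_caloric hv (fun t x hx => (hvout t x hx).ge) (fun x => by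
      rw [hinit]; exact mul_nonneg (by unfold ind; split_ifs <;> norm_num)
        (inv_nonneg.2 (h.mu_pos x).le)) ht x
  have hmass : ∀ t, 0 ≤ t → ∑ x ∈ B, mu nbr ω x * v t x ≤ 1 := fun t ht =>
    h.sum_mu_mul_le_one hv hvout hv0 hx'B hinit ht
  set θ := 1 / (16 * Ce * A ^ κe) with hθ
  have hAκ : 1 ≤ A ^ κe := Real.one_le_rpow hA (by linarith)
  have hθ0 : 0 < θ := by positivity
  have hθ1 : θ ≤ 1 / 16 := by
    rw [hθ]
    refine one_div_le_one_div_of_le (by norm_num) ?_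
    nlinarith
  set s₁ := θ * n ^ 2 with hs₁
  have hs₁0 : 0 ≤ s₁ := by positivity
  have hs₁1 : s₁ ≤ n ^ 2 / 16 := by rw [hs₁]; nlinarith
  have hhalf : 1 / 2 ≤ ∑ x ∈ ball x₀ (7 * n / 8), mu nbr ω x * v s₁ x := by
    have hsub : ball x₀ (7 * n / 8) ⊆ B := h.ball_mono x₀ (by linarith)
    obtain ⟨g, hg0, hgout, hg⟩ := exists_dirichlet nbr ω B (ind (ball x₀ (7 * n / 8)))
      (fun x hx => by unfold ind; exact if_neg fun h' => hx (hsub h'))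
    have h1 : 1 / 2 ≤ g s₁ x' := hexit h hc hn hθ0 (by
      rw [hθ, mul_one_div, div_le_one (by positivity)]
      nlinarith [mul_pos (by linarith : 0 < Ce) (by linarith : 0 < A ^ κe)]) hg hgout hg0 s₁
      ⟨hs₁0, le_rfl⟩ x' hx'
    have hgn : ∀ s, 0 ≤ s → ∀ x, 0 ≤ g s x := fun s hs x =>
      h.nonneg_of_caloric hg (fun t x hx => (hgout t x hx).ge) (fun x => by
        rw [hg0]; unfold ind; split_ifs <;> norm_num) hs x
    have h2 := h.duality hs₁0 le_rfl (hv.mono (Set.subset_univ _) subset_rfl)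
      (fun s hs => hv0 s hs.1) hg hgout hgn
    simp only [sub_zero, sub_self, hinit, hg0] at h2
    have h3 : ∑ x ∈ B, mu nbr ω x * (ind {x'} x * (mu nbr ω x)⁻¹ * g s₁ x) = g s₁ x' := by
      rw [← sum_ind_singleton_mul hx'B (g s₁)]
      refine sum_congr rfl fun x _ => ?_
      have := (h.mu_pos x).ne'
      field_simp
    rw [h3] at h2
    refine h1.trans (h2.trans (le_of_eq ?_))
    rw [← sum_subset hsub fun x _ hx => by simp [ind, hx]]
    exact sum_congr rfl fun x hx => by simp [ind, hx]
  set Kv := K A * (n ^ d)⁻¹ with hKv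
  have hKv0 : 0 < Kv := by positivity
  have hup : ∀ t ∈ Set.Icc s₁ (n ^ 2), ∀ x ∈ ball x₀ (15 * n / 16), v t x ≤ Kv := by
    intro t ht x hx
    have h1 := hmv h hc hθ0 le_rfl (a := 0) (b := n ^ 2) (hv.mono (Set.subset_univ _) subset_rfl)
      (fun t ht => hv0 t ht.1) t ⟨by simpa using ht.1, ht.2⟩ x
      (h.ball_mono x₀ (by nlinarith) hx)
    refine h1.trans ?_
    have hcs : ContinuousOn (fun s => ∑ x ∈ B, mu nbr ω x * v s x) (Set.Icc 0 (n ^ 2 + 1)) :=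
      (hv.mono (Set.subset_univ _) subset_rfl).continuousOn_sum _
    have h2 : ∫ s in (0 : ℝ)..(n ^ 2 + 1), ∑ x ∈ B, mu nbr ω x * v s x ≤ 2 * n ^ 2 := by
      have h3 := intervalIntegral.integral_mono_on (μ := volume) (g := fun _ => (1 : ℝ))
        (by positivity : (0 : ℝ) ≤ n ^ 2 + 1)
        ((hcs.mono (by rw [Set.uIcc_of_le (by positivity)])).intervalIntegrable)
        intervalIntegrable_const (fun s hs => hmass s hs.1)
      simp only [intervalIntegral.integral_const, smul_eq_mul] at h3
      linarith
    calc _ ≤ Cm * (A / θ) ^ κm * ((n ^ (d + 2))⁻¹ * (2 * n ^ 2)) := by gcongr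
      _ = Kv := by
        have e : A / θ = A * (16 * Ce * A ^ κe) := by rw [hθ]; field_simp
        rw [hKv, e, pow_add]
        simp only [hK]
        field_simp
  set k := 1 / (4 * (Creg ^ 2 * n ^ d * A)) with hk
  have hk0 : 0 < k := by positivity
  have h78 : ball x₀ (7 * n / 8) ⊆ ball x₀ (15 * n / 16) := h.ball_mono x₀ (by linarith)
  have hS := exists_dense_superlevel (F := ball x₀ (7 * n / 8)) (v := v s₁)
    (fun x => (h.mu_pos x).le)
    (fun x hx => hup s₁ ⟨le_rfl, by linarith⟩ x (h78 hx)) hk0.le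
    ((hc.mono h hp hq (h.ball_mono x₀ (by linarith))).sum_mu_le h hp) hhalf
    (by rw [hk]; field_simp; exact le_rfl)
  set S := (ball x₀ (7 * n / 8)).filter (fun x => k ≤ v s₁ x) with hSdef
  have hA' : A ≤ 4 * K A * A := by nlinarith
  set L := Λ A with hL
  have hL' : L = Λ₁ (4 * K A * A) + (16 * Creg ^ 2 * A * K A + 1) := rfl
  have hΛ₁0 : 0 ≤ Λ₁ (4 * K A * A) := by
    obtain ⟨_, _, _, _, hb⟩ := bΛ₁
    exact (hb _ (hA.trans hA')).1
  have hL16 : 0 ≤ 16 * Creg ^ 2 * A * K A := by positivity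
  set ε := 2 * Kv * Real.exp (-L) with hε
  have hε0 : 0 < ε := by positivity
  have hexp : Real.exp (-L) ≤ 1 / 2 := by
    have h1 : 2 ≤ Real.exp L := by linarith [Real.add_one_le_exp L]
    rw [Real.exp_neg, ← one_div]
    exact one_div_le_one_div_of_le two_pos h1
  have hεK : ε ≤ Kv := by rw [hε]; nlinarith
  have hlogε : Real.log ε = Real.log (2 * Kv) - L := by
    rw [hε, Real.log_mul (by positivity) (Real.exp_pos _).ne', Real.log_exp]; ring
  have hI0 : ∀ t ∈ Set.Icc s₁ (n ^ 2), 0 ≤ t := fun t ht => hs₁0.trans ht.1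
  have hfin := hspread h (hc.mono_const h hA') hn hr hr1 (a := s₁) (b := n ^ 2)
    (c := Real.log (2 * Kv)) (L := L) (by linarith) (by linarith) (v := fun t x => v t x + ε)
    ((hv.mono (Set.subset_univ _) (Finset.coe_subset.2 (h.ball_mono x₀ (by linarith)))).add_const ε)
    (fun t ht x => by linarith [hv0 t (hI0 t ht) x])
    (fun t ht x hx => sub_nonneg.2 (Real.log_le_log (by linarith [hv0 t (hI0 t ht) x])
      (by linarith [hup t ht x hx])))
    (fun t ht x hx => by
      have := Real.log_le_log hε0 (by linarith [hv0 t (hI0 t ht) x] : ε ≤ v t x + ε)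
      linarith)
    (S := S) (filter_subset _ _)
    (by
      have h1 : n ^ d ≤ 4 * K A * ∑ x ∈ S, mu nbr ω x := by
        rw [hKv] at hS
        have h2 := mul_le_mul_of_nonneg_left hS (by positivity : 0 ≤ 4 * n ^ d)
        calc n ^ d = 4 * n ^ d * (1 / 4) := by ring
          _ ≤ _ := h2
          _ = _ := by field_simp
      have h3 : 0 ≤ ∑ x ∈ S, mu nbr ω x := sum_nonneg fun x _ => (h.mu_pos x).le
      rw [one_div, inv_mul_le_iff₀ (by positivity)]
      nlinarith [mul_nonneg (by positivity : 0 ≤ 4 * K A) h3])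
    (fun x hx => by
      have h1 : k ≤ v s₁ x + ε := by linarith [(mem_filter.1 hx).2]
      have h2 := Real.log_le_log hk0 h1
      have h3 : Real.log (2 * Kv) - Real.log k = Real.log (8 * Creg ^ 2 * A * K A) := by
        rw [← Real.log_div (by positivity) hk0.ne', hk, hKv]
        congr 1; field_simp; ring
      have h4 := Real.log_le_self (by positivity : 0 ≤ 8 * Creg ^ 2 * A * K A)
      linarith)
    (by linarith) t ⟨by linarith [ht.1], ht.2⟩ x hx
  have ht0 : 0 ≤ t := by linarith [ht.1]
  have h1 : 1 + Real.log ε ≤ Real.log (v t x + ε) := by rw [hlogε]; linarith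
  have h2 : 2 * ε ≤ v t x + ε := by
    rw [Real.le_log_iff_exp_le (by linarith [hv0 t ht0 x]), Real.exp_add, Real.exp_log hε0] at h1
    nlinarith [Real.add_one_le_exp (1 : ℝ)]
  have h3 : Real.exp (-L) * (n ^ d)⁻¹ ≤ ε := by
    rw [hε, hKv]
    have : 0 ≤ Real.exp (-L) * (n ^ d)⁻¹ := by positivity
    nlinarith
  linarith

end Kernel

section LargeScale

variable {d : ℕ} {Creg Criso : ℝ} {V : Type} {G : SimpleGraph V} {nbr : V → Finset V}
  {ball : V → ℝ → Finset V} {ω : V → V → ℝ}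

lemma PolyBd.apply_nonneg {f : ℝ → ℝ} (hf : PolyBd f) {A : ℝ} (hA : 1 ≤ A) : 0 ≤ f A := by
  obtain ⟨_, _, _, _, hb⟩ := hf
  exact (hb A hA).1

/-- The Harnack inequality at large scales. -/
lemma exists_harnack_large (d : ℕ) (hd : 2 ≤ d) (Creg Criso : ℝ) (hCreg : 0 < Creg)
    (hCriso : 0 < Criso) (p q : ℝ) (hp : 1 < p) (hq : 1 < q) (hpq : 1 / p + 1 / q < 2 / (d : ℝ)) :
    ∃ Λ : ℝ → ℝ, PolyBd Λ ∧
      ∀ {V : Type} {G : SimpleGraph V} {nbr : V → Finset V} {ball : V → ℝ → Finset V}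
        {ω : V → V → ℝ} (_ : Env d Creg Criso G nbr ball ω) {A n : ℝ} {x₀ : V}
        (_ : Ctrl d p q Creg A n (ball x₀ n) nbr ω) (_ : 32 ≤ n)
        (_ : 8 * Creg ^ 2 / Criso ≤ 7 * n / 8) (_ : 2 * Creg ≤ 7 * n / 8)
        {t₀ : ℝ} {u : ℝ → V → ℝ} (_ : ∀ t ∈ Set.Icc t₀ (t₀ + n ^ 2), ∀ x, 0 < u t x)
        (_ : Caloric nbr ω (Set.Icc t₀ (t₀ + n ^ 2)) (ball x₀ n : Set V) u),
        ∀ t ∈ Set.Icc (t₀ + n ^ 2 / 4) (t₀ + n ^ 2 / 2), ∀ x ∈ ball x₀ (n / 2),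
        ∀ t' ∈ Set.Icc (t₀ + 3 * n ^ 2 / 4) (t₀ + n ^ 2), ∀ x' ∈ ball x₀ (n / 2),
          u t x ≤ Real.exp (Λ A) * u t' x' := by
  classical
  obtain ⟨Cm, κm, hCm, hκm, hmv⟩ :=
    exists_meanValue_one d hd Creg Criso hCreg hCriso p q hp hq hpq
  obtain ⟨Λ, bΛ, hker⟩ := exists_kernel_lower d hd Creg Criso hCreg hCriso p q hp hq hpq
  refine ⟨fun A => Cm * (A / (1 / 4)) ^ κm + Λ A,
    ((PolyBd.const (by linarith)).mul ((PolyBd.id.mul (PolyBd.const (c := (1 / 4)⁻¹)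
      (by norm_num))).rpow (by linarith))).add bΛ, ?_⟩
  intro V G nbr ball ω h A n x₀ hc hn hr hr1 t₀ u hu0 hu t ht x hx t' ht' x' hx'
  have hA := hc.one_le_A
  have hn2 : 32 * n ≤ n ^ 2 := by nlinarith
  have hn0 : 0 < n := by linarith
  have hsub : ball x₀ (3 * n / 4) ⊆ ball x₀ n := h.ball_mono x₀ (by linarith)
  have hx'3 : x' ∈ ball x₀ (3 * n / 4) := h.ball_mono x₀ (by linarith) hx'
  have hx'B := hsub hx'3
  have ht'0 : 0 < u t' x' := hu0 t' ⟨by linarith [ht'.1], ht'.2⟩ x'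
  obtain ⟨v, hv0, hvout, hv⟩ := exists_dirichlet nbr ω (ball x₀ n)
    (fun x => ind {x'} x * (mu nbr ω x)⁻¹) (fun x hx => by
      have : x ≠ x' := fun e => hx (e ▸ hx'B)
      simp [ind, this])
  have hvn : ∀ s, 0 ≤ s → ∀ x, 0 ≤ v s x := fun s hs x =>
    h.nonneg_of_caloric hv (fun t x hx => (hvout t x hx).ge) (fun x => by
      rw [hv0]; exact mul_nonneg (by unfold ind; split_ifs <;> norm_num)
        (inv_nonneg.2 (h.mu_pos x).le)) hs x
  have hlow := hker h hc hn hr hr1 hx'3 hv hvout hv0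
  set E := Real.exp (-Λ A) * (n ^ d)⁻¹ with hE
  have hE0 : 0 < E := by positivity
  have hmass : ∀ s ∈ Set.Icc t₀ (t₀ + n ^ 2 / 2 + 1),
      ∑ y ∈ ball x₀ (3 * n / 4), mu nbr ω y * u s y ≤ u t' x' / E := by
    intro s hs
    have hst : s ≤ t' := by linarith [hs.2, ht'.1]
    have hI : Set.Icc s t' ⊆ Set.Icc t₀ (t₀ + n ^ 2) := Set.Icc_subset_Icc hs.1 ht'.2
    have h1 := h.duality hst le_rfl (hu.mono hI subset_rfl)
      (fun r hr y => (hu0 r (hI hr) y).le) hv hvout hvn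
    rw [sub_self, hv0] at h1
    have h2 : ∑ y ∈ ball x₀ n, mu nbr ω y * (u t' y * (ind {x'} y * (mu nbr ω y)⁻¹)) = u t' x' := by
      rw [← sum_ind_singleton_mul hx'B (u t')]
      refine sum_congr rfl fun y _ => ?_
      have := (h.mu_pos y).ne'
      field_simp
    rw [h2] at h1
    rw [le_div_iff₀ hE0, sum_mul]
    refine le_trans ?_ (le_trans (sum_le_sum_of_subset_of_nonneg hsub fun y _ _ =>
      mul_nonneg (h.mu_pos y).le (mul_nonneg (hu0 s (hI ⟨le_rfl, hst⟩) y).le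
        (hvn _ (by linarith) y))) h1)
    refine sum_le_sum fun y hy => ?_
    rw [mul_assoc]
    have := hlow (t' - s) ⟨by linarith [hs.2, ht'.1], by linarith [hs.1, ht'.2]⟩ y hy
    have h3 := (h.mu_pos y).le
    have h4 := (hu0 s (hI ⟨le_rfl, hst⟩) y).le
    gcongr
  have hIb : Set.Icc t₀ (t₀ + n ^ 2 / 2 + 1) ⊆ Set.Icc t₀ (t₀ + n ^ 2) :=
    Set.Icc_subset_Icc le_rfl (by linarith)
  have hu' : Caloric nbr ω (Set.Icc t₀ (t₀ + n ^ 2 / 2 + 1)) (ball x₀ (3 * n / 4) : Set V) u :=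
    hu.mono hIb (Finset.coe_subset.2 hsub)
  have h1 := hmv h hc (θ := 1 / 4) (R := 3 * n / 4) (by norm_num) (by linarith) hu'
    (fun s hs y => (hu0 s (hIb hs) y).le) t ⟨by linarith [ht.1], ht.2⟩ x
    (h.ball_mono x₀ (by linarith) hx)
  have h2 : ∫ s in t₀..(t₀ + n ^ 2 / 2 + 1), ∑ y ∈ ball x₀ (3 * n / 4), mu nbr ω y * u s y ≤
      n ^ 2 * (u t' x' / E) := by
    have hle : t₀ ≤ t₀ + n ^ 2 / 2 + 1 := by linarith
    have h3 := intervalIntegral.integral_mono_on (μ := volume) (g := fun _ => u t' x' / E) hle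
      (((hu'.continuousOn_sum (mu nbr ω)).mono (by rw [Set.uIcc_of_le hle])).intervalIntegrable)
      intervalIntegrable_const hmass
    simp only [intervalIntegral.integral_const, smul_eq_mul] at h3
    refine h3.trans (mul_le_mul_of_nonneg_right (by linarith) (by positivity))
  set K := Cm * (A / (1 / 4)) ^ κm with hK
  have hK0 : 0 ≤ K := by positivity
  calc u t x ≤ K * ((n ^ (d + 2))⁻¹ * (n ^ 2 * (u t' x' / E))) := by
        refine h1.trans ?_
        gcongr
    _ = K * Real.exp (Λ A) * u t' x' := by
        rw [hE, Real.exp_neg, pow_add]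
        field_simp
    _ ≤ Real.exp K * Real.exp (Λ A) * u t' x' := by
        have := Real.add_one_le_exp K
        gcongr
        linarith
    _ = _ := by rw [← Real.exp_add]

end LargeScale

section SmallScale

variable {d : ℕ} {Creg Criso : ℝ} {V : Type} {G : SimpleGraph V} {nbr : V → Finset V}
  {ball : V → ℝ → Finset V} {ω : V → V → ℝ}

/-- Comparison of the values of a nonnegative caloric function at adjacent vertices. -/
lemma Env.caloric_step (h : Env d Creg Criso G nbr ball ω) {a b : ℝ} {B : Set V}
    {u : ℝ → V → ℝ} (hu : Caloric nbr ω (Set.Icc a b) B u)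
    (hu0 : ∀ t ∈ Set.Icc a b, ∀ x, 0 ≤ u t x) {x y : V} (hx : x ∈ B) (hy : y ∈ B)
    (hxy : G.Adj x y) {δ : ℝ} (hδ0 : 0 ≤ δ) (hδ : δ ≤ (mu nbr ω y)⁻¹ * ω y x) {t τ : ℝ}
    (hta : a ≤ t) (hτ : 0 ≤ τ) (htb : t + τ ≤ b) :
    τ * δ * (Real.exp t * u t x) ≤ Real.exp (t + τ) * u (t + τ) y := by
  have hI : Set.Icc t (t + τ) ⊆ Set.Icc a b := Set.Icc_subset_Icc hta htb
  have htI : t ∈ Set.Icc t (t + τ) := ⟨le_rfl, by linarith⟩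
  set c := δ * (Real.exp t * u t x) with hc
  have hder : ∀ s ∈ Set.Icc t (t + τ), HasDerivAt (fun s => Real.exp s * u s y - c * s)
      (Real.exp s * ((mu nbr ω y)⁻¹ * ∑ z ∈ nbr y, ω y z * u s z) - c * 1) s := fun s hs =>
    (h.hasDerivAt_exp_mul hu hy (hI hs)).sub ((hasDerivAt_id s).const_mul c)
  have hmono : MonotoneOn (fun s => Real.exp s * u s y - c * s) (Set.Icc t (t + τ)) := by
    refine monotoneOn_of_hasDerivWithinAt_nonneg (convex_Icc _ _)
      (fun s hs => (hder s hs).continuousAt.continuousWithinAt)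
      (fun s hs => (hder s (interior_subset hs)).hasDerivWithinAt) fun s hs => ?_
    have hs' := interior_subset hs
    have h1 : Real.exp t * u t x ≤ Real.exp s * u s x :=
      h.monotoneOn_exp_mul hu hu0 hx (hI htI) (hI hs') hs'.1
    have h2 : ω y x * u s x ≤ ∑ z ∈ nbr y, ω y z * u s z :=
      single_le_sum (f := fun z => ω y z * u s z)
        (fun z _ => mul_nonneg (h.omega_nonneg y z) (hu0 s (hI hs') z))
        ((h.mem_nbr y x).2 hxy.symm)
    have hm := inv_nonneg.2 (h.mu_pos y).le
    have h3 : 0 ≤ Real.exp s * u s x := mul_nonneg (Real.exp_nonneg _) (hu0 s (hI hs') x)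
    have h4 := Real.exp_nonneg s
    rw [sub_nonneg, mul_one]
    calc c ≤ δ * (Real.exp s * u s x) := by rw [hc]; gcongr
      _ ≤ (mu nbr ω y)⁻¹ * ω y x * (Real.exp s * u s x) := by gcongr
      _ = Real.exp s * ((mu nbr ω y)⁻¹ * (ω y x * u s x)) := by ring
      _ ≤ _ := by gcongr
  have h5 := hmono htI ⟨by linarith, le_rfl⟩ (by linarith : t ≤ t + τ)
  simp only at h5
  have h6 : 0 ≤ Real.exp t * u t y := mul_nonneg (Real.exp_nonneg _) (hu0 t (hI htI) y)
  have h7 : τ * δ * (Real.exp t * u t x) = c * τ := by rw [hc]; ring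
  rw [h7]
  linarith

lemma Env.caloric_chain (h : Env d Creg Criso G nbr ball ω) {a b : ℝ} {B : Set V}
    {u : ℝ → V → ℝ} (hu : Caloric nbr ω (Set.Icc a b) B u)
    (hu0 : ∀ t ∈ Set.Icc a b, ∀ x, 0 ≤ u t x) {δ τ : ℝ} (hδ0 : 0 ≤ δ) (hτ : 0 ≤ τ)
    (hδ : ∀ x ∈ B, ∀ y ∈ B, G.Adj x y → δ ≤ (mu nbr ω y)⁻¹ * ω y x) {x y : V} (w : G.Walk x y) :
    (∀ z ∈ w.support, z ∈ B) → ∀ t, a ≤ t → t + w.length * τ ≤ b →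
      (τ * δ) ^ w.length * (Real.exp t * u t x) ≤
        Real.exp (t + w.length * τ) * u (t + w.length * τ) y := by
  induction w with
  | nil => intro _ t _ _; simp
  | @cons x z y hxz w ih =>
    intro hw t ht htb
    simp only [SimpleGraph.Walk.length_cons, Nat.cast_add, Nat.cast_one] at htb ⊢
    have hl : 0 ≤ (w.length : ℝ) * τ := by positivity
    have hxB : x ∈ B := hw x (by simp)
    have hzB : z ∈ B := hw z (by simp)
    have h1 := h.caloric_step hu hu0 hxB hzB hxz hδ0 (hδ x hxB z hzB hxz) ht hτ
      (by linarith : t + τ ≤ b)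
    have h2 := ih (fun v hv => hw v (by simp [hv])) (t + τ) (by linarith) (by linarith)
    have e : t + τ + w.length * τ = t + (w.length + 1) * τ := by ring
    rw [e] at h2
    refine le_trans ?_ h2
    rw [pow_succ, mul_assoc]
    gcongr

/-- Two points of a ball are joined inside the ball by a path through the center. -/
lemma Env.exists_walk (h : Env d Creg Criso G nbr ball ω) {x₀ x y : V} {r : ℝ}
    (hx : x ∈ ball x₀ r) (hy : y ∈ ball x₀ r) :
    ∃ w : G.Walk x y, (∀ z ∈ w.support, z ∈ ball x₀ r) ∧ (w.length : ℝ) ≤ 2 * r := by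
  classical
  have key : ∀ x, x ∈ ball x₀ r → ∃ w : G.Walk x₀ x, (∀ z ∈ w.support, z ∈ ball x₀ r) ∧
      (w.length : ℝ) ≤ r := fun x hx => by
    obtain ⟨w, hw⟩ := h.conn.exists_walk_length_eq_dist x₀ x
    have hr := (h.mem_ball x₀ r x).1 hx
    rw [← hw] at hr
    refine ⟨w, fun z hz => (h.mem_ball x₀ r z).2 (le_trans ?_ hr), hr⟩
    exact_mod_cast (SimpleGraph.dist_le (w.takeUntil z hz)).trans (w.length_takeUntil_le_length hz)
  obtain ⟨w₁, h₁, l₁⟩ := key x hx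
  obtain ⟨w₂, h₂, l₂⟩ := key y hy
  refine ⟨w₁.reverse.append w₂, fun z hz => ?_, ?_⟩
  · rw [SimpleGraph.Walk.mem_support_append_iff, SimpleGraph.Walk.support_reverse,
      List.mem_reverse] at hz
    exact hz.elim (h₁ z) (h₂ z)
  · rw [SimpleGraph.Walk.length_append, SimpleGraph.Walk.length_reverse]
    push_cast
    linarith

/-- The Harnack inequality at bounded scales. -/
lemma exists_harnack_small (d : ℕ) (Creg Criso : ℝ) (hCreg : 0 < Creg)
    (p q : ℝ) (hp : 1 < p) (hq : 1 < q) {N : ℝ} (hN : 1 ≤ N) :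
    ∃ Λ : ℝ → ℝ, PolyBd Λ ∧
      ∀ {V : Type} {G : SimpleGraph V} {nbr : V → Finset V} {ball : V → ℝ → Finset V}
        {ω : V → V → ℝ} (_ : Env d Creg Criso G nbr ball ω) {A n : ℝ} {x₀ : V}
        (_ : Ctrl d p q Creg A n (ball x₀ n) nbr ω) (_ : n ≤ N)
        {t₀ : ℝ} {u : ℝ → V → ℝ} (_ : ∀ t ∈ Set.Icc t₀ (t₀ + n ^ 2), ∀ x, 0 < u t x)
        (_ : Caloric nbr ω (Set.Icc t₀ (t₀ + n ^ 2)) (ball x₀ n : Set V) u),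
        ∀ t ∈ Set.Icc (t₀ + n ^ 2 / 4) (t₀ + n ^ 2 / 2), ∀ x ∈ ball x₀ (n / 2),
        ∀ t' ∈ Set.Icc (t₀ + 3 * n ^ 2 / 4) (t₀ + n ^ 2), ∀ x' ∈ ball x₀ (n / 2),
          u t x ≤ Real.exp (Λ A) * u t' x' := by
  set D : ℝ → ℝ := fun A => 8 * (Creg * N ^ d * A) ^ 2 with hD
  have bD : PolyBd D := (PolyBd.const (by norm_num)).mul
    (((PolyBd.const (by positivity)).mul PolyBd.id).pow 2)
  refine ⟨fun A => D A ^ ⌈N⌉₊ + N ^ 2, (bD.pow _).add (PolyBd.const (by positivity)), ?_⟩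
  intro V G nbr ball ω h A n x₀ hc hnN t₀ u hu0 hu t ht x hx t' ht' x' hx'
  have hA := hc.one_le_A
  have hn := hc.one_le_n
  have hu0' : ∀ t ∈ Set.Icc t₀ (t₀ + n ^ 2), ∀ x, 0 ≤ u t x := fun t ht x => (hu0 t ht x).le
  set m := Creg * N ^ d * A with hm
  have hm1 : 1 ≤ m := by
    have h1 : 1 ≤ N ^ d := one_le_pow₀ hN
    have h2 := h.one_le_Creg
    have h3 : 1 ≤ Creg * N ^ d := by nlinarith
    rw [hm]
    nlinarith
  have hmn : Creg * n ^ d * A ≤ m := by rw [hm]; gcongr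
  obtain ⟨w, hw, hl⟩ := h.exists_walk hx hx'
  have hsub : ball x₀ (n / 2) ⊆ ball x₀ n := h.ball_mono x₀ (by linarith)
  have hδ : ∀ x ∈ (ball x₀ n : Set V), ∀ y ∈ (ball x₀ n : Set V), G.Adj x y →
      (m ^ 2)⁻¹ ≤ (mu nbr ω y)⁻¹ * ω y x := by
    intro x hx y hy hxy
    have h1 := (hc.mu_apply_le h hp (Finset.mem_coe.1 hy)).trans hmn
    have h2 := (h.inv_omega_le_nu hxy.symm).trans
      ((hc.nu_apply_le h hq (Finset.mem_coe.1 hy)).trans hmn)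
    have hω := h.pos y x hxy.symm
    have h3 : m⁻¹ ≤ ω y x := by rwa [inv_le_comm₀ (by positivity) hω]
    have h4 : m⁻¹ ≤ (mu nbr ω y)⁻¹ := inv_anti₀ (h.mu_pos y) h1
    rw [pow_two, mul_inv]
    exact mul_le_mul h4 h3 (by positivity) (inv_nonneg.2 (h.mu_pos y).le)
  set l : ℝ := (w.length : ℝ) with hldef
  have hl0 : 0 ≤ l := by positivity
  set τ := (t' - t) / (l + 1) with hτ
  have htt : n ^ 2 / 4 ≤ t' - t := by linarith [ht.2, ht'.1]
  have hτ8 : 1 / 8 ≤ τ := by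
    rw [hτ, le_div_iff₀ (by positivity)]
    nlinarith
  have hlτ : l * τ ≤ t' - t := by
    rw [hτ, mul_div_assoc', div_le_iff₀ (by positivity)]
    nlinarith [sq_nonneg n]
  have h1 := h.caloric_chain hu hu0' (δ := (m ^ 2)⁻¹) (τ := τ) (by positivity) (by linarith) hδ w
    (fun z hz => Finset.mem_coe.2 (hsub (hw z hz))) t (by linarith [ht.1, sq_nonneg n])
    (by linarith [ht'.2])
  have hlt : 0 ≤ l * τ := mul_nonneg hl0 (by linarith)
  have h2 : Real.exp (t + l * τ) * u (t + l * τ) x' ≤ Real.exp t' * u t' x' :=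
    h.monotoneOn_exp_mul hu hu0' (x := x') (Finset.mem_coe.2 (hsub hx'))
      ⟨by linarith [ht.1, sq_nonneg n], by linarith [ht'.2]⟩
      ⟨by linarith [ht'.1, sq_nonneg n], ht'.2⟩ (by linarith)
  have h3 := h1.trans h2
  have hD1 : 1 ≤ 8 * m ^ 2 := by nlinarith
  have hut : 0 < u t x := hu0 t ⟨by linarith [ht.1, sq_nonneg n], by linarith [ht.2, sq_nonneg n]⟩ x
  have hut' : 0 < u t' x' := hu0 t' ⟨by linarith [ht'.1, sq_nonneg n], ht'.2⟩ x'
  have h4 : ((8 * m ^ 2) ^ ⌈N⌉₊)⁻¹ ≤ (τ * (m ^ 2)⁻¹) ^ w.length := by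
    have h5 : w.length ≤ ⌈N⌉₊ := by
      have : (w.length : ℝ) ≤ (⌈N⌉₊ : ℝ) := by linarith [Nat.le_ceil N]
      exact_mod_cast this
    calc ((8 * m ^ 2) ^ ⌈N⌉₊)⁻¹ ≤ ((8 * m ^ 2) ^ w.length)⁻¹ := by gcongr
      _ = (1 / 8 * (m ^ 2)⁻¹) ^ w.length := by rw [← inv_pow, mul_inv, one_div]
      _ ≤ _ := by gcongr
  set P := (8 * m ^ 2) ^ ⌈N⌉₊ with hP
  have hP0 : 0 < P := by positivity
  have h6 : P⁻¹ * (Real.exp t * u t x) ≤ Real.exp t' * u t' x' :=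
    le_trans (by gcongr) h3
  rw [inv_mul_le_iff₀ hP0] at h6
  have h7 : u t x ≤ P * Real.exp (t' - t) * u t' x' := by
    refine le_of_mul_le_mul_left (h6.trans (le_of_eq ?_)) (Real.exp_pos t)
    have : Real.exp t' = Real.exp t * Real.exp (t' - t) := by rw [← Real.exp_add]; ring_nf
    rw [this]; ring
  refine h7.trans (mul_le_mul_of_nonneg_right ?_ hut'.le)
  change _ ≤ Real.exp (P + N ^ 2)
  rw [Real.exp_add]
  have h8 : t' - t ≤ N ^ 2 := by nlinarith [ht.1, ht'.2]
  have h9 := Real.add_one_le_exp P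
  gcongr
  linarith

end SmallScale

section Assembly

variable {d : ℕ} {Creg Criso : ℝ} {V : Type} {G : SimpleGraph V} {nbr : V → Finset V}
  {ball : V → ℝ → Finset V} {ω : V → V → ℝ}

lemma rpow_sum_le_of_nrm {F : Finset V} {f : V → ℝ} (hf : ∀ x, 0 ≤ f x) {r C m A : ℝ}
    (hr : 1 < r) (hC : 1 ≤ C) (hm : 0 ≤ m) (hF0 : F.Nonempty) (hF : (F.card : ℝ) ≤ C * m)
    (hA : nrm F r f ≤ A) :
    (∑ x ∈ F, f x ^ r) ^ (1 / r) ≤ C * m ^ (1 / r) * A := by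
  have hr0 : 0 ≤ 1 / r := by positivity
  have hr1 : 1 / r ≤ 1 := by rw [div_le_one (by linarith)]; exact hr.le
  have hcard : (0 : ℝ) < F.card := by exact_mod_cast hF0.card_pos
  have hsum : 0 ≤ ∑ x ∈ F, f x ^ r := sum_nonneg fun x _ => Real.rpow_nonneg (hf x) r
  have e : (∑ x ∈ F, f x ^ r) ^ (1 / r) = (F.card : ℝ) ^ (1 / r) * nrm F r f := by
    simp only [nrm, abs_of_nonneg (hf _)]
    rw [← Real.mul_rpow hcard.le (by positivity), mul_inv_cancel_left₀ hcard.ne']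
  have hn : 0 ≤ nrm F r f := Real.rpow_nonneg (mul_nonneg (by positivity)
    (sum_nonneg fun x _ => Real.rpow_nonneg (abs_nonneg _) r)) _
  rw [e]
  refine mul_le_mul ?_ hA hn (by positivity)
  calc (F.card : ℝ) ^ (1 / r) ≤ (C * m) ^ (1 / r) := by gcongr
    _ = C ^ (1 / r) * m ^ (1 / r) := Real.mul_rpow (by linarith) hm
    _ ≤ C * m ^ (1 / r) := by
        gcongr
        exact (Real.rpow_le_rpow_of_exponent_le hC hr1).trans_eq (Real.rpow_one C)

lemma Env.ctrl_of_nrm (h : Env d Creg Criso G nbr ball ω) {p q A n : ℝ} (hp : 1 < p) (hq : 1 < q)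
    {x₀ : V} (hn : 1 ≤ n) (hA : 1 ≤ A) (hμ : nrm (ball x₀ n) p (mu nbr ω) ≤ A)
    (hν : nrm (ball x₀ n) q (nu nbr ω) ≤ A) : Ctrl d p q Creg A n (ball x₀ n) nbr ω := by
  have hne : (ball x₀ n).Nonempty := ⟨x₀, by rw [h.mem_ball]; simp; linarith⟩
  have hcard := (h.vol x₀ n hn).2
  have hnd : 0 ≤ n ^ d := by positivity
  exact ⟨hA, hn,
    rpow_sum_le_of_nrm (fun x => (h.mu_pos x).le) hp h.one_le_Creg hnd hne hcard hμ,
    rpow_sum_le_of_nrm (fun x => (h.nu_pos x).le) hq h.one_le_Creg hnd hne hcard hν, hcard⟩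

end Assembly

end RCM

open RCM in
/-- **Parabolic Harnack inequality.** -/
theorem parabolic_harnack_inequality
    (d : ℕ) (hd : 2 ≤ d) (Creg Criso : ℝ) (hCreg : 0 < Creg) (hCriso : 0 < Criso)
    (p q : ℝ) (hp : 1 < p) (hq : 1 < q) (hpq : 1 / p + 1 / q < 2 / (d : ℝ)) :
    ∃ c₁ c₂ κ : ℝ, 0 < c₁ ∧ 0 < c₂ ∧ 0 < κ ∧
      ∀ (V : Type) (G : SimpleGraph V) (nbr : V → Finset V)
        (_ : ∀ x y, y ∈ nbr x ↔ G.Adj x y)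
        (_ : Infinite V) (_ : G.Connected)
        (ball : V → ℝ → Finset V)
        (_ : ∀ (x : V) (r : ℝ) (y : V), y ∈ ball x r ↔ (G.dist x y : ℝ) ≤ r)
        (_ : ∀ (x : V) (r : ℝ), 1 ≤ r →
              Creg⁻¹ * r ^ d ≤ ((ball x r).card : ℝ) ∧ ((ball x r).card : ℝ) ≤ Creg * r ^ d)
        (_ : ∀ (x : V) (r : ℝ) (A : Finset V), 1 ≤ r → A.Nonempty → A ⊆ ball x r →
              (A.card : ℝ) < ((ball x r).card : ℝ) / 2 →
              Criso / r ≤ ((RCM.relBdry G (ball x r) A).card : ℝ) / (A.card : ℝ))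
        (ω : V → V → ℝ)
        (_ : ∀ x y, ω x y = ω y x)
        (_ : ∀ x y, G.Adj x y → 0 < ω x y)
        (_ : ∀ x y, ¬ G.Adj x y → ω x y = 0)
        (x₀ : V) (t₀ n : ℝ) (_ : 0 ≤ t₀) (_ : 1 ≤ n)
        (u : ℝ → V → ℝ)
        (_ : ∀ t ∈ Set.Icc t₀ (t₀ + n ^ 2), ∀ x, 0 < u t x)
        (_ : Caloric nbr ω (Set.Icc t₀ (t₀ + n ^ 2)) (ball x₀ n : Set V) u),
        ∀ t ∈ Set.Icc (t₀ + n ^ 2 / 4) (t₀ + n ^ 2 / 2), ∀ x ∈ ball x₀ (n / 2),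
        ∀ t' ∈ Set.Icc (t₀ + 3 * n ^ 2 / 4) (t₀ + n ^ 2), ∀ x' ∈ ball x₀ (n / 2),
          u t x ≤ c₁ * Real.exp (c₂ *
              (max 1 (nrm (ball x₀ n) 1 (mu nbr ω) / nrm (ball x₀ (n / 2)) 1 (mu nbr ω)) *
               max 1 (nrm (ball x₀ n) p (mu nbr ω)) *
               max 1 (nrm (ball x₀ n) q (nu nbr ω))) ^ κ) * u t' x' := by
  obtain ⟨Λ₁, b₁, h₁⟩ := exists_harnack_large d hd Creg Criso hCreg hCriso p q hp hq hpq
  set N := 32 + 8 / 7 * (8 * Creg ^ 2 / Criso) + 8 / 7 * (2 * Creg) with hN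
  have hr₁ : 0 ≤ 8 * Creg ^ 2 / Criso := by positivity
  obtain ⟨Λ₂, b₂, h₂⟩ := exists_harnack_small d Creg Criso hCreg p q hp hq
    (by linarith : 1 ≤ N)
  obtain ⟨C, κ, hC, hκ, hb⟩ := b₁.add b₂
  refine ⟨1, C, κ, one_pos, by linarith, by linarith, ?_⟩
  intro V G nbr hnbr hinf hconn ball hball hvol hiso ω hsymm hpos hzero x₀ t₀ n _ hn u hu0 hu
    t ht x hx t' ht' x' hx'
  have h : Env d Creg Criso G nbr ball ω :=
    ⟨hd, hCreg, hCriso, hnbr, hinf, hconn, hball, hvol, hiso, hsymm, hpos, hzero⟩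
  set a := max 1 (nrm (ball x₀ n) p (mu nbr ω)) with ha
  set b := max 1 (nrm (ball x₀ n) q (nu nbr ω)) with hb'
  set M := max 1 (nrm (ball x₀ n) 1 (mu nbr ω) / nrm (ball x₀ (n / 2)) 1 (mu nbr ω)) with hM
  have ha1 : 1 ≤ a := le_max_left _ _
  have hb1 : 1 ≤ b := le_max_left _ _
  have hM1 : 1 ≤ M := le_max_left _ _
  have haA : a ≤ M * a * b := by nlinarith [mul_nonneg (sub_nonneg.2 hM1) (sub_nonneg.2 hb1)]
  have hbA : b ≤ M * a * b := le_mul_of_one_le_left (by linarith) (by nlinarith)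
  set A := M * a * b with hA
  have hA1 : 1 ≤ A := ha1.trans haA
  have hc : Ctrl d p q Creg A n (ball x₀ n) nbr ω := h.ctrl_of_nrm hp hq hn hA1
    ((le_max_right _ _).trans haA) ((le_max_right _ _).trans hbA)
  have hΛ₁ := b₁.apply_nonneg hA1
  have hΛ₂ := b₂.apply_nonneg hA1
  have hle : u t x ≤ Real.exp (Λ₁ A + Λ₂ A) * u t' x' := by
    have hu' : 0 < u t' x' := hu0 t' ⟨by linarith [ht'.1, sq_nonneg n], ht'.2⟩ x'
    rcases le_total n N with hnN | hnN
    · refine (h₂ h hc hnN hu0 hu t ht x hx t' ht' x' hx').trans ?_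
      gcongr
      linarith
    · refine (h₁ h hc (by linarith) (by linarith) (by linarith) hu0 hu t ht x hx t' ht' x'
        hx').trans ?_
      gcongr
      linarith
  refine hle.trans (mul_le_mul_of_nonneg_right ?_ ?_)
  · rw [one_mul]
    exact Real.exp_le_exp.2 (hb A hA1).2
  · exact (hu0 t' ⟨by linarith [ht'.1, sq_nonneg n], ht'.2⟩ x').le
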